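/- Let b : [0,T] × T^d → R^d be a Borel, divergence-free vector field, and let p, q ∈ (1,∞] satisfy the Prodi–Serrin condition d/p + 2/q < 1. Assume b ∈ L^q((0,T); L^p(T^d;R^d)) and b ∈ L^1_loc((0,T]; BV(T^d;R^d)). Then there exists a unique Borel probability measure η on Γ_T such that (i) η is concentrated on integral curves of b, and (ii) (e_t)_#η = L^d for every t ∈ [0,T]. -/

import Mathlib

open MeasureTheory Set Filter Topology
open scoped ENNReal

noncomputable section

/-- The `d`-dimensional flat torus `ℝ^d/ℤ^d`. -/
abbrev Torus (d : ℕ) : Type := Fin d → AddCircle (1 : ℝ)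

/-- Values of vector fields: `ℝ^d` with the Euclidean norm. -/
abbrev Vec (d : ℕ) : Type := EuclideanSpace ℝ (Fin d)

/-- The canonical projection `ℝ^d → 𝕋^d`. -/
def projT (d : ℕ) (x : Vec d) : Torus d := fun i => (x i : AddCircle (1 : ℝ))

/-- The path space `Γ_T = C([0,T]; 𝕋^d)` with the supremum metric. -/
abbrev PathSpace (T : ℝ) (d : ℕ) : Type := C(Set.Icc (0 : ℝ) T, Torus d)

instance (T : ℝ) (d : ℕ) : MeasurableSpace (PathSpace T d) := borel _
instance (T : ℝ) (d : ℕ) : BorelSpace (PathSpace T d) := ⟨rfl⟩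

/-- Extension of a path `γ : [0,T] → 𝕋^d` to all of `ℝ` by projection onto `[0,T]`. -/
def extendPath {T : ℝ} {d : ℕ} (hT : 0 ≤ T) (γ : PathSpace T d) : ℝ → Torus d :=
  fun s => γ (Set.projIcc 0 T hT s)

/-- `γ` is an integral curve of `b`:  `s ↦ b(s,γ(s))` is integrable on `(0,T)` and
`γ(t) = γ(0) + ∫_0^t b(s,γ(s)) ds` for all `t ∈ [0,T]`, the integral computed in `ℝ^d`
and projected to the torus. -/
def IsIntegralCurveOf {T : ℝ} {d : ℕ} (hT : 0 ≤ T) (b : ℝ → Torus d → Vec d)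
    (γ : PathSpace T d) : Prop :=
  MeasureTheory.IntegrableOn (fun s => b s (extendPath hT γ s)) (Set.Ioc 0 T) volume ∧
  ∀ t : Set.Icc (0 : ℝ) T,
    γ t = γ ⟨0, Set.left_mem_Icc.2 hT⟩
      + projT d (∫ s in Set.Ioc (0 : ℝ) (t : ℝ), b s (extendPath hT γ s))

/-- `η` is concentrated on integral curves of `b`. -/
def ConcentratedOnCurves {T : ℝ} {d : ℕ} (hT : 0 ≤ T) (b : ℝ → Torus d → Vec d)
    (η : Measure (PathSpace T d)) : Prop :=
  ∀ᵐ γ ∂η, IsIntegralCurveOf hT b γ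

/-- `{k y}_{y}` is a disintegration of `μ` with respect to `f` and `ν`:
a Borel family of measures, with `k y` concentrated on `f⁻¹(y)` and
`μ(A) = ∫ k y (A) dν(y)` for every Borel set `A`. -/
def IsDisintegration {X Y : Type*} [MeasurableSpace X] [MeasurableSpace Y]
    (μ : Measure X) (f : X → Y) (ν : Measure Y) (k : Y → Measure X) : Prop :=
  (∀ A : Set X, MeasurableSet A → Measurable fun y => k y A) ∧
  (∀ y : Y, k y ((f ⁻¹' {y})ᶜ) = 0) ∧
  (∀ A : Set X, MeasurableSet A → μ A = ∫⁻ y, k y A ∂ν)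

/-- A disintegration consisting of probability measures. -/
def IsProbDisintegration {X Y : Type*} [MeasurableSpace X] [MeasurableSpace Y]
    (μ : Measure X) (f : X → Y) (ν : Measure Y) (k : Y → Measure X) : Prop :=
  (∀ y : Y, IsProbabilityMeasure (k y)) ∧ IsDisintegration μ f ν k

/-- The fundamental domain `[0,1)^d ⊂ ℝ^d` of the torus. -/
def unitCube (d : ℕ) : Set (Vec d) := {x | ∀ i, x i ∈ Set.Ico (0 : ℝ) 1}

/-- `b` is divergence-free: for a.e. `t ∈ (0,T)`, `∫_{𝕋^d} b(t,·)·∇φ = 0` for every smooth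
`ℤ^d`-periodic test function `φ` (the torus integral written over the fundamental domain). -/
def DivergenceFree (T : ℝ) (d : ℕ) (b : ℝ → Torus d → Vec d) : Prop :=
  ∀ᵐ t ∂(volume.restrict (Set.Ioo 0 T)),
    ∀ φ : Vec d → ℝ, ContDiff ℝ (⊤ : ℕ∞) φ →
      (∀ x y : Vec d, projT d x = projT d y → φ x = φ y) →
      ∫ x in unitCube d, ∑ i, b t (projT d x) i * fderiv ℝ φ x (EuclideanSpace.single i 1) = 0

/-- `u : 𝕋^d → ℝ^d` is of bounded variation with derivative the matrix of finite signed
measures `Dp i j - Dm i j`: for all `i, j` and every smooth periodic test function `φ`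
(with `φb` its descent to the torus), `∫_{𝕋^d} u_j ∂_iφ = -∫_{𝕋^d} φb d(D_i u_j)`. -/
def HasBVStructure (d : ℕ) (u : Torus d → Vec d)
    (Dp Dm : Fin d → Fin d → Measure (Torus d)) : Prop :=
  (∀ i j, Dp i j Set.univ < ∞ ∧ Dm i j Set.univ < ∞) ∧
  ∀ (i j : Fin d) (φ : Vec d → ℝ) (φb : Torus d → ℝ),
    ContDiff ℝ (⊤ : ℕ∞) φ → (∀ x, φb (projT d x) = φ x) →
    ∫ x in unitCube d, u (projT d x) j * fderiv ℝ φ x (EuclideanSpace.single i 1)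
      = -((∫ y, φb y ∂(Dp i j)) - ∫ y, φb y ∂(Dm i j))

/-- `b ∈ L¹_loc((0,T]; BV(𝕋^d;ℝ^d))`: for a.e. `t ∈ (0,T]`, `b(t,·) ∈ BV`, and for every
`τ ∈ (0,T)` the total variations are integrable on `(τ,T]`. -/
def MemL1locBVIoc (T : ℝ) (d : ℕ) (b : ℝ → Torus d → Vec d) : Prop :=
  ∃ Dp Dm : ℝ → Fin d → Fin d → Measure (Torus d),
    (∀ᵐ t ∂(volume.restrict (Set.Ioc 0 T)), HasBVStructure d (b t) (Dp t) (Dm t)) ∧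
    ∀ τ ∈ Set.Ioo 0 T,
      ∫⁻ t in Set.Ioc τ T, (∑ i, ∑ j, (Dp t i j Set.univ + Dm t i j Set.univ)) < ∞

/-- `b ∈ L¹_loc([0,T); BV(𝕋^d;ℝ^d))`: for a.e. `t ∈ [0,T)`, `b(t,·) ∈ BV`, and for every
`τ ∈ (0,T)` the total variations are integrable on `[0,T-τ)`. -/
def MemL1locBVIco (T : ℝ) (d : ℕ) (b : ℝ → Torus d → Vec d) : Prop :=
  ∃ Dp Dm : ℝ → Fin d → Fin d → Measure (Torus d),
    (∀ᵐ t ∂(volume.restrict (Set.Ico 0 T)), HasBVStructure d (b t) (Dp t) (Dm t)) ∧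
    ∀ τ ∈ Set.Ioo 0 T,
      ∫⁻ t in Set.Ico 0 (T - τ), (∑ i, ∑ j, (Dp t i j Set.univ + Dm t i j Set.univ)) < ∞

/-- `b ∈ L^q((0,T); L^p(𝕋^d;ℝ^d))`. -/
def MemLqLp (T : ℝ) (d : ℕ) (p q : ℝ≥0∞) (b : ℝ → Torus d → Vec d) : Prop :=
  (q ≠ ∞ → ∫⁻ t in Set.Ioo 0 T,
      (eLpNorm (b t) p (volume : Measure (Torus d))) ^ q.toReal < ∞) ∧
  (q = ∞ → essSup (fun t => eLpNorm (b t) p (volume : Measure (Torus d)))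
      (volume.restrict (Set.Ioo 0 T)) < ∞)


/-! ### Basic facts about the torus -/

lemma projT_apply {d : ℕ} (x : Vec d) (i : Fin d) : projT d x i = (x i : AddCircle (1 : ℝ)) := rfl

lemma projT_add {d : ℕ} (x y : Vec d) : projT d (x + y) = projT d x + projT d y := by
  funext i; simp [projT]

lemma projT_zero {d : ℕ} : projT d 0 = 0 := by
  funext i; simp [projT]

lemma projT_neg {d : ℕ} (x : Vec d) : projT d (-x) = - projT d x := by
  funext i; simp [projT]

lemma projT_sub {d : ℕ} (x y : Vec d) : projT d (x - y) = projT d x - projT d y := by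
  funext i; simp [projT]

lemma continuous_projT {d : ℕ} : Continuous (projT d) := by
  unfold projT
  refine continuous_pi fun i => ?_
  exact (AddCircle.continuous_mk' 1).comp (by fun_prop)

lemma measurable_projT {d : ℕ} : Measurable (projT d) := continuous_projT.measurable

lemma norm_coe_addCircle_le (x : ℝ) : ‖(x : AddCircle (1 : ℝ))‖ ≤ |x| := by
  rw [AddCircle.norm_eq]
  simpa using round_le x 0

lemma norm_projT_le {d : ℕ} (x : Vec d) : ‖projT d x‖ ≤ ‖x‖ := by
  refine (pi_norm_le_iff_of_nonneg (norm_nonneg _)).2 fun i => ?_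
  refine (norm_coe_addCircle_le _).trans ?_
  exact PiLp.norm_apply_le x i

lemma isOpenQuotientMap_projT {d : ℕ} : IsOpenQuotientMap (projT d) := by
  have h1 : IsOpenQuotientMap (Pi.map (fun (_ : Fin d) (x : ℝ) => (x : AddCircle (1 : ℝ)))) :=
    IsOpenQuotientMap.piMap fun _ => QuotientAddGroup.isOpenQuotientMap_mk
  have h2 : IsOpenQuotientMap (EuclideanSpace.equiv (Fin d) ℝ) :=
    (EuclideanSpace.equiv (Fin d) ℝ).toHomeomorph.isOpenQuotientMap
  exact h1.comp h2


instance instProbCircle : IsProbabilityMeasure (volume : Measure (AddCircle (1 : ℝ))) :=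
  ⟨by rw [AddCircle.measure_univ]; simp⟩

instance instProbTorus (d : ℕ) : IsProbabilityMeasure (volume : Measure (Torus d)) := by
  rw [volume_pi]; infer_instance

/-- The measurable lift of the torus to the cube `(-1/2,1/2]^d`. -/
def liftT (d : ℕ) (y : Torus d) : Vec d :=
  WithLp.toLp 2 fun i => ((AddCircle.measurableEquivIoc 1 (-1/2) (y i) : Ioc (-1/2 : ℝ) (-1/2 + 1)) : ℝ)

/-- The cube `(-1/2,1/2]^d`. -/
def cubeT (d : ℕ) : Set (Vec d) := {x | ∀ i, x i ∈ Ioc (-1/2 : ℝ) (-1/2 + 1)}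

lemma liftT_mem {d : ℕ} (y : Torus d) : liftT d y ∈ cubeT d := fun i =>
  (AddCircle.measurableEquivIoc 1 (-1/2) (y i)).2

lemma projT_liftT {d : ℕ} (y : Torus d) : projT d (liftT d y) = y := by
  funext i
  exact AddCircle.coe_equivIoc (p := (1:ℝ)) (a := -1/2) (y := y i)

lemma measurable_liftT {d : ℕ} : Measurable (liftT d) := by
  refine (MeasurableEquiv.toLp 2 (Fin d → ℝ)).measurable.comp ?_
  refine measurable_pi_lambda _ fun i => ?_
  exact measurable_subtype_coe.comp
    ((AddCircle.measurableEquivIoc 1 (-1/2)).measurable.comp (measurable_pi_apply i))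

lemma liftT_projT_of_mem {d : ℕ} {x : Vec d} (hx : x ∈ cubeT d) : liftT d (projT d x) = x := by
  ext i
  have := AddCircle.equivIoc_coe_eq (p := (1:ℝ)) (a := -1/2) (hx i)
  exact congrArg Subtype.val this

lemma mp_projT_gen (d : ℕ) (a : ℝ) :
    MeasurePreserving (projT d) (volume.restrict {x : Vec d | ∀ i, x i ∈ Ioc a (a + 1)}) volume := by
  have h1 : MeasurePreserving (fun (x : Fin d → ℝ) => (fun i => (x i : AddCircle (1 : ℝ))))
      (Measure.pi fun _ => volume.restrict (Ioc a (a+1))) volume :=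
    measurePreserving_pi _ _ (fun i => AddCircle.measurePreserving_mk 1 a)
  have h2 : (Measure.pi fun _ : Fin d => (volume : Measure ℝ).restrict (Ioc a (a+1))) =
      (volume : Measure (Fin d → ℝ)).restrict (Set.univ.pi fun _ => Ioc a (a+1)) := by
    rw [volume_pi, Measure.restrict_pi_pi]
  rw [h2] at h1
  have h3 := (EuclideanSpace.volume_preserving_symm_measurableEquiv_toLp (Fin d)).restrict_preimage
    (s := Set.univ.pi fun _ => Ioc a (a+1)) (MeasurableSet.univ_pi fun _ => measurableSet_Ioc)
  have h4 := h1.comp h3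
  have e : {x : Vec d | ∀ i, x i ∈ Ioc a (a + 1)} =
      (MeasurableEquiv.toLp 2 (Fin d → ℝ)).symm ⁻¹' (Set.univ.pi fun _ => Ioc a (a+1)) := by
    ext x; simp
  rw [e]
  exact h4

lemma mp_projT (d : ℕ) :
    MeasurePreserving (projT d) (volume.restrict (cubeT d)) volume := mp_projT_gen d _

lemma unitCube_ae (d : ℕ) : unitCube d =ᵐ[volume] {x : Vec d | ∀ i, x i ∈ Ioc (0:ℝ) (0 + 1)} := by
  have h1 : (Set.univ.pi fun _ : Fin d => Ico (0:ℝ) 1) =ᵐ[volume]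
      (Set.univ.pi fun _ : Fin d => Ioc (0:ℝ) (0+1)) := by
    rw [volume_pi, zero_add]
    exact Measure.ae_eq_set_pi fun _ _ => Ico_ae_eq_Ioc
  have h3 := (EuclideanSpace.volume_preserving_symm_measurableEquiv_toLp
    (Fin d)).quasiMeasurePreserving.preimage_ae_eq h1
  have e1 : unitCube d =
      (MeasurableEquiv.toLp 2 (Fin d → ℝ)).symm ⁻¹' (Set.univ.pi fun _ => Ico (0:ℝ) 1) := by
    ext x; simp [unitCube]
  have e2 : {x : Vec d | ∀ i, x i ∈ Ioc (0:ℝ) (0 + 1)} =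
      (MeasurableEquiv.toLp 2 (Fin d → ℝ)).symm ⁻¹' (Set.univ.pi fun _ => Ioc (0:ℝ) (0+1)) := by
    ext x; simp
  rw [e1, e2]
  exact h3

lemma mp_projT_unitCube (d : ℕ) :
    MeasurePreserving (projT d) (volume.restrict (unitCube d)) volume := by
  rw [Measure.restrict_congr_set (unitCube_ae d)]
  exact mp_projT_gen d 0

lemma mp_liftT (d : ℕ) : MeasurePreserving (liftT d) volume (volume.restrict (cubeT d)) := by
  have hm : MeasurableSet (cubeT d) := by
    have : cubeT d = ⋂ i, (fun x : Vec d => x i) ⁻¹' (Ioc (-1/2 : ℝ) (-1/2 + 1)) := by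
      ext x; simp [cubeT]
    rw [this]
    exact MeasurableSet.iInter fun i => (by fun_prop : Measurable fun x : Vec d => x i) measurableSet_Ioc
  refine ⟨measurable_liftT, ?_⟩
  rw [← (mp_projT d).map_eq, Measure.map_map measurable_liftT measurable_projT]
  conv_rhs => rw [← Measure.map_id (μ := volume.restrict (cubeT d))]
  refine Measure.map_congr ?_
  filter_upwards [ae_restrict_mem hm] with x hx
  exact liftT_projT_of_mem hx

lemma integral_unitCube {d : ℕ} {E : Type*} [NormedAddCommGroup E] [NormedSpace ℝ E]
    (f : Torus d → E) (hf : AEStronglyMeasurable f volume) :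
    ∫ x in unitCube d, f (projT d x) = ∫ y, f y := by
  rw [← (mp_projT_unitCube d).map_eq, integral_map measurable_projT.aemeasurable]
  rwa [(mp_projT_unitCube d).map_eq]

/-- Smooth functions on the torus. -/
def SmoothT {d : ℕ} (ψ : Torus d → ℝ) : Prop := ContDiff ℝ (⊤ : ℕ∞) (fun x => ψ (projT d x))

/-- Differential of a function on the torus. -/
def DT {d : ℕ} (ψ : Torus d → ℝ) (y : Torus d) : Vec d →L[ℝ] ℝ :=
  fderiv ℝ (fun x => ψ (projT d x)) (liftT d y)

lemma DT_projT {d : ℕ} (ψ : Torus d → ℝ) (x : Vec d) :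
    DT ψ (projT d x) = fderiv ℝ (fun x => ψ (projT d x)) x := by
  unfold DT
  set v := liftT d (projT d x) - x with hv
  have h0 : projT d v = 0 := by rw [hv, projT_sub, projT_liftT, sub_self]
  have h1 : (fun x => ψ (projT d x)) = fun x => (fun x => ψ (projT d x)) (x + v) := by
    funext z; simp only [projT_add, h0, add_zero]
  have h2 := fderiv_comp_add_right (𝕜 := ℝ) (f := fun x => ψ (projT d x)) (x := x) v
  rw [← h1] at h2
  rw [h2, hv]
  congr 1
  abel

lemma continuous_DT {d : ℕ} {ψ : Torus d → ℝ}
    (h : ContDiff ℝ 1 (fun x => ψ (projT d x))) : Continuous (DT ψ) := by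
  rw [isOpenQuotientMap_projT.isQuotientMap.continuous_iff]
  have : DT ψ ∘ projT d = fderiv ℝ (fun x => ψ (projT d x)) := by
    funext x; exact DT_projT ψ x
  rw [this]
  exact h.continuous_fderiv one_ne_zero

lemma SmoothT.contDiff_one {d : ℕ} {ψ : Torus d → ℝ} (h : SmoothT ψ) :
    ContDiff ℝ 1 (fun x => ψ (projT d x)) := h.of_le (by simp)

lemma continuous_of_lift {d : ℕ} {ψ : Torus d → ℝ}
    (h : Continuous (fun x => ψ (projT d x))) : Continuous ψ := by
  rw [isOpenQuotientMap_projT.isQuotientMap.continuous_iff]; exact h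

lemma SmoothT.continuous {d : ℕ} {ψ : Torus d → ℝ} (h : SmoothT ψ) : Continuous ψ :=
  continuous_of_lift (ContDiff.continuous h)

lemma clm_apply_eq_sum {d : ℕ} (a : Vec d →L[ℝ] ℝ) (v : Vec d) :
    a v = ∑ i, v i * a (EuclideanSpace.single i 1) := by
  conv_lhs => rw [← (EuclideanSpace.basisFun (Fin d) ℝ).sum_repr v]
  simp [map_sum]

lemma divFree_torus {d : ℕ} {w : Torus d → Vec d} (hw : Measurable w)
    (h : ∀ φ : Vec d → ℝ, ContDiff ℝ (⊤ : ℕ∞) φ →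
      (∀ x y : Vec d, projT d x = projT d y → φ x = φ y) →
      ∫ x in unitCube d, ∑ i, w (projT d x) i * fderiv ℝ φ x (EuclideanSpace.single i 1) = 0)
    {ψ : Torus d → ℝ} (hψ : SmoothT ψ) : ∫ y, DT ψ y (w y) = 0 := by
  have h1 := h (fun x => ψ (projT d x)) hψ (fun x y hxy => by simp only [hxy])
  rw [← integral_unitCube, ← h1]
  · congr 1
    funext x
    rw [DT_projT, clm_apply_eq_sum]
  · have := (continuous_DT hψ.contDiff_one).measurable
    refine Measurable.aestronglyMeasurable ?_
    exact (continuous_fst.clm_apply continuous_snd).measurable.comp (this.prodMk hw)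

lemma bv_torus {d : ℕ} {w : Torus d → Vec d} (hw : Measurable w)
    {Dp Dm : Fin d → Fin d → Measure (Torus d)} (h : HasBVStructure d w Dp Dm) (i j : Fin d)
    {ψ : Torus d → ℝ} (hψ : SmoothT ψ) :
    ∫ y, w y j * DT ψ y (EuclideanSpace.single i 1) =
      -((∫ y, ψ y ∂(Dp i j)) - ∫ y, ψ y ∂(Dm i j)) := by
  rw [← h.2 i j (fun x => ψ (projT d x)) ψ hψ (fun x => rfl), ← integral_unitCube]
  · simp only [DT_projT]
  · have := continuous_DT hψ.contDiff_one
    refine Measurable.aestronglyMeasurable ?_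
    have h1 : Measurable fun y => DT ψ y (EuclideanSpace.single i 1) :=
      (by fun_prop : Continuous fun y => DT ψ y (EuclideanSpace.single i 1)).measurable
    exact (by fun_prop : Measurable fun y => w y j).mul h1

/-! ### Smooth functions -/

lemma SmoothT.add {d : ℕ} {f g : Torus d → ℝ} (hf : SmoothT f) (hg : SmoothT g) :
    SmoothT (fun y => f y + g y) := ContDiff.add hf hg

lemma SmoothT.mul {d : ℕ} {f g : Torus d → ℝ} (hf : SmoothT f) (hg : SmoothT g) :
    SmoothT (fun y => f y * g y) := ContDiff.mul hf hg

lemma SmoothT.neg {d : ℕ} {f : Torus d → ℝ} (hf : SmoothT f) :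
    SmoothT (fun y => - f y) := ContDiff.neg hf

lemma SmoothT.const {d : ℕ} (c : ℝ) : SmoothT (fun _ : Torus d => c) := contDiff_const

/-- The subalgebra of smooth functions. -/
def smoothAlg (d : ℕ) : Subalgebra ℝ C(Torus d, ℝ) where
  carrier := {f | SmoothT (f : Torus d → ℝ)}
  mul_mem' := fun {a b} ha hb => SmoothT.mul (f := a) (g := b) ha hb
  add_mem' := fun {a b} ha hb => SmoothT.add (f := a) (g := b) ha hb
  algebraMap_mem' := fun r => SmoothT.const r

lemma smoothAlg_dense (d : ℕ) : Dense (smoothAlg d : Set C(Torus d, ℝ)) := by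
  have hsep : (smoothAlg d).SeparatesPoints := by
    intro x y hxy
    obtain ⟨i, hi⟩ := Function.ne_iff.1 hxy
    have h1 : AddCircle.toCircle (x i) ≠ AddCircle.toCircle (y i) :=
      fun h => hi (AddCircle.injective_toCircle one_ne_zero h)
    have hc : Continuous fun z : Torus d => ((AddCircle.toCircle (z i) : Circle) : ℂ) :=
      continuous_subtype_val.comp (AddCircle.continuous_toCircle.comp (continuous_apply i))
    have key : ∀ z : Vec d, ((AddCircle.toCircle (projT d z i) : Circle) : ℂ) =
        Complex.exp ((2 * Real.pi * z i : ℝ) * Complex.I) := by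
      intro z
      rw [projT_apply, AddCircle.toCircle_apply_mk, Circle.coe_exp]
      norm_num
    have hs : ContDiff ℝ (⊤ : ℕ∞) fun z : Vec d =>
        ((AddCircle.toCircle (projT d z i) : Circle) : ℂ) := by
      simp only [key]
      have e1 : ContDiff ℝ (⊤ : ℕ∞) fun z : Vec d => (2 * Real.pi * z i : ℝ) := by fun_prop
      have e2 : ContDiff ℝ (⊤ : ℕ∞) fun z : Vec d => ((2 * Real.pi * z i : ℝ) : ℂ) :=
        Complex.ofRealCLM.contDiff.comp e1
      exact (e2.mul contDiff_const).cexp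
    have hre : SmoothT fun z : Torus d => ((AddCircle.toCircle (z i) : Circle) : ℂ).re :=
      Complex.reCLM.contDiff.comp hs
    have him : SmoothT fun z : Torus d => ((AddCircle.toCircle (z i) : Circle) : ℂ).im :=
      Complex.imCLM.contDiff.comp hs
    by_cases h2 : ((AddCircle.toCircle (x i) : Circle) : ℂ).re = ((AddCircle.toCircle (y i) : Circle) : ℂ).re
    · have h3 : ((AddCircle.toCircle (x i) : Circle) : ℂ).im ≠ ((AddCircle.toCircle (y i) : Circle) : ℂ).im := by
        intro h3
        exact h1 (Subtype.ext (Complex.ext h2 h3))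
      exact ⟨_, ⟨⟨_, Complex.continuous_im.comp hc⟩, him, rfl⟩, h3⟩
    · exact ⟨_, ⟨⟨_, Complex.continuous_re.comp hc⟩, hre, rfl⟩, h2⟩
  have := ContinuousMap.subalgebra_topologicalClosure_eq_top_of_separatesPoints _ hsep
  rw [dense_iff_closure_eq, ← Subalgebra.topologicalClosure_coe, this]
  rfl

lemma exists_countable_smooth (d : ℕ) : ∃ D : AddSubgroup C(Torus d, ℝ),
    (D : Set C(Torus d, ℝ)).Countable ∧ (∀ ψ ∈ D, SmoothT (ψ : Torus d → ℝ)) ∧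
    (1 : C(Torus d, ℝ)) ∈ D ∧ Dense (D : Set C(Torus d, ℝ)) := by
  obtain ⟨t, hts, htc, htd⟩ := (smoothAlg_dense d).exists_countable_dense_subset
  refine ⟨AddSubgroup.closure (insert 1 t), ?_, ?_, ?_, ?_⟩
  · have : Countable (insert 1 t : Set C(Torus d, ℝ)) := (htc.insert 1).to_subtype
    let f : FreeAddGroup (insert 1 t : Set C(Torus d, ℝ)) →+ C(Torus d, ℝ) :=
      FreeAddGroup.lift Subtype.val
    have h1 : f.range = AddSubgroup.closure (insert 1 t) := by
      rw [FreeAddGroup.range_lift_eq_closure, Subtype.range_val]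
    have : Countable (FreeAddGroup (insert 1 t : Set C(Torus d, ℝ))) := by
      unfold FreeAddGroup
      exact Quot.mk_surjective.countable
    rw [← h1]
    exact Set.countable_range f
  · intro ψ hψ
    have : AddSubgroup.closure (insert 1 t) ≤ (smoothAlg d).toSubmodule.toAddSubgroup := by
      rw [AddSubgroup.closure_le]
      refine insert_subset ?_ hts
      exact (smoothAlg d).one_mem
    exact this hψ
  · exact AddSubgroup.subset_closure (mem_insert _ _)
  · exact htd.mono ((subset_insert _ _).trans AddSubgroup.subset_closure)

/-- Approximation in `L¹` by elements of a dense set of continuous functions. -/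
lemma dense_approx {d : ℕ} {D : Set C(Torus d, ℝ)} (hD : Dense D) (μ : Measure (Torus d))
    [IsFiniteMeasure μ] {f : Torus d → ℝ} (hf : Integrable f μ) {ε : ℝ} (hε : 0 < ε) :
    ∃ ψ ∈ D, ∫ y, |f y - ψ y| ∂μ ≤ ε := by
  obtain ⟨g, hg, hgi⟩ := hf.exists_boundedContinuous_integral_sub_le (half_pos hε)
  set δ : ℝ := ε / 2 / (μ.real univ + 1) with hδ
  have hμ : 0 ≤ μ.real univ := measureReal_nonneg
  have hδ0 : 0 < δ := by positivity
  obtain ⟨ψ, hψD, hψ⟩ := hD.exists_dist_lt (g : C(Torus d, ℝ)) hδ0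
  refine ⟨ψ, hψD, ?_⟩
  have hψi : Integrable (fun y => ψ y) μ := by
    refine Integrable.of_bound (C := ‖ψ‖) ψ.continuous.aestronglyMeasurable (ae_of_all _ fun y => ?_)
    exact ψ.norm_coe_le_norm y
  have h2 : ∀ y, |g y - ψ y| ≤ δ := fun y => by
    have := (ContinuousMap.dist_lt_iff hδ0).1 hψ y
    rw [Real.dist_eq] at this
    exact this.le
  calc ∫ y, |f y - ψ y| ∂μ ≤ ∫ y, (‖f y - g y‖ + δ) ∂μ := by
        refine integral_mono (hf.sub hψi).abs ((hf.sub hgi).norm.add (integrable_const _)) fun y => ?_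
        calc |f y - ψ y| ≤ |f y - g y| + |g y - ψ y| := abs_sub_le _ _ _
          _ ≤ _ := by gcongr; exacts [le_rfl, h2 y]
    _ = (∫ y, ‖f y - g y‖ ∂μ) + μ.real univ * δ := by
        have e := integral_add (hf.sub hgi).norm (integrable_const δ)
        simpa using e
    _ ≤ ε / 2 + ε / 2 := by
        refine add_le_add hg ?_
        rw [hδ, ← mul_div_assoc, div_le_iff₀ (by positivity)]
        nlinarith
    _ = ε := by ring

lemma integrable_cont {d : ℕ} (μ : Measure (Torus d)) [IsFiniteMeasure μ] {f : Torus d → ℝ}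
    (hf : Continuous f) : Integrable f μ :=
  hf.integrable_of_hasCompactSupport (HasCompactSupport.of_compactSpace f)

/-- Duality: domination on smooth test functions gives domination of measures. -/
lemma dual_le {d : ℕ} (μ ν : Measure (Torus d)) [IsFiniteMeasure μ] [IsFiniteMeasure ν]
    {f : Torus d → ℝ} (hfm : Measurable f) (hf : Integrable f μ)
    (h : ∀ ξ : Torus d → ℝ, SmoothT ξ → |∫ y, ξ y * f y ∂μ| ≤ ∫ y, |ξ y| ∂ν) :
    μ.withDensity (fun y => ‖f y‖ₑ) ≤ ν := by
  have hfin : IsFiniteMeasure (μ.withDensity (fun y => ‖f y‖ₑ)) :=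
    isFiniteMeasure_withDensity hf.2.ne
  -- first step
  have step : ∀ A, MeasurableSet A → |∫ y in A, f y ∂μ| ≤ ν.real A := by
    intro A hA
    refine le_of_forall_pos_le_add fun ε hε => ?_
    set σ := μ.withDensity (fun y => ‖f y‖ₑ) + ν
    have h1 : Integrable (A.indicator (fun _ => (1 : ℝ))) σ := (integrable_const _).indicator hA
    obtain ⟨ψ, hψ, hψe⟩ := dense_approx (smoothAlg_dense d) σ h1 (half_pos hε)
    have hi : Integrable (fun y => |A.indicator (fun _ => (1 : ℝ)) y - ψ y|) σ :=
      (h1.sub (integrable_cont σ ψ.continuous)).abs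
    have hi1 := hi.left_of_add_measure
    have hi2 := hi.right_of_add_measure
    rw [integral_add_measure hi1 hi2] at hψe
    have hn1 : 0 ≤ ∫ y, |A.indicator (fun _ => (1 : ℝ)) y - ψ y| ∂(μ.withDensity (fun y => ‖f y‖ₑ)) :=
      integral_nonneg fun _ => abs_nonneg _
    have hn2 : 0 ≤ ∫ y, |A.indicator (fun _ => (1 : ℝ)) y - ψ y| ∂ν :=
      integral_nonneg fun _ => abs_nonneg _
    have e1 : ∫ y, |A.indicator (fun _ => (1 : ℝ)) y - ψ y| ∂(μ.withDensity (fun y => ‖f y‖ₑ)) =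
        ∫ y, |f y| * |A.indicator (fun _ => (1 : ℝ)) y - ψ y| ∂μ := by
      rw [integral_withDensity_eq_integral_toReal_smul hfm.enorm (ae_of_all _ fun y => by simp)]
      simp
    have hψf : Integrable (fun y => ψ y * f y) μ :=
      hf.bdd_mul (c := ‖ψ‖) ψ.continuous.aestronglyMeasurable (ae_of_all _ fun y => ψ.norm_coe_le_norm y)
    have hAf : Integrable (fun y => A.indicator (fun _ => (1 : ℝ)) y * f y) μ := by
      refine (hf.indicator hA).congr (ae_of_all _ fun y => ?_)
      by_cases hy : y ∈ A <;> simp [hy]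
    have e2 : ∫ y in A, f y ∂μ = ∫ y, A.indicator (fun _ => (1 : ℝ)) y * f y ∂μ := by
      rw [← integral_indicator hA]
      congr 1; funext y
      by_cases hy : y ∈ A <;> simp [hy]
    have e3 : |(∫ y in A, f y ∂μ) - ∫ y, ψ y * f y ∂μ| ≤
        ∫ y, |f y| * |A.indicator (fun _ => (1 : ℝ)) y - ψ y| ∂μ := by
      rw [e2, ← integral_sub hAf hψf]
      refine abs_integral_le_integral_abs.trans_eq ?_
      congr 1; funext y
      rw [← sub_mul, abs_mul, mul_comm]
    have e4 : ∫ y, |ψ y| ∂ν ≤ ν.real A + ∫ y, |A.indicator (fun _ => (1 : ℝ)) y - ψ y| ∂ν := by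
      have : ν.real A = ∫ y, A.indicator (fun _ => (1 : ℝ)) y ∂ν := by
        rw [integral_indicator hA]; simp
      rw [this, ← integral_add h1.right_of_add_measure hi2]
      refine integral_mono (integrable_cont ν ψ.continuous).abs (h1.right_of_add_measure.add hi2)
        fun y => ?_
      have h0 : 0 ≤ A.indicator (fun _ => (1 : ℝ)) y := indicator_nonneg (fun _ _ => zero_le_one) _
      calc |ψ y| = |A.indicator (fun _ => (1 : ℝ)) y - (A.indicator (fun _ => (1 : ℝ)) y - ψ y)| := by
            congr 1; ring
        _ ≤ |A.indicator (fun _ => (1 : ℝ)) y| + _ := abs_sub _ _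
        _ = _ := by rw [abs_of_nonneg h0]
    have e5 := h ψ hψ
    have e6 := abs_sub_abs_le_abs_sub (∫ y in A, f y ∂μ) (∫ y, ψ y * f y ∂μ)
    linarith
  have conv : ∀ A, MeasurableSet A → ∫⁻ y in A, ‖f y‖ₑ ∂μ = ENNReal.ofReal (∫ y in A, |f y| ∂μ) := by
    intro A hA
    rw [ofReal_integral_eq_lintegral_ofReal hf.abs.integrableOn (ae_of_all _ fun y => abs_nonneg _)]
    congr 1; funext y
    rw [← Real.norm_eq_abs, ofReal_norm]
  refine Measure.le_iff.2 fun A hA => ?_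
  rw [withDensity_apply _ hA]
  set P := {y | 0 ≤ f y}
  have hP : MeasurableSet P := measurableSet_le measurable_const hfm
  have hP' : ∫⁻ y in A ∩ P, ‖f y‖ₑ ∂μ ≤ ν (A ∩ P) := by
    rw [conv _ (hA.inter hP), ← ofReal_measureReal]
    refine ENNReal.ofReal_le_ofReal ?_
    refine le_trans ?_ (step _ (hA.inter hP))
    rw [setIntegral_congr_fun (hA.inter hP) (g := f) fun y hy => abs_of_nonneg hy.2]
    exact le_abs_self _
  have hN' : ∫⁻ y in A \ P, ‖f y‖ₑ ∂μ ≤ ν (A \ P) := by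
    rw [conv _ (hA.diff hP), ← ofReal_measureReal]
    refine ENNReal.ofReal_le_ofReal ?_
    refine le_trans ?_ (step _ (hA.diff hP))
    rw [setIntegral_congr_fun (hA.diff hP) (g := fun y => - f y) fun y hy =>
      abs_of_neg (not_le.1 hy.2), integral_neg]
    exact neg_le_abs _
  calc ∫⁻ y in A, ‖f y‖ₑ ∂μ = (∫⁻ y in A ∩ P, ‖f y‖ₑ ∂μ) + ∫⁻ y in A \ P, ‖f y‖ₑ ∂μ :=
        (lintegral_inter_add_sdiff _ _ hP).symm
    _ ≤ ν (A ∩ P) + ν (A \ P) := add_le_add hP' hN'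
    _ = ν A := measure_inter_add_sdiff _ hP

/-- Density of a dominated measure. -/
lemma exists_density {X : Type*} [MeasurableSpace X] (μ ν : Measure X) [IsFiniteMeasure μ] [IsFiniteMeasure ν]
    (h : ν ≤ μ) : ∃ p : X → ℝ, Measurable p ∧ (∀ x, 0 ≤ p x) ∧ (∀ x, p x ≤ 1) ∧
      ν = μ.withDensity (fun x => ENNReal.ofReal (p x)) := by
  have hac : ν ≪ μ := Measure.absolutelyContinuous_of_le h
  have h1 : ν.rnDeriv μ ≤ᵐ[μ] 1 := by
    refine ae_le_of_forall_setLIntegral_le_of_sigmaFinite (Measure.measurable_rnDeriv ν μ) ?_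
    intro s hs _
    rw [Measure.setLIntegral_rnDeriv hac]
    simpa using h s
  refine ⟨fun x => (min (ν.rnDeriv μ x) 1).toReal, ?_, fun x => ENNReal.toReal_nonneg, fun x => ?_, ?_⟩
  · exact ((Measure.measurable_rnDeriv ν μ).min measurable_const).ennreal_toReal
  · exact ENNReal.toReal_le_of_le_ofReal zero_le_one (by simp)
  · conv_lhs => rw [← Measure.withDensity_rnDeriv_eq ν μ hac]
    refine withDensity_congr_ae ?_
    filter_upwards [h1] with x hx
    rw [ENNReal.ofReal_toReal (ne_top_of_le_ne_top ENNReal.one_ne_top (min_le_right _ _))]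
    exact (min_eq_left hx).symm

lemma integral_density {X : Type*} [MeasurableSpace X] (μ : Measure X)
    {p : X → ℝ} (hp : Measurable p) (hp0 : ∀ x, 0 ≤ p x) (f : X → ℝ) :
    ∫ x, f x ∂(μ.withDensity (fun x => ENNReal.ofReal (p x))) = ∫ x, p x * f x ∂μ := by
  rw [integral_withDensity_eq_integral_toReal_smul hp.ennreal_ofReal (ae_of_all _ fun y => by simp)]
  congr 1; funext x
  rw [ENNReal.toReal_ofReal (hp0 x), smul_eq_mul]

/-! ### BV structure at a fixed time -/

lemma DT_add_right {d : ℕ} (ψ : Torus d → ℝ) (v x : Torus d) :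
    DT (fun y => ψ (y + v)) x = DT ψ (x + v) := by
  have h0 : ∀ z, ψ (projT d z + v) = ψ (projT d (z + liftT d v)) := fun z => by
    rw [projT_add, projT_liftT]
  have h1 : DT (fun y => ψ (y + v)) x =
      fderiv ℝ (fun z => (fun z => ψ (projT d z)) (z + liftT d v)) (liftT d x) := by
    unfold DT; simp only [h0]
  have h2 := fderiv_comp_add_right (𝕜 := ℝ) (f := fun z => ψ (projT d z)) (x := liftT d x) (liftT d v)
  rw [h1, h2, ← DT_projT, projT_add, projT_liftT, projT_liftT]

lemma SmoothT.add_right {d : ℕ} {ψ : Torus d → ℝ} (h : SmoothT ψ) (v : Torus d) :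
    SmoothT (fun y => ψ (y + v)) := by
  have h0 : (fun z => ψ (projT d z + v)) = fun z => ψ (projT d (z + liftT d v)) := by
    funext z; rw [projT_add, projT_liftT]
  unfold SmoothT
  rw [h0]
  exact ContDiff.comp (g := fun x => ψ (projT d x)) h (contDiff_id.add contDiff_const)

lemma hasDerivAt_line {d : ℕ} {ψ : Torus d → ℝ} (h : ContDiff ℝ 1 (fun x => ψ (projT d x)))
    (x : Torus d) (z : Vec d) (s : ℝ) :
    HasDerivAt (fun s : ℝ => ψ (x + projT d (s • z))) (DT ψ (x + projT d (s • z)) z) s := by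
  have e : ∀ s : ℝ, x + projT d (s • z) = projT d (liftT d x + s • z) := fun s => by
    rw [projT_add, projT_liftT]
  simp only [e]
  rw [DT_projT]
  have h1 : HasFDerivAt (fun x => ψ (projT d x)) (fderiv ℝ (fun x => ψ (projT d x)) (liftT d x + s • z))
      (liftT d x + s • z) := (h.differentiable one_ne_zero _).hasFDerivAt
  have h2 : HasDerivAt (fun s : ℝ => liftT d x + s • z) z s := by
    simpa using ((hasDerivAt_id s).smul_const z).const_add (liftT d x)
  exact h1.comp_hasDerivAt s h2

lemma line_integral {d : ℕ} {ψ : Torus d → ℝ} (h : ContDiff ℝ 1 (fun x => ψ (projT d x)))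
    (x : Torus d) (z : Vec d) :
    ∫ s in Ioc (0:ℝ) 1, DT ψ (x + projT d (s • z)) z = ψ (x + projT d z) - ψ x := by
  rw [← intervalIntegral.integral_of_le zero_le_one]
  rw [intervalIntegral.integral_eq_sub_of_hasDerivAt (fun s _ => hasDerivAt_line h x z s)]
  · simp [projT_zero]
  · have h1 := continuous_DT h
    have h2 : Continuous (projT d) := continuous_projT
    exact (by fun_prop : Continuous fun s : ℝ => DT ψ (x + projT d (s • z)) z).intervalIntegrable _ _

lemma DT_bound {d : ℕ} {ψ : Torus d → ℝ} (h : ContDiff ℝ 1 (fun x => ψ (projT d x))) :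
    ∃ C : ℝ, 0 ≤ C ∧ ∀ y, ‖DT ψ y‖ ≤ C := by
  obtain ⟨C, hC⟩ := isCompact_univ.exists_bound_of_continuousOn (continuous_DT h).continuousOn
  exact ⟨max C 0, le_max_right _ _, fun y => (hC y trivial).trans (le_max_left _ _)⟩

lemma lip_of_DT_bound {d : ℕ} {ψ : Torus d → ℝ} (h : ContDiff ℝ 1 (fun x => ψ (projT d x)))
    {C : ℝ} (hC : ∀ y, ‖DT ψ y‖ ≤ C) (x : Torus d) (z : Vec d) :
    |ψ (x + projT d z) - ψ x| ≤ C * ‖z‖ := by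
  rw [← line_integral h, ← Real.norm_eq_abs]
  refine (norm_setIntegral_le_of_norm_le_const (C := C * ‖z‖) (by simp) fun s _ => ?_).trans ?_
  · exact (ContinuousLinearMap.le_opNorm _ _).trans (by gcongr; exact hC _)
  · simp

lemma enorm_withDensity_integral {X : Type*} [MeasurableSpace X] (μ : Measure X)
    {g : X → ℝ} (hg : Measurable g) (f : X → ℝ) :
    ∫ x, f x ∂(μ.withDensity (fun x => ‖g x‖ₑ)) = ∫ x, |g x| * f x ∂μ := by
  rw [integral_withDensity_eq_integral_toReal_smul hg.enorm (ae_of_all _ fun y => by simp)]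
  simp

/-- Weak derivative `N μ` of the vector field `w`. -/
def IsWeakDer {d : ℕ} (w : Torus d → Vec d) (μ : Measure (Torus d))
    (N : Torus d → (Vec d →L[ℝ] Vec d)) : Prop :=
  ∀ (a : Vec d →L[ℝ] ℝ) (z : Vec d) (ψ : Torus d → ℝ), SmoothT ψ →
    ∫ y, a (w y) * DT ψ y z = - ∫ y, ψ y * a (N y z) ∂μ

lemma test_diff {d : ℕ} {w : Torus d → Vec d} (hwi : Integrable w)
    {μ : Measure (Torus d)} [IsFiniteMeasure μ] {N : Torus d → (Vec d →L[ℝ] Vec d)}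
    (hN : IsWeakDer w μ N) (a : Vec d →L[ℝ] ℝ) (z : Vec d) {ξ : Torus d → ℝ} (hξ : SmoothT ξ) :
    ∫ x, ξ x * a (w x - w (x - projT d z)) =
      ∫ s in Ioc (0:ℝ) 1, ∫ y, ξ (y + projT d (s • z)) * a (N y z) ∂μ := by
  have haw : Integrable (fun x => a (w x)) := a.integrable_comp hwi
  have hξc := hξ.continuous
  obtain ⟨Cξ, hCξ⟩ := isCompact_univ.exists_bound_of_continuousOn hξc.continuousOn
  have haw' : Integrable (fun x => a (w (x - projT d z))) := haw.comp_sub_right _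
  have i1 : Integrable (fun x => ξ x * a (w x)) :=
    haw.bdd_mul (c := Cξ) hξc.aestronglyMeasurable (ae_of_all _ fun y => hCξ y trivial)
  have i2 : Integrable (fun x => ξ x * a (w (x - projT d z))) :=
    haw'.bdd_mul (c := Cξ) hξc.aestronglyMeasurable (ae_of_all _ fun y => hCξ y trivial)
  have i3 : Integrable (fun x => ξ (x + projT d z) * a (w x)) :=
    haw.bdd_mul (c := Cξ) (hξc.comp (continuous_add_const _)).aestronglyMeasurable
      (ae_of_all _ fun y => hCξ _ trivial)
  have e1 : ∫ x, ξ x * a (w x - w (x - projT d z)) =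
      ∫ x, a (w x) * (-(ξ (x + projT d z) - ξ x)) := by
    have : ∫ x, ξ x * a (w (x - projT d z)) = ∫ x, ξ (x + projT d z) * a (w x) := by
      rw [← integral_add_right_eq_self _ (projT d z)]
      simp
    simp only [map_sub, mul_sub]
    rw [integral_sub i1 i2, this, ← integral_sub i1 i3]
    congr 1; funext x; ring
  rw [e1]
  have h1 := continuous_DT hξ.contDiff_one
  obtain ⟨C, hC0, hC⟩ := DT_bound hξ.contDiff_one
  have h2 : Continuous (projT d) := continuous_projT
  have e2 : ∀ x, a (w x) * (-(ξ (x + projT d z) - ξ x)) =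
      ∫ s in Ioc (0:ℝ) 1, -(a (w x) * DT ξ (x + projT d (s • z)) z) := by
    intro x
    rw [integral_neg, integral_const_mul, line_integral hξ.contDiff_one]; ring
  simp_rw [e2]
  rw [integral_integral_swap]
  · congr 1; funext s
    rw [integral_neg]
    have := hN a z (fun y => ξ (y + projT d (s • z))) (hξ.add_right _)
    simp only [DT_add_right] at this
    rw [this, neg_neg]
  · have h3 : Continuous fun q : Torus d × ℝ => DT ξ (q.1 + projT d (q.2 • z)) z := by fun_prop
    have h4 : Integrable (fun q : Torus d × ℝ => a (w q.1))
        ((volume : Measure (Torus d)).prod (volume.restrict (Ioc (0:ℝ) 1))) := haw.comp_fst _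
    have := h4.mul_bdd (c := C * ‖z‖) (g := fun q : Torus d × ℝ => DT ξ (q.1 + projT d (q.2 • z)) z)
      h3.aestronglyMeasurable
      (ae_of_all _ fun q => (ContinuousLinearMap.le_opNorm _ _).trans (by gcongr; exact hC _))
    exact this.neg

/-- The measure dominating difference quotients. -/
def diffMeas {d : ℕ} (μ : Measure (Torus d)) (N : Torus d → (Vec d →L[ℝ] Vec d))
    (a : Vec d →L[ℝ] ℝ) (z : Vec d) : Measure (Torus d) :=
  Measure.map (fun q : ℝ × Torus d => q.2 + projT d (q.1 • z))
    ((volume.restrict (Ioc (0:ℝ) 1)).prod (μ.withDensity fun y => ‖a (N y z)‖ₑ))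

lemma measurable_aNz {d : ℕ} {N : Torus d → (Vec d →L[ℝ] Vec d)} (hNm : Measurable N)
    (a : Vec d →L[ℝ] ℝ) (z : Vec d) : Measurable fun y => a (N y z) :=
  (by fun_prop : Continuous fun A : Vec d →L[ℝ] Vec d => a (A z)).measurable.comp hNm

lemma finite_aNz {d : ℕ} {μ : Measure (Torus d)} [IsFiniteMeasure μ]
    {N : Torus d → (Vec d →L[ℝ] Vec d)} {c : ℝ} (hNb : ∀ y, ‖N y‖ ≤ c)
    (a : Vec d →L[ℝ] ℝ) (z : Vec d) : ∀ y, ‖a (N y z)‖ ≤ ‖a‖ * (c * ‖z‖) := by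
  intro y
  refine (a.le_opNorm _).trans ?_
  gcongr
  exact ((N y).le_opNorm z).trans (by gcongr; exact hNb y)

lemma diff_le {d : ℕ} {w : Torus d → Vec d} (hw : Measurable w) (hwi : Integrable w)
    {μ : Measure (Torus d)} [IsFiniteMeasure μ] {N : Torus d → (Vec d →L[ℝ] Vec d)}
    (hNm : Measurable N) {c : ℝ} (hNb : ∀ y, ‖N y‖ ≤ c)
    (hN : IsWeakDer w μ N) (a : Vec d →L[ℝ] ℝ) (z : Vec d) :
    (volume : Measure (Torus d)).withDensity (fun x => ‖a (w x - w (x - projT d z))‖ₑ) ≤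
      diffMeas μ N a z := by
  have hm := measurable_aNz hNm a z
  have hb := finite_aNz (μ := μ) hNb a z
  have hbi : Integrable (fun y => a (N y z)) μ :=
    Integrable.of_bound hm.aestronglyMeasurable _ (ae_of_all _ hb)
  have hfin : IsFiniteMeasure (μ.withDensity fun y => ‖a (N y z)‖ₑ) :=
    isFiniteMeasure_withDensity hbi.2.ne
  have : IsFiniteMeasure (diffMeas μ N a z) := by unfold diffMeas; infer_instance
  have h2 : Continuous (projT d) := continuous_projT
  have hφ : Continuous (fun q : ℝ × Torus d => q.2 + projT d (q.1 • z)) := by fun_prop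
  refine dual_le _ _ ?_ ?_ ?_
  · exact a.continuous.measurable.comp (hw.sub (hw.comp (measurable_id.sub_const _)))
  · exact a.integrable_comp (hwi.sub (hwi.comp_sub_right _))
  · intro ξ hξ
    rw [test_diff hwi hN a z hξ]
    have hξc := hξ.continuous
    obtain ⟨Cξ, hCξ⟩ := isCompact_univ.exists_bound_of_continuousOn hξc.continuousOn
    unfold diffMeas
    rw [integral_map hφ.aemeasurable (by fun_prop), integral_prod]
    · rw [← Real.norm_eq_abs]
      refine (norm_integral_le_integral_norm _).trans ?_
      refine integral_mono_of_nonneg (ae_of_all _ fun _ => norm_nonneg _) ?_ (ae_of_all _ fun s => ?_)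
      · apply Integrable.integral_prod_left (f := fun q : ℝ × Torus d => |ξ (q.2 + projT d (q.1 • z))|)
        refine Integrable.of_bound (C := Cξ) (by fun_prop) (ae_of_all _ fun q => ?_)
        rw [Real.norm_eq_abs, abs_abs]; exact hCξ _ trivial
      · simp only
        rw [enorm_withDensity_integral _ hm]
        refine (norm_integral_le_integral_norm _).trans_eq ?_
        congr 1; funext y
        rw [norm_mul, mul_comm]; rfl
    · refine Integrable.of_bound (C := Cξ) (by fun_prop) (ae_of_all _ fun q => ?_)
      rw [Real.norm_eq_abs, abs_abs]; exact hCξ _ trivial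

lemma diff_lintegral_le {d : ℕ} {w : Torus d → Vec d} (hw : Measurable w) (hwi : Integrable w)
    {μ : Measure (Torus d)} [IsFiniteMeasure μ] {N : Torus d → (Vec d →L[ℝ] Vec d)}
    (hNm : Measurable N) {c : ℝ} (hNb : ∀ y, ‖N y‖ ≤ c)
    (hN : IsWeakDer w μ N) (a : Vec d →L[ℝ] ℝ) (z : Vec d)
    {ψ : Torus d → ℝ} (hψ : SmoothT ψ) {C : ℝ} (hC0 : 0 ≤ C) (hC : ∀ y, ‖DT ψ y‖ ≤ C) :
    ∫⁻ x, ‖ψ x‖ₑ * ‖a (w x - w (x - projT d z))‖ₑ ≤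
      ∫⁻ y, (‖ψ y‖ₑ + ENNReal.ofReal (C * ‖z‖)) * ‖a (N y z)‖ₑ ∂μ := by
  have hm := measurable_aNz hNm a z
  have hb := finite_aNz (μ := μ) hNb a z
  have hbi : Integrable (fun y => a (N y z)) μ :=
    Integrable.of_bound hm.aestronglyMeasurable _ (ae_of_all _ hb)
  have hfin : IsFiniteMeasure (μ.withDensity fun y => ‖a (N y z)‖ₑ) :=
    isFiniteMeasure_withDensity hbi.2.ne
  have h2 : Continuous (projT d) := continuous_projT
  have hψc := hψ.continuous
  have hφ : Continuous (fun q : ℝ × Torus d => q.2 + projT d (q.1 • z)) := by fun_prop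
  have hm1 : Measurable fun x => ‖a (w x - w (x - projT d z))‖ₑ :=
    (a.continuous.measurable.comp (hw.sub (hw.comp (measurable_id.sub_const _)))).enorm
  have hψm : Measurable fun x => ‖ψ x‖ₑ := hψc.measurable.enorm
  calc ∫⁻ x, ‖ψ x‖ₑ * ‖a (w x - w (x - projT d z))‖ₑ
      = ∫⁻ x, ‖ψ x‖ₑ ∂(volume : Measure (Torus d)).withDensity (fun x => ‖a (w x - w (x - projT d z))‖ₑ) := by
        rw [lintegral_withDensity_eq_lintegral_mul _ hm1 hψm]
        simp [mul_comm]
    _ ≤ ∫⁻ x, ‖ψ x‖ₑ ∂(diffMeas μ N a z) := lintegral_mono' (diff_le hw hwi hNm hNb hN a z) le_rfl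
    _ = ∫⁻ q, ‖ψ (q.2 + projT d (q.1 • z))‖ₑ
          ∂((volume.restrict (Ioc (0:ℝ) 1)).prod (μ.withDensity fun y => ‖a (N y z)‖ₑ)) := by
        unfold diffMeas
        rw [lintegral_map hψm hφ.measurable]
    _ = ∫⁻ s in Ioc (0:ℝ) 1, ∫⁻ y, ‖ψ (y + projT d (s • z))‖ₑ ∂(μ.withDensity fun y => ‖a (N y z)‖ₑ) := by
        rw [lintegral_prod _ (by exact (hψm.comp hφ.measurable).aemeasurable)]
    _ ≤ ∫⁻ s in Ioc (0:ℝ) 1, ∫⁻ y, (‖ψ y‖ₑ + ENNReal.ofReal (C * ‖z‖)) ∂(μ.withDensity fun y => ‖a (N y z)‖ₑ) := by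
        refine setLIntegral_mono' measurableSet_Ioc fun s hs => lintegral_mono fun y => ?_
        have h3 := lip_of_DT_bound hψ.contDiff_one hC y (s • z)
        have h4 : ‖s • z‖ ≤ ‖z‖ := by
          rw [norm_smul, Real.norm_eq_abs, abs_of_pos hs.1]
          exact mul_le_of_le_one_left (norm_nonneg _) hs.2
        calc ‖ψ (y + projT d (s • z))‖ₑ = ‖ψ y + (ψ (y + projT d (s • z)) - ψ y)‖ₑ := by
              congr 1; ring
          _ ≤ ‖ψ y‖ₑ + ‖ψ (y + projT d (s • z)) - ψ y‖ₑ := enorm_add_le _ _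
          _ ≤ _ := by
              gcongr
              rw [← ofReal_norm]
              refine ENNReal.ofReal_le_ofReal (h3.trans (by gcongr))
    _ = ∫⁻ y, (‖ψ y‖ₑ + ENNReal.ofReal (C * ‖z‖)) ∂(μ.withDensity fun y => ‖a (N y z)‖ₑ) := by
        simp
    _ = _ := by
        rw [lintegral_withDensity_eq_lintegral_mul _ hm.enorm (by exact hψm.add measurable_const)]
        simp [mul_comm]

lemma trace_smulRight' {d : ℕ} (f : Vec d →L[ℝ] ℝ) (v : Vec d) :
    LinearMap.trace ℝ (Vec d) (f.smulRight v : Vec d →L[ℝ] Vec d).toLinearMap = f v := by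
  have : (f.smulRight v : Vec d →L[ℝ] Vec d).toLinearMap = (f : Vec d →ₗ[ℝ] ℝ).smulRight v := rfl
  rw [this, LinearMap.trace_smulRight]; rfl

lemma exists_weakDer {d : ℕ} {w : Torus d → Vec d} (hw : Measurable w) (hwi : Integrable w)
    (hdiv : ∀ ψ : Torus d → ℝ, SmoothT ψ → ∫ y, DT ψ y (w y) = 0)
    {Dp Dm : Fin d → Fin d → Measure (Torus d)} (h : HasBVStructure d w Dp Dm) :
    ∃ (μ : Measure (Torus d)) (N : Torus d → (Vec d →L[ℝ] Vec d)), IsFiniteMeasure μ ∧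
      μ univ = ∑ i, ∑ j, (Dp i j univ + Dm i j univ) ∧ Measurable N ∧
      (∀ y, ‖N y‖ ≤ (d : ℝ) * d) ∧
      (∀ y, LinearMap.trace ℝ (Vec d) (N y).toLinearMap = 0) ∧ IsWeakDer w μ N := by
  set μ : Measure (Torus d) := ∑ i, ∑ j, (Dp i j + Dm i j) with hμ
  have hfp : ∀ i j, IsFiniteMeasure (Dp i j) := fun i j => ⟨(h.1 i j).1⟩
  have hfm : ∀ i j, IsFiniteMeasure (Dm i j) := fun i j => ⟨(h.1 i j).2⟩
  have hμu : μ univ = ∑ i, ∑ j, (Dp i j univ + Dm i j univ) := by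
    simp [hμ, Measure.finsetSum_apply]
  have hμf : IsFiniteMeasure μ := ⟨by
    rw [hμu]
    exact ENNReal.sum_lt_top.2 fun i _ => ENNReal.sum_lt_top.2 fun j _ =>
      ENNReal.add_lt_top.2 (h.1 i j)⟩
  have hle : ∀ i j, Dp i j + Dm i j ≤ μ := fun i j => by
    rw [hμ]
    refine le_trans ?_ (Finset.single_le_sum (f := fun i => ∑ j, (Dp i j + Dm i j))
      (fun _ _ => Measure.zero_le _) (Finset.mem_univ i))
    exact Finset.single_le_sum (f := fun j => (Dp i j + Dm i j)) (fun _ _ => Measure.zero_le _) (Finset.mem_univ j)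
  have hp := fun i j => exists_density μ (Dp i j) ((Measure.le_add_right le_rfl).trans (hle i j))
  have hm := fun i j => exists_density μ (Dm i j) ((Measure.le_add_left le_rfl).trans (hle i j))
  choose p hpm hp0 hp1 hpe using hp
  choose m hmm hm0 hm1 hme using hm
  -- the matrix
  let E : Fin d → Fin d → (Vec d →L[ℝ] Vec d) := fun i j =>
    (EuclideanSpace.proj i : Vec d →L[ℝ] ℝ).smulRight (EuclideanSpace.single j (1:ℝ))
  have hE : ∀ i j, ‖E i j‖ ≤ 1 := fun i j => by
    refine ContinuousLinearMap.opNorm_le_bound _ zero_le_one fun z => ?_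
    simp only [E, ContinuousLinearMap.smulRight_apply, norm_smul, one_mul]
    simpa using PiLp.norm_apply_le z i
  let N0 : Torus d → (Vec d →L[ℝ] Vec d) := fun y => ∑ i, ∑ j, (p i j y - m i j y) • E i j
  have hN0m : Measurable N0 := by
    refine Finset.measurable_sum _ fun i _ => Finset.measurable_sum _ fun j _ => ?_
    exact ((hpm i j).sub (hmm i j)).smul_const _
  have hN0t : ∀ y, LinearMap.trace ℝ (Vec d) (N0 y).toLinearMap = ∑ i, (p i i y - m i i y) := by
    intro y
    have : (N0 y).toLinearMap = ∑ i, ∑ j, (p i j y - m i j y) • (E i j).toLinearMap := by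
      ext z; simp [N0]
    rw [this]
    simp only [map_sum, map_smul, E, trace_smulRight']
    refine Finset.sum_congr rfl fun i _ => ?_
    rw [Finset.sum_eq_single i]
    · simp
    · intro j _ hj
      simp [hj.symm]
    · simp
  have hwj : ∀ j, Integrable (fun y => w y j) := fun j =>
    (EuclideanSpace.proj j : Vec d →L[ℝ] ℝ).integrable_comp hwi
  -- basic formula
  have hform : ∀ i j (ψ : Torus d → ℝ), SmoothT ψ →
      ∫ y, w y j * DT ψ y (EuclideanSpace.single i 1) = -∫ y, ψ y * (p i j y - m i j y) ∂μ := by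
    intro i j ψ hψ
    rw [bv_torus hw h i j hψ, hpe i j, hme i j, integral_density μ (hpm i j) (hp0 i j),
      integral_density μ (hmm i j) (hm0 i j), ← integral_sub]
    · congr 2; funext y; ring
    · exact (integrable_cont μ hψ.continuous).bdd_mul (c := 1) (hpm i j).aestronglyMeasurable
        (ae_of_all _ fun y => by rw [Real.norm_eq_abs, abs_of_nonneg (hp0 i j y)]; exact hp1 i j y)
    · exact (integrable_cont μ hψ.continuous).bdd_mul (c := 1) (hmm i j).aestronglyMeasurable
        (ae_of_all _ fun y => by rw [Real.norm_eq_abs, abs_of_nonneg (hm0 i j y)]; exact hm1 i j y)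
  have hb : ∀ i j y, |p i j y - m i j y| ≤ 1 := fun i j y => by
    rw [abs_le]; constructor <;> linarith [hp0 i j y, hp1 i j y, hm0 i j y, hm1 i j y]
  have hbi : ∀ i j, Integrable (fun y => p i j y - m i j y) μ := fun i j =>
    Integrable.of_bound ((hpm i j).sub (hmm i j)).aestronglyMeasurable 1 (ae_of_all _ (hb i j))
  have hψb : ∀ i j (ψ : Torus d → ℝ), SmoothT ψ →
      Integrable (fun y => ψ y * (p i j y - m i j y)) μ := fun i j ψ hψ =>
    (integrable_cont μ hψ.continuous).mul_bdd (c := 1) ((hpm i j).sub (hmm i j)).aestronglyMeasurable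
        (ae_of_all _ (hb i j))
  have hwD : ∀ i j (ψ : Torus d → ℝ), SmoothT ψ →
      Integrable (fun y => w y j * DT ψ y (EuclideanSpace.single i 1)) := by
    intro i j ψ hψ
    obtain ⟨C, hC0, hC⟩ := DT_bound hψ.contDiff_one
    have h1 := continuous_DT hψ.contDiff_one
    refine (hwj j).mul_bdd (c := C * ‖(EuclideanSpace.single i (1:ℝ) : Vec d)‖)
      (g := fun y => DT ψ y (EuclideanSpace.single i 1)) (by fun_prop) (ae_of_all _ fun y => ?_)
    exact (ContinuousLinearMap.le_opNorm _ _).trans (by gcongr; exact hC _)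
  -- trace zero
  have htr : ∀ᵐ y ∂μ, LinearMap.trace ℝ (Vec d) (N0 y).toLinearMap = 0 := by
    simp only [hN0t]
    have hmt : Measurable fun y => ∑ i, (p i i y - m i i y) :=
      Finset.measurable_sum _ fun i _ => (hpm i i).sub (hmm i i)
    have h1 : μ.withDensity (fun y => ‖∑ i, (p i i y - m i i y)‖ₑ) ≤ 0 := by
      refine dual_le μ 0 hmt (integrable_finsetSum _ fun i _ => hbi i i) fun ξ hξ => ?_
      have e1 : ∫ y, ξ y * ∑ i, (p i i y - m i i y) ∂μ = -∫ y, DT ξ y (w y) := by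
        simp_rw [Finset.mul_sum, clm_apply_eq_sum (DT ξ _) (w _)]
        rw [integral_finsetSum _ fun i _ => hψb i i ξ hξ, integral_finsetSum _ fun i _ => hwD i i ξ hξ,
          ← Finset.sum_neg_distrib]
        refine Finset.sum_congr rfl fun i _ => ?_
        rw [hform i i ξ hξ, neg_neg]
      rw [e1, hdiv ξ hξ]; simp
    have h2 : μ.withDensity (fun y => ‖∑ i, (p i i y - m i i y)‖ₑ) = 0 := le_antisymm h1 (Measure.zero_le _)
    rw [withDensity_eq_zero_iff hmt.enorm.aemeasurable] at h2
    filter_upwards [h2] with y hy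
    simpa using hy
  have hmtr : MeasurableSet {y | LinearMap.trace ℝ (Vec d) (N0 y).toLinearMap = 0} := by
    simp only [hN0t]
    exact measurableSet_eq_fun (Finset.measurable_sum _ fun i _ => (hpm i i).sub (hmm i i))
      measurable_const
  classical
  refine ⟨μ, {y | LinearMap.trace ℝ (Vec d) (N0 y).toLinearMap = 0}.indicator N0, hμf, hμu,
    hN0m.indicator hmtr, fun y => ?_, fun y => ?_, ?_⟩
  · refine (norm_indicator_le_norm_self _ _).trans ?_
    calc ‖N0 y‖ ≤ ∑ i : Fin d, ∑ j : Fin d, (1:ℝ) := by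
          refine (norm_sum_le _ _).trans (Finset.sum_le_sum fun i _ => ?_)
          refine (norm_sum_le _ _).trans (Finset.sum_le_sum fun j _ => ?_)
          rw [norm_smul]
          exact mul_le_one₀ (hb i j y) (norm_nonneg _) (hE i j)
      _ = _ := by simp
  · by_cases hy : y ∈ {y | LinearMap.trace ℝ (Vec d) (N0 y).toLinearMap = 0}
    · rw [indicator_of_mem hy]; exact hy
    · rw [indicator_of_notMem hy]; simp
  · intro a z ψ hψ
    have e1 : ∫ y, ψ y * a (({y | LinearMap.trace ℝ (Vec d) (N0 y).toLinearMap = 0}.indicator N0) y z) ∂μ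
        = ∫ y, ∑ i, ∑ j, (z i * a (EuclideanSpace.single j 1)) * (ψ y * (p i j y - m i j y)) ∂μ := by
      refine integral_congr_ae ?_
      filter_upwards [htr] with y hy
      rw [indicator_of_mem (by exact hy)]
      simp only [N0, E, sum_apply, smul_apply,
        ContinuousLinearMap.smulRight_apply, map_sum, map_smul, smul_eq_mul, Finset.mul_sum]
      refine Finset.sum_congr rfl fun i _ => Finset.sum_congr rfl fun j _ => ?_
      simp
      ring
    have e2 : ∀ y, a (w y) * DT ψ y z = ∑ i, ∑ j, (z i * a (EuclideanSpace.single j 1)) *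
        (w y j * DT ψ y (EuclideanSpace.single i 1)) := by
      intro y
      rw [clm_apply_eq_sum a (w y), clm_apply_eq_sum (DT ψ y) z, Finset.sum_mul_sum, Finset.sum_comm]
      refine Finset.sum_congr rfl fun i _ => Finset.sum_congr rfl fun j _ => ?_
      ring
    rw [e1]
    simp_rw [e2]
    rw [integral_finsetSum _ fun i _ => integrable_finsetSum _ fun j _ => (hwD i j ψ hψ).const_mul _,
      integral_finsetSum _ fun i _ => integrable_finsetSum _ fun j _ => (hψb i j ψ hψ).const_mul _,
      ← Finset.sum_neg_distrib]
    refine Finset.sum_congr rfl fun i _ => ?_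
    rw [integral_finsetSum _ fun j _ => (hwD i j ψ hψ).const_mul _,
      integral_finsetSum _ fun j _ => (hψb i j ψ hψ).const_mul _, ← Finset.sum_neg_distrib]
    refine Finset.sum_congr rfl fun j _ => ?_
    rw [integral_const_mul, integral_const_mul, hform i j ψ hψ]; ring

/-! ### Alberti's lemma -/

lemma det_hasDerivAt_trace {n : ℕ} (f : ℝ → Matrix (Fin n) (Fin n) ℝ) (f' : Matrix (Fin n) (Fin n) ℝ)
    (h0 : f 0 = 1) (hf : ∀ i j, HasDerivAt (fun s => f s i j) (f' i j) 0) :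
    HasDerivAt (fun s => (f s).det) f'.trace 0 := by
  -- work in the function space
  let Δ : (Fin n → Fin n → ℝ) → ℝ := fun g => Matrix.det (Matrix.of g)
  have hΔ : Differentiable ℝ Δ := by
    simp only [Δ, Matrix.det_apply, Matrix.of_apply]
    fun_prop
  let g : ℝ → (Fin n → Fin n → ℝ) := fun s i j => f s i j
  let g' : Fin n → Fin n → ℝ := fun i j => f' i j
  let e : Fin n → Fin n → ℝ := fun i j => (1 : Matrix (Fin n) (Fin n) ℝ) i j
  have hg0 : g 0 = e := by funext i j; simp [g, e, h0]
  have hg : HasDerivAt g g' 0 := hasDerivAt_pi.2 fun i => hasDerivAt_pi.2 fun j => hf i j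
  let l : ℝ → (Fin n → Fin n → ℝ) := fun s => e + s • g'
  have hl : HasDerivAt l g' 0 := by
    have := ((hasDerivAt_id (0:ℝ)).smul_const g').const_add e
    rwa [one_smul] at this
  have hl0 : l 0 = e := by simp [l]
  have h1 : HasDerivAt (fun s => Δ (g s)) (fderiv ℝ Δ e g') 0 := by
    have := (hΔ (g 0)).hasFDerivAt.comp_hasDerivAt 0 hg
    rwa [hg0] at this
  have h2 : HasDerivAt (fun s => Δ (l s)) (fderiv ℝ Δ e g') 0 := by
    have := (hΔ (l 0)).hasFDerivAt.comp_hasDerivAt 0 hl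
    rwa [hl0] at this
  have h3 : HasDerivAt (fun s => Δ (l s)) f'.trace 0 := by
    have e1 : ∀ s : ℝ, Δ (l s) = 1 + f'.trace * s +
        (Matrix.det (1 + (Polynomial.X : Polynomial ℝ) • f'.map Polynomial.C)).divX.divX.eval s * s ^ 2 := by
      intro s
      rw [← Matrix.det_one_add_smul]
      rfl
    simp only [e1]
    set P := (Matrix.det (1 + (Polynomial.X : Polynomial ℝ) • f'.map Polynomial.C)).divX.divX
    have a1 : HasDerivAt (fun s : ℝ => 1 + f'.trace * s) f'.trace 0 := by
      simpa using ((hasDerivAt_id' (0:ℝ)).const_mul f'.trace).const_add 1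
    have a2 : HasDerivAt (fun s : ℝ => P.eval s * s ^ 2) 0 0 := by
      simpa using (P.hasDerivAt 0).fun_mul (hasDerivAt_pow 2 (0:ℝ))
    simpa using a1.fun_add a2
  have h4 := h2.unique h3
  rw [h4] at h1
  exact h1

lemma expL_zero {d : ℕ} (N : Vec d →L[ℝ] Vec d) :
    (NormedSpace.exp ((0:ℝ) • N) : Vec d →L[ℝ] Vec d) = 1 := by
  have h : (0:ℝ) • N = 0 := by ext v; simp
  rw [h, NormedSpace.exp_zero]

lemma expL_add {d : ℕ} (N : Vec d →L[ℝ] Vec d) (s t : ℝ) :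
    (NormedSpace.exp ((s + t) • N) : Vec d →L[ℝ] Vec d)
      = NormedSpace.exp (s • N) * NormedSpace.exp (t • N) := by
  let _ : NormedAlgebra ℚ (Vec d →L[ℝ] Vec d) := NormedAlgebra.restrictScalars ℚ ℝ _
  have h : (s + t) • N = s • N + t • N := add_smul s t N
  have hc : Commute (s • N) (t • N) := by
    show (s • N) * (t • N) = (t • N) * (s • N)
    ext v i
    simp
    ring
  rw [h]
  exact NormedSpace.exp_add_of_commute hc

lemma det_exp_eq_one {d : ℕ} (N : Vec d →L[ℝ] Vec d)
    (hN : LinearMap.trace ℝ (Vec d) N.toLinearMap = 0) (s : ℝ) :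
    LinearMap.det (NormedSpace.exp (s • N) : Vec d →L[ℝ] Vec d).toLinearMap = 1 := by
  let bs := (EuclideanSpace.basisFun (Fin d) ℝ).toBasis
  let m : ℝ → Matrix (Fin d) (Fin d) ℝ := fun s =>
    LinearMap.toMatrix bs bs (NormedSpace.exp (s • N) : Vec d →L[ℝ] Vec d).toLinearMap
  let f : ℝ → ℝ := fun s => LinearMap.det (NormedSpace.exp (s • N) : Vec d →L[ℝ] Vec d).toLinearMap
  have hfm : ∀ s, f s = (m s).det := fun s => (LinearMap.det_toMatrix bs _).symm
  have hexp : ∀ t, HasDerivAt (fun u : ℝ => (NormedSpace.exp (u • N) : Vec d →L[ℝ] Vec d))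
      (NormedSpace.exp (t • N) * N) t := fun t => hasDerivAt_exp_smul_const N t
  have hd0 : HasDerivAt f 0 0 := by
    have h1 : HasDerivAt (fun s => (m s).det) (LinearMap.toMatrix bs bs N.toLinearMap).trace 0 := by
      refine det_hasDerivAt_trace m _ ?_ ?_
      · have := expL_zero N
        simp only [m, this]
        exact LinearMap.toMatrix_id bs
      · intro i j
        let ev : (Vec d →L[ℝ] Vec d) →L[ℝ] ℝ :=
          (EuclideanSpace.proj i : Vec d →L[ℝ] ℝ).comp
            (ContinuousLinearMap.apply ℝ (Vec d) (bs j))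
        have h2 := ev.hasFDerivAt.comp_hasDerivAt (0:ℝ) (hexp 0)
        have e1 : ∀ A : Vec d →L[ℝ] Vec d, LinearMap.toMatrix bs bs A.toLinearMap i j = ev A := by
          intro A
          simp [LinearMap.toMatrix_apply, ev, bs]
        have e2 : (fun s => m s i j) = ev ∘ fun u : ℝ => (NormedSpace.exp (u • N) : Vec d →L[ℝ] Vec d) := by
          funext s; exact e1 _
        rw [e2, e1]
        rw [expL_zero, one_mul] at h2
        exact h2
    have h2 : (LinearMap.toMatrix bs bs N.toLinearMap).trace = 0 := by
      rw [← LinearMap.trace_eq_matrix_trace, hN]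
    rw [h2] at h1
    have : f = fun s => (m s).det := funext hfm
    rw [this]; exact h1
  have hmul : ∀ s t, f (s + t) = f s * f t := by
    intro s t
    simp only [f]
    rw [expL_add]
    exact LinearMap.det.map_mul _ _
  have hd : ∀ s, HasDerivAt f 0 s := by
    intro s
    have h1 : f = fun u => f s * f (u - s) := by
      funext u; rw [← hmul]; congr 1; ring
    rw [h1]
    have h2 : HasDerivAt (fun u => f (u - s)) 0 s := by
      have := HasDerivAt.comp_sub_const (f := f) (f' := 0) s s (by simpa using hd0)
      exact this
    simpa using h2.const_mul (f s)
  have hc := is_const_of_deriv_eq_zero (fun s => (hd s).differentiableAt) (fun s => (hd s).deriv) s 0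
  have h00 : f 0 = 1 := by
    have := expL_zero N
    simp only [f, this]
    exact LinearMap.det_id
  exact hc.trans h00

lemma mp_exp {d : ℕ} (N : Vec d →L[ℝ] Vec d)
    (hN : LinearMap.trace ℝ (Vec d) N.toLinearMap = 0) (s : ℝ) :
    MeasurePreserving (NormedSpace.exp (s • N) : Vec d →L[ℝ] Vec d) volume volume := by
  refine ⟨(NormedSpace.exp (s • N) : Vec d →L[ℝ] Vec d).continuous.measurable, ?_⟩
  have h := det_exp_eq_one N hN s
  have := Measure.map_linearMap_addHaar_eq_smul_addHaar (volume : Measure (Vec d))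
    (f := (NormedSpace.exp (s • N) : Vec d →L[ℝ] Vec d).toLinearMap) (by rw [h]; exact one_ne_zero)
  rw [h] at this
  simpa using this

/-- Admissible convolution kernels. -/
structure IsKer {d : ℕ} (ρ : Vec d → ℝ) : Prop where
  smooth : ContDiff ℝ 1 ρ
  supp : HasCompactSupport ρ
  int : ∫ z, ρ z = 1

/-- The anisotropic quantity in Ambrosio-Alberti's lemma. -/
def gK {d : ℕ} (ρ : Vec d → ℝ) (N : Vec d →L[ℝ] Vec d) : ℝ≥0∞ :=
  ∫⁻ z, ‖fderiv ℝ ρ z (N z)‖ₑ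

lemma alberti {d : ℕ} (N : Vec d →L[ℝ] Vec d)
    (hN : LinearMap.trace ℝ (Vec d) N.toLinearMap = 0) {δ : ℝ} (hδ : 0 < δ) :
    ∃ ρ : Vec d → ℝ, IsKer ρ ∧ gK ρ N ≤ ENNReal.ofReal δ := by
  let φ : ContDiffBump (0 : Vec d) := default
  let θ : Vec d → ℝ := φ.normed volume
  have hθs : ContDiff ℝ (⊤ : ℕ∞) θ := φ.contDiff_normed
  have hθ1 : ContDiff ℝ 1 θ := hθs.of_le (by simp)
  have hθc : HasCompactSupport θ := φ.hasCompactSupport_normed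
  have hθi : ∫ z, θ z = 1 := φ.integral_normed
  have hθ0 : ∀ z, 0 ≤ θ z := φ.nonneg_normed
  have hθcont : Continuous θ := hθ1.continuous
  have hθint : Integrable θ := hθcont.integrable_of_hasCompactSupport hθc
  have hθl : ∫⁻ z, ‖θ z‖ₑ = 1 := by
    have := ofReal_integral_eq_lintegral_ofReal hθint (ae_of_all _ hθ0)
    rw [hθi, ENNReal.ofReal_one] at this
    rw [this]
    congr 1; funext z
    rw [Real.enorm_eq_ofReal (hθ0 z)]
  set τ : ℝ := 2 / δ with hτ
  have hτ0 : 0 < τ := by positivity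
  let A : ℝ → (Vec d →L[ℝ] Vec d) := fun s => NormedSpace.exp (s • (-N))
  have hN' : LinearMap.trace ℝ (Vec d) (-N).toLinearMap = 0 := by
    have : (-N).toLinearMap = - N.toLinearMap := rfl
    rw [this, map_neg, hN, neg_zero]
  have hAd : ∀ t, HasDerivAt A (A t * (-N)) t := fun t => hasDerivAt_exp_smul_const (-N) t
  have hAc : Continuous A := continuous_iff_continuousAt.2 fun t => (hAd t).continuousAt
  have hAm : ∀ s, MeasurePreserving (A s) volume volume := fun s => mp_exp (-N) hN' s
  have hDc : Continuous (fderiv ℝ θ) := hθ1.continuous_fderiv one_ne_zero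
  obtain ⟨C, hC⟩ := (hθc.fderiv (𝕜 := ℝ)).exists_bound_of_continuous hDc
  have hC0 : 0 ≤ C := (norm_nonneg _).trans (hC 0)
  let F' : Vec d → ℝ → (Vec d →L[ℝ] ℝ) := fun z s => (fderiv ℝ θ (A s z)).comp (A s)
  have hF'c : Continuous (Function.uncurry F') := by
    simp only [Function.uncurry_def, F']
    have : Continuous fun q : Vec d × ℝ => A q.2 q.1 := by fun_prop
    exact (hDc.comp this).clm_comp (hAc.comp continuous_snd)
  have hFd : ∀ z s, HasFDerivAt (fun z => θ (A s z)) (F' z s) z := fun z s =>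
    ((hθ1.differentiable one_ne_zero) _).hasFDerivAt.comp z (A s).hasFDerivAt
  have hFc : Continuous (fun q : Vec d × ℝ => θ (A q.2 q.1)) := by fun_prop
  let R : Vec d → ℝ := fun z => ∫ s in (0:ℝ)..τ, θ (A s z)
  have hRd : ∀ z, HasFDerivAt R (∫ s in (0:ℝ)..τ, F' z s) z := by
    intro z
    refine intervalIntegral.hasFDerivAt_integral_of_dominated_of_fderiv_le (s := univ)
      (bound := fun s => C * ‖A s‖) univ_mem (Eventually.of_forall fun x => ?_) ?_ ?_ ?_ ?_ ?_
    · exact (by fun_prop : Continuous fun s => θ (A s x)).aestronglyMeasurable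
    · exact (by fun_prop : Continuous fun s => θ (A s z)).intervalIntegrable _ _
    · exact (hF'c.comp (by fun_prop : Continuous fun s : ℝ => (z, s))).aestronglyMeasurable
    · refine ae_of_all _ fun s _ x _ => ?_
      exact (ContinuousLinearMap.opNorm_comp_le _ _).trans (by gcongr; exact hC _)
    · exact (by fun_prop : Continuous fun s => C * ‖A s‖).intervalIntegrable _ _
    · exact ae_of_all _ fun s _ x _ => hFd x s
  have hRc1 : ContDiff ℝ 1 R := by
    rw [contDiff_one_iff_fderiv]
    refine ⟨fun z => (hRd z).differentiableAt, ?_⟩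
    have : fderiv ℝ R = fun z => ∫ s in (0:ℝ)..τ, F' z s := funext fun z => (hRd z).fderiv
    rw [this]
    exact intervalIntegral.continuous_parametric_intervalIntegral_of_continuous' hF'c _ _
  have hdir : ∀ z, fderiv ℝ R z (N z) = θ z - θ (A τ z) := by
    intro z
    rw [(hRd z).fderiv, ContinuousLinearMap.intervalIntegral_apply]
    · have h1 : ∀ s, HasDerivAt (fun s => - θ (A s z)) (F' z s (N z)) s := by
        intro s
        have h2 : HasDerivAt (fun s => A s z) ((A s * (-N)) z) s := by
          have := (ContinuousLinearMap.apply ℝ (Vec d) z).hasFDerivAt.comp_hasDerivAt s (hAd s)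
          exact this
        have h3 := ((hθ1.differentiable one_ne_zero) (A s z)).hasFDerivAt.comp_hasDerivAt s h2
        have h4 := h3.neg
        have e5 : -((fderiv ℝ θ (A s z)) ((A s * (-N)) z)) = F' z s (N z) := by
          have : (A s * (-N)) z = - (A s (N z)) := by
            show A s (-(N z)) = _
            rw [map_neg]
          rw [this, map_neg, neg_neg]; rfl
        rw [e5] at h4
        exact h4
      rw [intervalIntegral.integral_eq_sub_of_hasDerivAt (fun s _ => h1 s)]
      · have : A 0 = 1 := expL_zero (-N)
        rw [this]
        simp only [one_apply_eq_self]; ring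
      · have hc : Continuous fun s => F' z s := hF'c.comp (by fun_prop : Continuous fun s : ℝ => (z, s))
        exact (by fun_prop : Continuous fun s => F' z s (N z)).intervalIntegrable _ _
    · exact (hF'c.comp (by fun_prop : Continuous fun s : ℝ => (z, s))).intervalIntegrable _ _
  have hRsupp : HasCompactSupport R := by
    have hcomp : IsCompact ((fun q : ℝ × Vec d => (NormedSpace.exp (q.1 • N) : Vec d →L[ℝ] Vec d) q.2) ''
        (Icc 0 τ ×ˢ tsupport θ)) := by
      refine (isCompact_Icc.prod hθc).image ?_
      have : Continuous fun s : ℝ => (NormedSpace.exp (s • N) : Vec d →L[ℝ] Vec d) :=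
        continuous_iff_continuousAt.2 fun t => (hasDerivAt_exp_smul_const N t).continuousAt
      exact (this.comp continuous_fst).clm_apply continuous_snd
    refine HasCompactSupport.intro hcomp fun z hz => ?_
    simp only [R]
    rw [intervalIntegral.integral_of_le hτ0.le]
    refine setIntegral_eq_zero_of_forall_eq_zero fun s hs => ?_
    by_contra hne
    refine hz ⟨(s, A s z), ⟨⟨hs.1.le, hs.2⟩, subset_tsupport _ hne⟩, ?_⟩
    have : (NormedSpace.exp (s • N) : Vec d →L[ℝ] Vec d) * A s = 1 := by
      have e1 : s • (-N) = (-s) • N := by ext v; simp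
      simp only [A]
      rw [e1, ← expL_add, add_neg_cancel, expL_zero]
    change ((NormedSpace.exp (s • N) : Vec d →L[ℝ] Vec d) * A s) z = z
    rw [this]; rfl
  have hRint : ∫ z, R z = τ := by
    simp only [R]
    simp_rw [intervalIntegral.integral_of_le hτ0.le]
    rw [integral_integral_swap]
    · have : ∀ s, ∫ z, θ (A s z) = 1 := by
        intro s
        rw [← hθi]
        have h1 := integral_map (μ := volume) (φ := A s) (hAm s).measurable.aemeasurable
          (f := θ) (by rw [(hAm s).map_eq]; exact hθcont.aestronglyMeasurable)
        rw [(hAm s).map_eq] at h1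
        exact h1.symm
      simp_rw [this]
      simp [hτ0.le]
    · have hm : AEStronglyMeasurable (Function.uncurry fun (z : Vec d) (s : ℝ) => θ (A s z))
          ((volume : Measure (Vec d)).prod (volume.restrict (Ioc 0 τ))) := hFc.aestronglyMeasurable
      rw [integrable_prod_iff' hm]
      constructor
      · refine ae_of_all _ fun s => ?_
        exact (hAm s).integrable_comp_of_integrable hθint
      · have : ∀ s, ∫ z, ‖θ (A s z)‖ = 1 := by
          intro s
          rw [← hθi]
          have h1 := integral_map (μ := volume) (φ := A s) (hAm s).measurable.aemeasurable
            (f := θ) (by rw [(hAm s).map_eq]; exact hθcont.aestronglyMeasurable)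
          rw [(hAm s).map_eq] at h1
          rw [h1]
          congr 1; funext z; exact Real.norm_of_nonneg (hθ0 _)
        simp only [Function.uncurry, this]
        exact integrable_const _
  refine ⟨fun z => τ⁻¹ * R z, ⟨contDiff_const.mul hRc1, hRsupp.mul_left, ?_⟩, ?_⟩
  · rw [integral_const_mul, hRint, inv_mul_cancel₀ hτ0.ne']
  · unfold gK
    have h1 : ∀ z, fderiv ℝ (fun z => τ⁻¹ * R z) z (N z) = τ⁻¹ * (θ z - θ (A τ z)) := by
      intro z
      rw [((hRd z).const_mul τ⁻¹).fderiv, ← hdir z, (hRd z).fderiv]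
      simp
    simp_rw [h1]
    have hme : Measurable fun z => ‖θ z‖ₑ := hθcont.measurable.enorm
    calc ∫⁻ z, ‖τ⁻¹ * (θ z - θ (A τ z))‖ₑ ≤ ∫⁻ z, ‖τ⁻¹‖ₑ * (‖θ z‖ₑ + ‖θ (A τ z)‖ₑ) := by
          refine lintegral_mono fun z => ?_
          rw [enorm_mul]
          gcongr
          exact enorm_sub_le
      _ = ‖τ⁻¹‖ₑ * ((∫⁻ z, ‖θ z‖ₑ) + ∫⁻ z, ‖θ (A τ z)‖ₑ) := by
          rw [lintegral_const_mul' _ _ (by simp), lintegral_add_left hme]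
      _ = ‖τ⁻¹‖ₑ * 2 := by
          rw [(hAm τ).lintegral_comp hme, hθl, one_add_one_eq_two]
      _ = ENNReal.ofReal δ := by
          rw [Real.enorm_eq_ofReal (by positivity), ← ENNReal.ofReal_ofNat,
            ← ENNReal.ofReal_mul (by positivity)]
          congr 1
          rw [hτ]; field_simp
      _ ≤ _ := le_rfl

/-! ### Finite families of kernels -/

/-- First moment of the gradient of a kernel. -/
def gM {d : ℕ} (ρ : Vec d → ℝ) : ℝ≥0∞ := ∫⁻ z, ‖fderiv ℝ ρ z‖ₑ * ‖z‖ₑ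

lemma gM_lt_top {d : ℕ} {ρ : Vec d → ℝ} (h : IsKer ρ) : gM ρ < ∞ := by
  have hc : Continuous (fderiv ℝ ρ) := h.smooth.continuous_fderiv one_ne_zero
  have h1 : Continuous fun z : Vec d => ‖fderiv ℝ ρ z‖ * ‖z‖ := hc.norm.mul continuous_norm
  have h2 : HasCompactSupport fun z : Vec d => ‖fderiv ℝ ρ z‖ * ‖z‖ :=
    ((h.supp.fderiv (𝕜 := ℝ)).norm).mul_right
  have h3 := (h1.integrable_of_hasCompactSupport (μ := volume) h2).2
  unfold HasFiniteIntegral at h3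
  unfold gM
  convert h3 using 3 with z
  rw [enorm_mul, enorm_norm, enorm_norm]

lemma gK_le_add {d : ℕ} {ρ : Vec d → ℝ} (h : IsKer ρ) (N N' : Vec d →L[ℝ] Vec d) :
    gK ρ N' ≤ gK ρ N + ‖N' - N‖ₑ * gM ρ := by
  have hc : Continuous (fderiv ℝ ρ) := h.smooth.continuous_fderiv one_ne_zero
  unfold gK gM
  rw [← lintegral_const_mul' _ _ (by simp), ← lintegral_add_left]
  · refine lintegral_mono fun z => ?_
    have e : fderiv ℝ ρ z (N' z) = fderiv ℝ ρ z (N z) + fderiv ℝ ρ z ((N' - N) z) := by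
      rw [← map_add]; congr 1; simp
    rw [e]
    refine (enorm_add_le _ _).trans ?_
    gcongr
    calc ‖fderiv ℝ ρ z ((N' - N) z)‖ₑ ≤ ‖fderiv ℝ ρ z‖ₑ * ‖(N' - N) z‖ₑ :=
          ContinuousLinearMap.le_opENorm _ _
      _ ≤ ‖fderiv ℝ ρ z‖ₑ * (‖N' - N‖ₑ * ‖z‖ₑ) := by gcongr; exact ContinuousLinearMap.le_opENorm _ _
      _ = _ := by ring
  · exact (hc.clm_apply N.continuous).measurable.enorm

lemma gK_le_gM {d : ℕ} {ρ : Vec d → ℝ} (h : IsKer ρ) (N : Vec d →L[ℝ] Vec d) :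
    gK ρ N ≤ ‖N‖ₑ * gM ρ := by
  have := gK_le_add h 0 N
  have h0 : gK ρ (0 : Vec d →L[ℝ] Vec d) = 0 := by simp [gK]
  simpa [h0] using this

lemma measurable_gK {d : ℕ} {ρ : Vec d → ℝ} (h : IsKer ρ) : Measurable (gK ρ) := by
  have hc : Continuous (fderiv ℝ ρ) := h.smooth.continuous_fderiv one_ne_zero
  unfold gK
  have : Measurable fun q : (Vec d →L[ℝ] Vec d) × Vec d => ‖fderiv ℝ ρ q.2 (q.1 q.2)‖ₑ :=
    (((hc.comp continuous_snd).clm_apply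
      (continuous_fst.clm_apply continuous_snd)).measurable).enorm
  exact this.lintegral_prod_right'

lemma kernel_family (d : ℕ) {δ : ℝ} (hδ : 0 < δ) :
    ∃ S : Set (Vec d → ℝ), S.Finite ∧ (∀ ρ ∈ S, IsKer ρ) ∧
      ∀ N : Vec d →L[ℝ] Vec d, ‖N‖ ≤ d * d → LinearMap.trace ℝ (Vec d) N.toLinearMap = 0 →
        ∃ ρ ∈ S, gK ρ N ≤ ENNReal.ofReal δ := by
  let KN : Set (Vec d →L[ℝ] Vec d) := {N | ‖N‖ ≤ d * d ∧ LinearMap.trace ℝ (Vec d) N.toLinearMap = 0}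
  have hKc : IsCompact KN := by
    have : ProperSpace (Vec d →L[ℝ] Vec d) := FiniteDimensional.proper ℝ _
    refine Metric.isCompact_of_isClosed_isBounded ?_ ?_
    · refine (isClosed_le continuous_norm continuous_const).inter ?_
      let tr : (Vec d →L[ℝ] Vec d) →ₗ[ℝ] ℝ :=
        (LinearMap.trace ℝ (Vec d)).comp (ContinuousLinearMap.coeLM ℝ)
      have : Continuous tr := tr.continuous_of_finiteDimensional
      exact isClosed_eq this continuous_const
    · exact (Metric.isBounded_closedBall (x := (0 : Vec d →L[ℝ] Vec d)) (r := d * d)).subset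
        fun N hN => by simpa using hN.1
  have h1 : ∀ N ∈ KN, ∃ ρ : Vec d → ℝ, IsKer ρ ∧ gK ρ N ≤ ENNReal.ofReal (δ/2) := fun N hN =>
    alberti N hN.2 (by positivity)
  choose! ρ hρ hρg using h1
  have h2 : ∀ N ∈ KN, {N' : Vec d →L[ℝ] Vec d | ‖N' - N‖ₑ * gM (ρ N) ≤ ENNReal.ofReal (δ/2)} ∈ 𝓝 N := by
    intro N hN
    have ht : Tendsto (fun N' : Vec d →L[ℝ] Vec d => ‖N' - N‖ₑ * gM (ρ N)) (𝓝 N) (𝓝 0) := by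
      have : Tendsto (fun N' : Vec d →L[ℝ] Vec d => ‖N' - N‖ₑ) (𝓝 N) (𝓝 0) := by
        have : Continuous fun N' : Vec d →L[ℝ] Vec d => ‖N' - N‖ₑ := by fun_prop
        have h := this.tendsto N
        have e : ‖N - N‖ₑ = 0 := by
          rw [enorm_eq_nnnorm, ENNReal.coe_eq_zero, nnnorm_eq_zero, sub_self]
        rwa [e] at h
      have := ENNReal.Tendsto.mul_const (b := gM (ρ N)) this (Or.inr (gM_lt_top (hρ N hN)).ne)
      simpa using this
    have := ht.eventually (Iic_mem_nhds (b := 0) (a := ENNReal.ofReal (δ/2)) (by simpa using hδ))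
    exact this
  obtain ⟨t, ht, hcov⟩ := hKc.elim_nhds_subcover _ h2
  refine ⟨ρ '' t, t.finite_toSet.image ρ, ?_, ?_⟩
  · rintro _ ⟨N, hN, rfl⟩; exact hρ N (ht N hN)
  · intro N hb htr
    have := hcov (show N ∈ KN from ⟨hb, htr⟩)
    simp only [mem_iUnion] at this
    obtain ⟨M, hM, hN⟩ := this
    refine ⟨ρ M, ⟨M, hM, rfl⟩, (gK_le_add (hρ M (ht M hM)) M N).trans ?_⟩
    calc _ ≤ ENNReal.ofReal (δ/2) + ENNReal.ofReal (δ/2) := add_le_add (hρg M (ht M hM)) hN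
      _ = ENNReal.ofReal δ := by rw [← ENNReal.ofReal_add (by positivity) (by positivity)]; ring_nf

/-! ### Kernels on the torus -/

lemma lint_scale {d : ℕ} {c : ℝ} (hc : 0 < c) {f : Vec d → ℝ≥0∞} (hf : Measurable f) :
    ∫⁻ z, ENNReal.ofReal (c ^ d) * f (c • z) = ∫⁻ z, f z := by
  have h := Measure.map_addHaar_smul (volume : Measure (Vec d)) hc.ne'
  rw [lintegral_const_mul' _ _ (by simp), ← lintegral_map hf (by fun_prop : Measurable fun z : Vec d => c • z)]
  have h' : Measure.map (fun z : Vec d => c • z) volume = _ := h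
  rw [h', lintegral_smul_measure, smul_eq_mul, ← mul_assoc, ← ENNReal.ofReal_mul (by positivity)]
  have : c ^ d * |(c ^ Module.finrank ℝ (Vec d))⁻¹| = 1 := by
    rw [finrank_euclideanSpace_fin, abs_of_pos (by positivity)]
    field_simp
  rw [this]; simp

/-- Rescaled kernel. -/
def scK {d : ℕ} (c : ℝ) (ρ : Vec d → ℝ) (z : Vec d) : ℝ := c ^ d * ρ (c • z)

lemma fderiv_scK {d : ℕ} {ρ : Vec d → ℝ} (h : IsKer ρ) {c : ℝ} (z : Vec d) :
    fderiv ℝ (scK c ρ) z = (c ^ d * c) • fderiv ℝ ρ (c • z) := by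
  unfold scK
  have h1 : DifferentiableAt ℝ (fun z => ρ (c • z)) z :=
    (h.smooth.differentiable one_ne_zero).differentiableAt.comp z
      (by fun_prop : DifferentiableAt ℝ (fun z : Vec d => c • z) z)
  rw [fderiv_const_mul h1, fderiv_comp_smul, mul_smul]

lemma isKer_scK {d : ℕ} {ρ : Vec d → ℝ} (h : IsKer ρ) {c : ℝ} (hc : 0 < c) : IsKer (scK c ρ) := by
  refine ⟨?_, ?_, ?_⟩
  · exact contDiff_const.mul (h.smooth.comp (by fun_prop : ContDiff ℝ 1 fun z : Vec d => c • z))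
  · exact (h.supp.comp_smul hc.ne').mul_left
  · unfold scK
    rw [integral_const_mul, Measure.integral_comp_smul, h.int, finrank_euclideanSpace_fin,
      abs_of_pos (by positivity)]
    simp; field_simp

lemma gK_scK {d : ℕ} {ρ : Vec d → ℝ} (h : IsKer ρ) {c : ℝ} (hc : 0 < c) (N : Vec d →L[ℝ] Vec d) :
    gK (scK c ρ) N = gK ρ N := by
  have hcd : Continuous (fderiv ℝ ρ) := h.smooth.continuous_fderiv one_ne_zero
  unfold gK
  have := lint_scale hc (f := fun z => ‖fderiv ℝ ρ z (N z)‖ₑ)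
    (hcd.clm_apply N.continuous).measurable.enorm
  rw [← this]
  congr 1; funext z
  have e1 : fderiv ℝ (scK c ρ) z (N z) = c ^ d * fderiv ℝ ρ (c • z) (N (c • z)) := by
    rw [fderiv_scK h, map_smul, map_smul]
    show (c ^ d * c) * fderiv ℝ ρ (c • z) (N z) = _ * (c * _)
    ring
  rw [e1, enorm_mul, Real.enorm_eq_ofReal (by positivity)]

lemma scK_bound {d : ℕ} {ρ : Vec d → ℝ} (h : IsKer ρ) :
    ∃ R : ℝ, 0 ≤ R ∧ ∀ c : ℝ, 0 < c → ∀ z, R / c < ‖z‖ → scK c ρ z = 0 := by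
  obtain ⟨R, hR⟩ := h.supp.isBounded.exists_norm_le
  refine ⟨max R 0, le_max_right _ _, fun c hc z hz => ?_⟩
  unfold scK
  by_contra hne
  have : c • z ∈ tsupport ρ := subset_tsupport _ (fun h0 => hne (by rw [h0, mul_zero]))
  have h1 := (hR _ this).trans (le_max_left R 0)
  rw [norm_smul, Real.norm_of_nonneg hc.le] at h1
  rw [div_lt_iff₀ hc] at hz
  linarith

/-- Kernel on the torus. -/
def KT {d : ℕ} (κ : Vec d → ℝ) (y : Torus d) : ℝ := κ (liftT d y)

lemma KT_cases {d : ℕ} (x₀ : Vec d) :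
    (∃ v : Vec d, v = x₀ - liftT d (projT d x₀) ∧ ∀ᶠ x in 𝓝 x₀, liftT d (projT d x) = x - v) ∨
      (∀ᶠ x in 𝓝 x₀, (1/4 : ℝ) < ‖liftT d (projT d x)‖) := by
  by_cases h : ∀ i, liftT d (projT d x₀) i < 1/2
  · left
    refine ⟨_, rfl, ?_⟩
    set v := x₀ - liftT d (projT d x₀)
    have hv : projT d v = 0 := by simp only [v]; rw [projT_sub, projT_liftT, sub_self]
    have h1 : ∀ᶠ x in 𝓝 x₀, ∀ i, (x - v) i ∈ Ioo (-1/2 : ℝ) (1/2) := by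
      rw [eventually_all]
      intro i
      have hc : ContinuousAt (fun x : Vec d => (x - v) i) x₀ := by fun_prop
      refine hc.eventually (Ioo_mem_nhds ?_ ?_)
      · have := (liftT_mem (projT d x₀) i).1
        simp only [v]; simpa using this
      · have := h i
        simp only [v]; simpa using this
    filter_upwards [h1] with x hx
    have h2 : projT d x = projT d (x - v) := by rw [projT_sub, hv, sub_zero]
    rw [h2]
    refine liftT_projT_of_mem fun i => ⟨(hx i).1, ?_⟩
    have := (hx i).2
    norm_num at this ⊢
    linarith
  · right
    push Not at h
    obtain ⟨i, hi⟩ := h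
    have h1 := (liftT_mem (projT d x₀) i).2
    have h2 : liftT d (projT d x₀) i = 1/2 := by norm_num at h1 hi ⊢; linarith
    have h3 : (1/2 : ℝ) ≤ ‖projT d x₀‖ := by
      refine le_trans ?_ (norm_le_pi_norm (projT d x₀) i)
      have : projT d x₀ i = ((1/2 : ℝ) : AddCircle (1:ℝ)) := by
        conv_lhs => rw [← projT_liftT (projT d x₀)]
        rw [projT_apply, h2]
      rw [this, AddCircle.norm_half_period_eq]
      simp
    have hc : ContinuousAt (fun x => ‖projT d x‖) x₀ := (continuous_projT.norm).continuousAt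
    filter_upwards [hc.eventually (Ioi_mem_nhds (a := 1/4) (by linarith))] with x hx
    have := norm_projT_le (liftT d (projT d x))
    rw [projT_liftT] at this
    have hx' : (1/4 : ℝ) < ‖projT d x‖ := hx
    linarith

lemma KT_fderiv {d : ℕ} {κ : Vec d → ℝ} (h : IsKer κ) (hs : ∀ z, (1/4 : ℝ) < ‖z‖ → κ z = 0)
    (x : Vec d) : HasFDerivAt (fun x => KT κ (projT d x)) (fderiv ℝ κ (liftT d (projT d x))) x := by
  have hd := h.smooth.differentiable one_ne_zero
  rcases KT_cases x with ⟨v, hv, hx⟩ | hx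
  · have h1 : (fun x => KT κ (projT d x)) =ᶠ[𝓝 x] fun x => κ (x - v) := by
      filter_upwards [hx] with y hy
      simp only [KT, hy]
    have h2 : liftT d (projT d x) = x - v := by rw [hv]; simp
    rw [h2]
    refine HasFDerivAt.congr_of_eventuallyEq ?_ h1
    have := (hd (x - v)).hasFDerivAt.comp x ((hasFDerivAt_id x).sub_const v)
    exact this
  · have h1 : (fun x => KT κ (projT d x)) =ᶠ[𝓝 x] fun _ => 0 := by
      filter_upwards [hx] with y hy
      exact hs _ hy
    have h2 : fderiv ℝ κ (liftT d (projT d x)) = 0 := by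
      have h3 : κ =ᶠ[𝓝 (liftT d (projT d x))] fun _ => 0 := by
        filter_upwards [continuous_norm.continuousAt.eventually (Ioi_mem_nhds hx.self_of_nhds)] with z hz
        exact hs z hz
      rw [h3.fderiv_eq]; simp
    rw [h2]
    exact (hasFDerivAt_const (0:ℝ) x).congr_of_eventuallyEq h1

lemma DT_KT {d : ℕ} {κ : Vec d → ℝ} (h : IsKer κ) (hs : ∀ z, (1/4 : ℝ) < ‖z‖ → κ z = 0)
    (y : Torus d) : DT (KT κ) y = fderiv ℝ κ (liftT d y) := by
  unfold DT
  rw [(KT_fderiv h hs _).fderiv, projT_liftT]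

lemma contDiff_KT {d : ℕ} {κ : Vec d → ℝ} (h : IsKer κ) (hs : ∀ z, (1/4 : ℝ) < ‖z‖ → κ z = 0) :
    ContDiff ℝ 1 (fun x => KT κ (projT d x)) := by
  rw [contDiff_one_iff_fderiv]
  refine ⟨fun x => (KT_fderiv h hs x).differentiableAt, ?_⟩
  have hc : Continuous (fderiv ℝ κ) := h.smooth.continuous_fderiv one_ne_zero
  have e : fderiv ℝ (fun x => KT κ (projT d x)) = fun x => fderiv ℝ κ (liftT d (projT d x)) :=
    funext fun x => (KT_fderiv h hs x).fderiv
  rw [e, continuous_iff_continuousAt]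
  intro x
  rcases KT_cases x with ⟨v, hv, hx⟩ | hx
  · have h1 : (fun x => fderiv ℝ κ (liftT d (projT d x))) =ᶠ[𝓝 x] fun x => fderiv ℝ κ (x - v) := by
      filter_upwards [hx] with y hy
      simp only [hy]
    exact ContinuousAt.congr (hc.comp (by fun_prop : Continuous fun x : Vec d => x - v)).continuousAt h1.symm
  · have h1 : (fun x => fderiv ℝ κ (liftT d (projT d x))) =ᶠ[𝓝 x] fun x => 0 := by
      filter_upwards [hx] with y hy
      have h3 : κ =ᶠ[𝓝 (liftT d (projT d y))] fun _ => 0 := by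
        filter_upwards [continuous_norm.continuousAt.eventually (Ioi_mem_nhds hy)] with z hz
        exact hs z hz
      rw [h3.fderiv_eq]; simp
    exact ContinuousAt.congr continuousAt_const h1.symm

lemma cubeT_of_norm {d : ℕ} {z : Vec d} (h : ‖z‖ ≤ 1/4) : z ∈ cubeT d := by
  intro i
  have := (PiLp.norm_apply_le z i).trans h
  rw [Real.norm_eq_abs, abs_le] at this
  constructor <;> linarith

/-- Transfer of integrals from the torus to the Euclidean space. -/
lemma lint_liftT {d : ℕ} {g : Vec d → ℝ≥0∞} (hg : Measurable g)
    (hs : ∀ z, (1/4 : ℝ) < ‖z‖ → g z = 0) : ∫⁻ y, g (liftT d y) = ∫⁻ z, g z := by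
  rw [(mp_liftT d).lintegral_comp hg, ← lintegral_indicator₀]
  · congr 1; funext z
    by_cases hz : z ∈ cubeT d
    · simp [hz]
    · simp only [hz, not_false_eq_true, indicator_of_notMem]
      exact (hs z (not_le.1 fun h => hz (cubeT_of_norm h))).symm
  · have : cubeT d = ⋂ i, (fun x : Vec d => x i) ⁻¹' (Ioc (-1/2 : ℝ) (-1/2 + 1)) := by
      ext x; simp [cubeT]
    rw [this]
    exact (MeasurableSet.iInter fun i =>
      (by fun_prop : Measurable fun x : Vec d => x i) measurableSet_Ioc).nullMeasurableSet

lemma int_liftT {d : ℕ} {g : Vec d → ℝ} (hg : Measurable g)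
    (hs : ∀ z, (1/4 : ℝ) < ‖z‖ → g z = 0) : ∫ y, g (liftT d y) = ∫ z, g z := by
  have h := integral_map (μ := volume) (measurable_liftT (d := d)).aemeasurable (f := g)
    hg.aestronglyMeasurable
  rw [← h, (mp_liftT d).map_eq]
  refine setIntegral_eq_integral_of_forall_compl_eq_zero fun z hz => ?_
  exact hs z (not_le.1 fun h => hz (cubeT_of_norm h))

/-- Anisotropic commutator bound. -/
lemma commutator_bound {d : ℕ} {w : Torus d → Vec d} (hw : Measurable w) (hwi : Integrable w)
    {μ : Measure (Torus d)} [IsFiniteMeasure μ] {N : Torus d → (Vec d →L[ℝ] Vec d)}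
    (hNm : Measurable N) {c : ℝ} (hNb : ∀ y, ‖N y‖ ≤ c) (hN : IsWeakDer w μ N)
    {ψ : Torus d → ℝ} (hψ : SmoothT ψ) {C : ℝ} (hC0 : 0 ≤ C) (hC : ∀ y, ‖DT ψ y‖ ≤ C)
    {κ : Vec d → ℝ} (h : IsKer κ) {r : ℝ} (hr : r ≤ 1/4) (hs : ∀ z, r < ‖z‖ → κ z = 0) :
    ∫⁻ y, ∫⁻ x, ‖ψ x‖ₑ * ‖DT (KT κ) (x - y) (w x - w y)‖ₑ ≤
      ∫⁻ y, (‖ψ y‖ₑ + ENNReal.ofReal (C * r)) * gK κ (N y) ∂μ := by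
  have hs' : ∀ z, (1/4 : ℝ) < ‖z‖ → κ z = 0 := fun z hz => hs z (hr.trans_lt hz)
  have hψm : Measurable ψ := hψ.continuous.measurable
  have hcd : Continuous (fderiv ℝ κ) := h.smooth.continuous_fderiv one_ne_zero
  have hKm : Measurable (DT (KT κ)) := (continuous_DT (contDiff_KT h hs')).measurable
  have hzero : ∀ z, r < ‖z‖ → fderiv ℝ κ z = 0 := fun z hz => by
    have h3 : κ =ᶠ[𝓝 z] fun _ => 0 := by
      filter_upwards [continuous_norm.continuousAt.eventually (Ioi_mem_nhds hz)] with z hz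
      exact hs z hz
    rw [h3.fderiv_eq]; simp
  have happ : Measurable fun q : (Vec d →L[ℝ] ℝ) × Vec d => q.1 q.2 :=
    (by fun_prop : Continuous fun q : (Vec d →L[ℝ] ℝ) × Vec d => q.1 q.2).measurable
  have e1 : ∀ y, ∫⁻ x, ‖ψ x‖ₑ * ‖DT (KT κ) (x - y) (w x - w y)‖ₑ =
      ∫⁻ x, ‖ψ (x + y)‖ₑ * ‖DT (KT κ) x (w (x + y) - w y)‖ₑ := by
    intro y
    rw [← lintegral_add_right_eq_self _ y]
    simp only [add_sub_cancel_right]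
  simp_rw [e1]
  rw [lintegral_lintegral_swap]
  · have e2 : ∀ x, ∫⁻ y, ‖ψ (x + y)‖ₑ * ‖DT (KT κ) x (w (x + y) - w y)‖ₑ =
        ∫⁻ y, ‖ψ y‖ₑ * ‖DT (KT κ) x (w y - w (y - x))‖ₑ := by
      intro x
      rw [← lintegral_sub_right_eq_self _ x]
      simp only [add_sub_cancel]
    simp_rw [e2]
    calc ∫⁻ x, ∫⁻ y, ‖ψ y‖ₑ * ‖DT (KT κ) x (w y - w (y - x))‖ₑ
        ≤ ∫⁻ x, (fun z => ∫⁻ y, (‖ψ y‖ₑ + ENNReal.ofReal (C * r)) * ‖fderiv ℝ κ z (N y z)‖ₑ ∂μ) (liftT d x) := by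
          refine lintegral_mono fun x => ?_
          have h1 := diff_lintegral_le hw hwi hNm hNb hN (DT (KT κ) x) (liftT d x) hψ hC0 hC
          rw [projT_liftT] at h1
          refine h1.trans ?_
          refine lintegral_mono fun y => ?_
          simp only
          rw [DT_KT h hs']
          by_cases hz : r < ‖liftT d x‖
          · rw [hzero _ hz]; simp
          · gcongr
            exact not_lt.1 hz
      _ = ∫⁻ z, ∫⁻ y, (‖ψ y‖ₑ + ENNReal.ofReal (C * r)) * ‖fderiv ℝ κ z (N y z)‖ₑ ∂μ := by
          refine lint_liftT (g := fun z => ∫⁻ y, (‖ψ y‖ₑ + ENNReal.ofReal (C * r)) * ‖fderiv ℝ κ z (N y z)‖ₑ ∂μ) ?_ ?_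
          · refine Measurable.lintegral_prod_right' (f := fun q : Vec d × Torus d =>
              (‖ψ q.2‖ₑ + ENNReal.ofReal (C * r)) * ‖fderiv ℝ κ q.1 (N q.2 q.1)‖ₑ) ?_
            have hNz : Measurable fun q : Vec d × Torus d => N q.2 q.1 :=
              (by fun_prop : Continuous fun q : (Vec d →L[ℝ] Vec d) × Vec d => q.1 q.2).measurable.comp
                ((hNm.comp measurable_snd).prodMk measurable_fst)
            refine Measurable.fun_mul (by fun_prop) ?_
            exact (happ.comp ((hcd.measurable.comp measurable_fst).prodMk hNz)).enorm
          · intro z hz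
            rw [hzero z (hr.trans_lt hz)]; simp
      _ = ∫⁻ y, (∫⁻ z : Vec d, (‖ψ y‖ₑ + ENNReal.ofReal (C * r)) * ‖fderiv ℝ κ z (N y z)‖ₑ) ∂μ := by
          refine lintegral_lintegral_swap ?_
          have hNz : Measurable fun q : Vec d × Torus d => N q.2 q.1 :=
              (by fun_prop : Continuous fun q : (Vec d →L[ℝ] Vec d) × Vec d => q.1 q.2).measurable.comp
                ((hNm.comp measurable_snd).prodMk measurable_fst)
          refine AEMeasurable.fun_mul (by fun_prop) ?_
          exact (happ.comp ((hcd.measurable.comp measurable_fst).prodMk hNz)).enorm.aemeasurable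
      _ = _ := by
          refine lintegral_congr fun y => ?_
          rw [lintegral_const_mul']
          · rfl
          · simp
  · refine Measurable.aemeasurable ?_
    refine Measurable.fun_mul (by fun_prop) ?_
    exact (happ.comp ((hKm.comp measurable_snd).prodMk (by fun_prop))).enorm


/-! ### Convergence of mollified products -/

def cvT {d : ℕ} (v u : Torus d → ℝ) (z : Torus d) : ℝ := ∫ y, v (y + z) * u y

lemma int_mul_bdd {X : Type*} [MeasurableSpace X] {μ : Measure X} {f g : X → ℝ}
    (hf : Integrable f μ) (hg : AEStronglyMeasurable g μ) {C : ℝ} (hC : ∀ x, |g x| ≤ C) :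
    Integrable (fun x => f x * g x) μ :=
  hf.mul_bdd (c := C) hg (ae_of_all _ fun x => by simpa using hC x)

lemma int_translate {d : ℕ} {v : Torus d → ℝ} (hv : Integrable v) (z : Torus d) :
    Integrable (fun y => v (y + z)) := hv.comp_add_right z

lemma cvT_sub_le {d : ℕ} {v v' u : Torus d → ℝ} (hv : Integrable v) (hv' : Integrable v')
    (hu : Measurable u) (hu1 : ∀ y, |u y| ≤ 1) (z : Torus d) :
    |cvT v u z - cvT v' u z| ≤ ∫ y, |v y - v' y| := by
  unfold cvT
  rw [← integral_sub (int_mul_bdd (int_translate hv z) hu.aestronglyMeasurable hu1)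
    (int_mul_bdd (int_translate hv' z) hu.aestronglyMeasurable hu1)]
  refine (abs_integral_le_integral_abs).trans ?_
  rw [← integral_add_right_eq_self (fun y => |v y - v' y|) z]
  refine integral_mono_of_nonneg (ae_of_all _ fun _ => abs_nonneg _)
    ((int_translate hv z).sub (int_translate hv' z)).abs (ae_of_all _ fun y => ?_)
  simp only
  rw [← sub_mul, abs_mul]
  exact mul_le_of_le_one_right (abs_nonneg _) (hu1 y)

lemma abs_cvT_le {d : ℕ} {v u : Torus d → ℝ} (hv : Integrable v)
    (hu : Measurable u) (hu1 : ∀ y, |u y| ≤ 1) (z : Torus d) :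
    |cvT v u z| ≤ ∫ y, |v y| := by
  have := cvT_sub_le hv (integrable_zero (Torus d) ℝ volume) hu hu1 z
  simpa [cvT] using this

lemma continuous_cvT {d : ℕ} {v u : Torus d → ℝ} (hv : Integrable v)
    (hu : Measurable u) (hu1 : ∀ y, |u y| ≤ 1) : Continuous (cvT v u) := by
  refine continuous_of_uniform_approx_of_continuous fun U hU => ?_
  obtain ⟨ε, hε, hεU⟩ := Metric.mem_uniformity_dist.1 hU
  obtain ⟨g, hg, hgi⟩ := hv.exists_boundedContinuous_integral_sub_le (half_pos hε)
  refine ⟨cvT g u, ?_, fun z => hεU ?_⟩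
  · unfold cvT
    refine continuous_of_dominated (bound := fun _ => ‖g‖) ?_ ?_ (integrable_const _) ?_
    · intro z
      exact ((g.continuous.comp (by fun_prop : Continuous fun y => y + z)).measurable.mul
        hu).aestronglyMeasurable
    · intro z
      refine ae_of_all _ fun y => ?_
      rw [norm_mul]
      exact (mul_le_of_le_one_right (norm_nonneg _) (hu1 y)).trans (g.norm_coe_le_norm _)
    · refine ae_of_all _ fun y => ?_
      exact (g.continuous.comp (by fun_prop : Continuous fun z => y + z)).mul continuous_const
  · rw [Real.dist_eq]
    refine (cvT_sub_le hv hgi hu hu1 z).trans_lt ?_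
    refine lt_of_le_of_lt ?_ (half_lt_self hε)
    simpa using hg

lemma continuous_KT {d : ℕ} {κ : Vec d → ℝ} (h : IsKer κ) (hs : ∀ z, (1/4 : ℝ) < ‖z‖ → κ z = 0) :
    Continuous (KT κ) := continuous_of_lift (contDiff_KT h hs).continuous

lemma KT_bdd {d : ℕ} {κ : Vec d → ℝ} (h : IsKer κ) :
    ∃ C, ∀ y, |KT κ y| ≤ C := by
  obtain ⟨C, hC⟩ := h.supp.exists_bound_of_continuous h.smooth.continuous
  exact ⟨C, fun y => hC _⟩

lemma mp_shift (d : ℕ) : MeasurePreserving (fun q : Torus d × Torus d => (q.1 + q.2, q.1))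
    (volume.prod volume) (volume.prod volume) := by
  have h := measurePreserving_prod_add (volume : Measure (Torus d)) (volume : Measure (Torus d))
  have h2 := (Measure.measurePreserving_swap (μ := (volume : Measure (Torus d)))
    (ν := (volume : Measure (Torus d)))).comp h
  exact h2

lemma integrable_ker {d : ℕ} {v u : Torus d → ℝ} (hv : Integrable v)
    (hu : Measurable u) (hu1 : ∀ y, |u y| ≤ 1) {κ : Vec d → ℝ} (h : IsKer κ)
    (hs : ∀ z, (1/4 : ℝ) < ‖z‖ → κ z = 0) :
    Integrable (fun q : Torus d × Torus d => v q.1 * (u q.2 * KT κ (q.1 - q.2)))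
      (volume.prod volume) := by
  obtain ⟨C, hC⟩ := KT_bdd h
  refine int_mul_bdd (C := C) (hv.comp_fst _) ?_ ?_
  · refine Measurable.aestronglyMeasurable ?_
    exact (hu.comp measurable_snd).fun_mul ((continuous_KT h hs).measurable.comp
      (measurable_fst.sub measurable_snd))
  · intro q
    rw [abs_mul]
    exact (mul_le_of_le_one_left (abs_nonneg _) (hu1 _)).trans (hC _)

lemma conv_eq {d : ℕ} {v u : Torus d → ℝ} (hv : Integrable v)
    (hu : Measurable u) (hu1 : ∀ y, |u y| ≤ 1) {κ : Vec d → ℝ} (h : IsKer κ)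
    (hs : ∀ z, (1/4 : ℝ) < ‖z‖ → κ z = 0) :
    ∫ q : Torus d × Torus d, v q.1 * (u q.2 * KT κ (q.1 - q.2)) ∂(volume.prod volume)
      = ∫ z, κ z * cvT v u (projT d z) := by
  have hi := integrable_ker hv hu hu1 h hs
  have hi2 := (mp_shift d).integrable_comp_of_integrable hi
  have e1 : ∫ q : Torus d × Torus d, v q.1 * (u q.2 * KT κ (q.1 - q.2)) ∂(volume.prod volume)
      = ∫ q : Torus d × Torus d, v (q.1 + q.2) * (u q.1 * KT κ q.2) ∂(volume.prod volume) := by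
    conv_lhs => rw [← (mp_shift d).map_eq]
    rw [integral_map (mp_shift d).measurable.aemeasurable]
    · simp
    · rw [(mp_shift d).map_eq]; exact hi.aestronglyMeasurable
  have hi3 : Integrable (fun q : Torus d × Torus d => v (q.1 + q.2) * (u q.1 * KT κ q.2))
      (volume.prod volume) := by
    refine hi2.congr (ae_of_all _ fun q => ?_)
    simp
  rw [e1, integral_prod_symm _ hi3]
  have e2 : ∀ z : Torus d, ∫ y, v (y + z) * (u y * KT κ z) = KT κ z * cvT v u z := by
    intro z
    unfold cvT
    rw [← integral_const_mul]
    congr 1; funext y; ring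
  simp_rw [e2]
  have e3 : ∀ z : Torus d, KT κ z * cvT v u z =
      (fun ζ => κ ζ * cvT v u (projT d ζ)) (liftT d z) := by
    intro z; simp only [projT_liftT]; rfl
  simp_rw [e3]
  refine int_liftT (g := fun ζ => κ ζ * cvT v u (projT d ζ)) ?_ ?_
  · exact h.smooth.continuous.measurable.fun_mul
      ((continuous_cvT hv hu hu1).measurable.comp measurable_projT)
  · intro z hz; simp [hs z hz]

lemma scK_int {d : ℕ} {ρ : Vec d → ℝ} {c : ℝ} (hc : 0 < c) (g : Vec d → ℝ) :
    ∫ z, scK c ρ z * g z = ∫ z, ρ z * g (c⁻¹ • z) := by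
  have := Measure.integral_comp_smul (volume : Measure (Vec d)) (fun z => ρ z * g (c⁻¹ • z)) c
  simp only [inv_smul_smul₀ hc.ne', finrank_euclideanSpace_fin] at this
  unfold scK
  simp_rw [mul_assoc]
  rw [integral_const_mul, this, abs_of_pos (by positivity), smul_eq_mul, ← mul_assoc,
    mul_inv_cancel₀ (by positivity), one_mul]

lemma IsKer.integrable {d : ℕ} {ρ : Vec d → ℝ} (h : IsKer ρ) : Integrable ρ :=
  h.smooth.continuous.integrable_of_hasCompactSupport h.supp

lemma conv_le {d : ℕ} {v u : Torus d → ℝ} (hv : Integrable v)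
    (hu : Measurable u) (hu1 : ∀ y, |u y| ≤ 1) {ρ : Vec d → ℝ} (h : IsKer ρ) {c : ℝ} (hc : 0 < c)
    (hs : ∀ z, (1/4 : ℝ) < ‖z‖ → scK c ρ z = 0) :
    |∫ q : Torus d × Torus d, v q.1 * (u q.2 * KT (scK c ρ) (q.1 - q.2)) ∂(volume.prod volume)|
      ≤ (∫ y, |v y|) * ∫ z, |ρ z| := by
  rw [conv_eq hv hu hu1 (isKer_scK h hc) hs, scK_int hc, ← integral_const_mul]
  refine (abs_integral_le_integral_abs).trans ?_
  refine integral_mono_of_nonneg (ae_of_all _ fun _ => abs_nonneg _)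
    (h.integrable.abs.const_mul _) (ae_of_all _ fun y => ?_)
  simp only
  rw [abs_mul, mul_comm]
  exact mul_le_mul_of_nonneg_right (abs_cvT_le hv hu hu1 _) (abs_nonneg _)

lemma conv_tendsto {d : ℕ} {v u : Torus d → ℝ} (hv : Integrable v)
    (hu : Measurable u) (hu1 : ∀ y, |u y| ≤ 1) {ρ : Vec d → ℝ} (h : IsKer ρ)
    {c : ℕ → ℝ} (hc : ∀ n, 0 < c n) (hc' : Tendsto c atTop atTop)
    (hs : ∀ n, ∀ z, (1/4 : ℝ) < ‖z‖ → scK (c n) ρ z = 0) :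
    Tendsto (fun n => ∫ q : Torus d × Torus d, v q.1 * (u q.2 * KT (scK (c n) ρ) (q.1 - q.2))
      ∂(volume.prod volume)) atTop (𝓝 (∫ y, v y * u y)) := by
  have e : ∀ n, ∫ q : Torus d × Torus d, v q.1 * (u q.2 * KT (scK (c n) ρ) (q.1 - q.2))
      ∂(volume.prod volume) = ∫ z, ρ z * cvT v u (projT d ((c n)⁻¹ • z)) := fun n => by
    rw [conv_eq hv hu hu1 (isKer_scK h (hc n)) (hs n), scK_int (hc n)]
  simp_rw [e]
  have e2 : ∫ y, v y * u y = ∫ z, ρ z * cvT v u 0 := by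
    rw [integral_mul_const, h.int, one_mul]; simp [cvT]
  rw [e2]
  have hcc := continuous_cvT hv hu hu1
  refine tendsto_integral_of_dominated_convergence (fun z => |ρ z| * ∫ y, |v y|) ?_ ?_ ?_ ?_
  · intro n
    refine Measurable.aestronglyMeasurable ?_
    exact h.smooth.continuous.measurable.fun_mul
      (hcc.measurable.comp (measurable_projT.comp (by fun_prop)))
  · exact h.integrable.abs.mul_const _
  · intro n
    refine ae_of_all _ fun z => ?_
    rw [norm_mul]
    exact mul_le_mul_of_nonneg_left (abs_cvT_le hv hu hu1 _) (abs_nonneg _)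
  · refine ae_of_all _ fun z => ?_
    refine Tendsto.const_mul _ ?_
    have h1 : Tendsto (fun n => projT d ((c n)⁻¹ • z)) atTop (𝓝 (projT d ((0:ℝ) • z))) := by
      refine (continuous_projT.tendsto _).comp ?_
      exact (tendsto_inv_atTop_zero.comp hc').smul_const z
    rw [zero_smul, projT_zero] at h1
    exact (hcc.tendsto 0).comp h1


/-! ### Absolutely continuous functions and the chain rule -/

lemma ac_of_dom {E : Type*} [PseudoMetricSpace E] {f : ℝ → E} {Φ : ℝ → ℝ} {a b : ℝ}
    (hΦ : AbsolutelyContinuousOnInterval Φ a b)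
    (h : ∀ s ∈ uIcc a b, ∀ t ∈ uIcc a b, dist (f s) (f t) ≤ dist (Φ s) (Φ t)) :
    AbsolutelyContinuousOnInterval f a b := by
  rw [absolutelyContinuousOnInterval_iff] at hΦ ⊢
  intro ε hε
  obtain ⟨δ, hδ, hd⟩ := hΦ ε hε
  refine ⟨δ, hδ, fun E hE hs => lt_of_le_of_lt ?_ (hd E hE hs)⟩
  refine Finset.sum_le_sum fun i hi => ?_
  have := hE.1 i hi
  exact h _ this.1 _ this.2

lemma chain_rule {E : Type*} [NormedAddCommGroup E] [NormedSpace ℝ E] [CompleteSpace E]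
    [ProperSpace E] {F : E → ℝ} (hF : ContDiff ℝ 1 F) {ζ : ℝ → E} (hζ : Integrable ζ) (z₀ : E)
    (a b : ℝ) :
    F (z₀ + ∫ s in (0:ℝ)..b, ζ s) - F (z₀ + ∫ s in (0:ℝ)..a, ζ s)
      = ∫ t in a..b, fderiv ℝ F (z₀ + ∫ s in (0:ℝ)..t, ζ s) (ζ t) := by
  set Z : ℝ → E := fun t => z₀ + ∫ s in (0:ℝ)..t, ζ s with hZ
  have hii : ∀ s t, IntervalIntegrable ζ volume s t := fun s t => hζ.intervalIntegrable
  have hZs : ∀ s t, Z t - Z s = ∫ r in s..t, ζ r := by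
    intro s t
    simp only [hZ, add_sub_add_left_eq_sub]
    rw [intervalIntegral.integral_interval_sub_left (hii _ _) (hii _ _)]
  set M : ℝ := ‖z₀‖ + ∫ s, ‖ζ s‖ with hM
  have hZM : ∀ t, Z t ∈ Metric.closedBall (0:E) M := by
    intro t
    rw [mem_closedBall_zero_iff]
    refine (norm_add_le _ _).trans (add_le_add_right ?_ _)
    refine (intervalIntegral.norm_integral_le_integral_norm_uIoc).trans ?_
    exact setIntegral_le_integral hζ.norm (ae_of_all _ fun _ => norm_nonneg _)
  obtain ⟨C, hC⟩ := hF.contDiffOn.exists_lipschitzOnWith one_ne_zero (convex_closedBall (0:E) M)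
    (isCompact_closedBall (0:E) M)
  have hACn : AbsolutelyContinuousOnInterval (fun x => C * ∫ v in a..x, ‖ζ v‖) a b :=
    (IntervalIntegrable.absolutelyContinuousOnInterval_intervalIntegral
      (hζ.norm.intervalIntegrable) left_mem_uIcc).const_mul _
  have hAC : AbsolutelyContinuousOnInterval (fun t => F (Z t)) a b := by
    refine ac_of_dom hACn fun s _ t _ => ?_
    refine (hC.dist_le_mul _ (hZM s) _ (hZM t)).trans ?_
    have hn : ∀ s t, IntervalIntegrable (fun x => ‖ζ x‖) volume s t :=
      fun s t => hζ.norm.intervalIntegrable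
    rw [dist_comm, dist_eq_norm, hZs, dist_comm, Real.dist_eq, ← mul_sub, abs_mul,
      intervalIntegral.integral_interval_sub_left (hn _ _) (hn _ _), NNReal.abs_eq]
    refine mul_le_mul_of_nonneg_left ?_ C.2
    exact intervalIntegral.norm_integral_le_abs_integral_norm
  rw [← hAC.integral_deriv_eq_sub]
  refine intervalIntegral.integral_congr_ae ?_
  filter_upwards [LocallyIntegrable.ae_hasDerivAt_integral hζ.locallyIntegrable] with t ht _
  have h1 : HasDerivAt Z (ζ t) t := (ht 0).const_add z₀
  exact (((hF.differentiable one_ne_zero).differentiableAt.hasFDerivAt).comp_hasDerivAt t h1).deriv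

lemma fderiv_pair {d : ℕ} {ψ K : Torus d → ℝ} (hψ : ContDiff ℝ 1 (fun x => ψ (projT d x)))
    (hK : ContDiff ℝ 1 (fun x => K (projT d x))) :
    ContDiff ℝ 1 (fun p : Vec d × Vec d => ψ (projT d p.1) * K (projT d p.1 - projT d p.2)) ∧
    ∀ p q : Vec d × Vec d,
      fderiv ℝ (fun p : Vec d × Vec d => ψ (projT d p.1) * K (projT d p.1 - projT d p.2)) p q
        = DT ψ (projT d p.1) q.1 * K (projT d p.1 - projT d p.2)
          + ψ (projT d p.1) * DT K (projT d p.1 - projT d p.2) (q.1 - q.2) := by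
  have e : (fun p : Vec d × Vec d => ψ (projT d p.1) * K (projT d p.1 - projT d p.2)) =
      fun p : Vec d × Vec d => ψ (projT d p.1) * K (projT d (p.1 - p.2)) := by
    funext p; rw [projT_sub]
  rw [e]
  refine ⟨(hψ.comp contDiff_fst).mul (hK.comp (contDiff_fst.sub contDiff_snd)), fun p q => ?_⟩
  have h1 : HasFDerivAt (fun p : Vec d × Vec d => ψ (projT d p.1))
      ((DT ψ (projT d p.1)).comp (ContinuousLinearMap.fst ℝ (Vec d) (Vec d))) p := by
    rw [DT_projT]
    exact ((hψ.differentiable one_ne_zero).differentiableAt.hasFDerivAt).comp p hasFDerivAt_fst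
  have h2 : HasFDerivAt (fun p : Vec d × Vec d => K (projT d (p.1 - p.2)))
      ((DT K (projT d (p.1 - p.2))).comp (ContinuousLinearMap.fst ℝ (Vec d) (Vec d) -
        ContinuousLinearMap.snd ℝ (Vec d) (Vec d))) p := by
    rw [DT_projT]
    exact ((hK.differentiable one_ne_zero).differentiableAt.hasFDerivAt).comp p
      (hasFDerivAt_fst.sub hasFDerivAt_snd)
  rw [(h1.fun_mul h2).fderiv]
  simp [projT_sub]
  ring

/-- Chain rule along a pair of absolutely continuous curves on the torus. -/
lemma chain_torus {d : ℕ} {ψ K : Torus d → ℝ} (hψ : ContDiff ℝ 1 (fun x => ψ (projT d x)))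
    (hK : ContDiff ℝ 1 (fun x => K (projT d x))) {β β' : ℝ → Vec d} (hβ : Integrable β)
    (hβ' : Integrable β') {x x' : ℝ → Torus d} {x₀ x₀' : Torus d} {a b : ℝ}
    (hx : ∀ t ∈ uIcc a b, x t = x₀ + projT d (∫ s in (0:ℝ)..t, β s))
    (hx' : ∀ t ∈ uIcc a b, x' t = x₀' + projT d (∫ s in (0:ℝ)..t, β' s)) :
    ψ (x b) * K (x b - x' b) - ψ (x a) * K (x a - x' a)
      = ∫ t in a..b, (DT ψ (x t) (β t) * K (x t - x' t)
          + ψ (x t) * DT K (x t - x' t) (β t - β' t)) := by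
  obtain ⟨h1, h2⟩ := fderiv_pair hψ hK
  have := chain_rule h1 (hβ.prodMk hβ') (liftT d x₀, liftT d x₀') a b
  have e : ∀ t ∈ uIcc a b, (x t = projT d ((liftT d x₀, liftT d x₀') + ∫ s in (0:ℝ)..t, (β s, β' s)).1) ∧
      (x' t = projT d ((liftT d x₀, liftT d x₀') + ∫ s in (0:ℝ)..t, (β s, β' s)).2) := by
    intro t ht
    have e1 : ∫ s in (0:ℝ)..t, (β s, β' s) = (∫ s in (0:ℝ)..t, β s, ∫ s in (0:ℝ)..t, β' s) := by
      refine Prod.ext ?_ ?_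
      · exact ((ContinuousLinearMap.fst ℝ (Vec d) (Vec d)).intervalIntegral_comp_comm
          (hβ.prodMk hβ').intervalIntegrable).symm
      · exact ((ContinuousLinearMap.snd ℝ (Vec d) (Vec d)).intervalIntegral_comp_comm
          (hβ.prodMk hβ').intervalIntegrable).symm
    rw [e1, hx t ht, hx' t ht]
    simp [projT_add, projT_liftT]
  rw [(e b right_mem_uIcc).1, (e b right_mem_uIcc).2, (e a left_mem_uIcc).1, (e a left_mem_uIcc).2,
    this]
  refine intervalIntegral.integral_congr fun t ht => ?_
  rw [h2, ← (e t ht).1, ← (e t ht).2]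

/-- A function dominated by an integrable modulus whose derivative vanishes a.e. is constant. -/
lemma const_of_dom {H G : ℝ → ℝ} {a b : ℝ} (hab : a ≤ b) (hG : IntervalIntegrable G volume a b)
    (hd : ∀ s t, a ≤ s → s ≤ t → t ≤ b → |H t - H s| ≤ ∫ r in s..t, G r)
    (h0 : ∀ᵐ r, r ∈ Ioo a b → HasDerivAt H 0 r) : H a = H b := by
  have hsub : ∀ s t, s ∈ uIcc a b → t ∈ uIcc a b → IntervalIntegrable G volume s t :=
    fun s t hs ht => hG.mono_set (uIcc_subset_uIcc hs ht)
  have key : ∀ s ∈ uIcc a b, ∀ t ∈ uIcc a b, s ≤ t →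
      |H t - H s| ≤ |(∫ v in a..t, G v) - ∫ v in a..s, G v| := by
    intro s hs t ht hst
    have hs' := hs; have ht' := ht
    rw [uIcc_of_le hab] at hs' ht'
    rw [intervalIntegral.integral_interval_sub_left (hsub _ _ left_mem_uIcc ht)
      (hsub _ _ left_mem_uIcc hs)]
    exact (hd s t hs'.1 hst ht'.2).trans (le_abs_self _)
  have hAC : AbsolutelyContinuousOnInterval H a b := by
    refine ac_of_dom (hG.absolutelyContinuousOnInterval_intervalIntegral left_mem_uIcc)
      fun s hs t ht => ?_
    rcases le_total s t with hst | hst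
    · rw [dist_comm, Real.dist_eq, dist_comm, Real.dist_eq]; exact key s hs t ht hst
    · rw [Real.dist_eq, Real.dist_eq]; exact key t ht s hs hst
  obtain ⟨C, hC⟩ := hAC.const_of_ae_hasDerivAt_zero (by
    have h1 : ∀ᵐ x : ℝ, x ≠ a := by simp [ae_iff, measure_singleton]
    have h2 : ∀ᵐ x : ℝ, x ≠ b := by simp [ae_iff, measure_singleton]
    filter_upwards [h0, h1, h2] with r hr h1 h2 hrm
    rw [uIcc_of_le hab] at hrm
    exact hr ⟨lt_of_le_of_ne hrm.1 (Ne.symm h1), lt_of_le_of_ne hrm.2 h2⟩)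
  rw [hC a left_mem_uIcc, hC b right_mem_uIcc]


/-! ### Doubling of variables on path space -/

lemma continuous_extend {T : ℝ} {d : ℕ} (hT : 0 ≤ T) :
    Continuous (fun p : ℝ × PathSpace T d => extendPath hT p.2 p.1) := by
  unfold extendPath
  exact continuous_eval.comp (continuous_snd.prodMk ((continuous_projIcc (h := hT)).comp continuous_fst))

lemma measurable_extend {T : ℝ} {d : ℕ} (hT : 0 ≤ T) :
    Measurable (fun p : ℝ × PathSpace T d => extendPath hT p.2 p.1) :=
  (continuous_extend hT).measurable

lemma measurable_extend' {T : ℝ} {d : ℕ} (hT : 0 ≤ T) (r : ℝ) :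
    Measurable (fun γ : PathSpace T d => extendPath hT γ r) :=
  (measurable_extend hT).comp (measurable_const.prodMk measurable_id)

lemma curve_eq {T : ℝ} {d : ℕ} (hT : 0 ≤ T) {b : ℝ → Torus d → Vec d} {γ : PathSpace T d}
    (h : IsIntegralCurveOf hT b γ) :
    Integrable ((Ioc 0 T).indicator fun s => b s (extendPath hT γ s)) ∧
    ∀ t ∈ Icc 0 T, extendPath hT γ t = extendPath hT γ 0 +
      projT d (∫ s in (0:ℝ)..t, (Ioc 0 T).indicator (fun s => b s (extendPath hT γ s)) s) := by
  refine ⟨(integrable_indicator_iff measurableSet_Ioc).2 h.1, fun t ht => ?_⟩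
  have := h.2 ⟨t, ht⟩
  have e1 : extendPath hT γ t = γ ⟨t, ht⟩ := by
    unfold extendPath; rw [projIcc_of_mem hT ht]
  have e2 : extendPath hT γ 0 = γ ⟨0, left_mem_Icc.2 hT⟩ := by
    unfold extendPath; rw [projIcc_of_mem hT (left_mem_Icc.2 hT)]
  rw [e1, this, e2]
  congr 2
  rw [intervalIntegral.integral_of_le ht.1]
  refine setIntegral_congr_fun measurableSet_Ioc fun s hs => ?_
  have hs' : s ∈ Ioc 0 T := ⟨hs.1, hs.2.trans ht.2⟩
  rw [indicator_of_mem hs']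

section doubling

variable {T : ℝ} {d : ℕ} (hT : 0 ≤ T) {b : ℝ → Torus d → Vec d}
  {lam : Measure (PathSpace T d)} [IsFiniteMeasure lam]

lemma map_pair (r : ℝ) :
    Measure.map (fun q : PathSpace T d × PathSpace T d => (extendPath hT q.1 r, extendPath hT q.2 r))
      (lam.prod lam) = (lam.map fun γ => extendPath hT γ r).prod (lam.map fun γ => extendPath hT γ r) :=
  (Measure.map_prod_map lam lam (measurable_extend' hT r) (measurable_extend' hT r)).symm

lemma push_lint_le {r : ℝ} (hm : lam.map (fun γ => extendPath hT γ r) ≤ volume)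
    {g : Torus d × Torus d → ℝ≥0∞} (hg : Measurable g) :
    ∫⁻ q, g (extendPath hT q.1 r, extendPath hT q.2 r) ∂(lam.prod lam)
      ≤ ∫⁻ q, g q ∂(volume.prod volume) := by
  have hmm : Measurable (fun q : PathSpace T d × PathSpace T d =>
      (extendPath hT q.1 r, extendPath hT q.2 r)) :=
    ((measurable_extend' hT r).comp measurable_fst).prodMk
      ((measurable_extend' hT r).comp measurable_snd)
  rw [← lintegral_map (f := g) hg hmm, map_pair]
  exact lintegral_mono' (Measure.prod_mono hm hm) le_rfl

lemma push_int {r : ℝ} {u : Torus d → ℝ} (hu : Measurable u) (hu0 : ∀ x, 0 ≤ u x)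
    (hm : lam.map (fun γ => extendPath hT γ r) = volume.withDensity fun x => ENNReal.ofReal (u x))
    {g : Torus d × Torus d → ℝ} (hg : Measurable g) :
    ∫ q, g (extendPath hT q.1 r, extendPath hT q.2 r) ∂(lam.prod lam)
      = ∫ q, (u q.1 * u q.2) * g q ∂(volume.prod volume) := by
  have hmm : Measurable (fun q : PathSpace T d × PathSpace T d =>
      (extendPath hT q.1 r, extendPath hT q.2 r)) :=
    ((measurable_extend' hT r).comp measurable_fst).prodMk
      ((measurable_extend' hT r).comp measurable_snd)
  rw [← integral_map (f := g) hmm.aemeasurable hg.aestronglyMeasurable, map_pair, hm,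
    prod_withDensity hu.ennreal_ofReal hu.ennreal_ofReal]
  simp_rw [← ENNReal.ofReal_mul (hu0 _)]
  exact integral_density _ (by fun_prop) (fun q => mul_nonneg (hu0 _) (hu0 _)) g

/-- the transport part of the doubled integrand -/
def fI (b : ℝ → Torus d → Vec d) (ψ K : Torus d → ℝ) (r : ℝ) (q : Torus d × Torus d) : ℝ :=
  DT ψ q.1 (b r q.1) * K (q.1 - q.2)

/-- the commutator part of the doubled integrand -/
def fJ (b : ℝ → Torus d → Vec d) (ψ K : Torus d → ℝ) (r : ℝ) (q : Torus d × Torus d) : ℝ :=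
  ψ q.1 * DT K (q.1 - q.2) (b r q.1 - b r q.2)

lemma clm_meas {X : Type*} [MeasurableSpace X] {f : X → (Vec d →L[ℝ] ℝ)} (hf : Measurable f)
    {g : X → Vec d} (hg : Measurable g) : Measurable fun x => f x (g x) :=
  (isBoundedBilinearMap_apply.continuous.measurable).comp (hf.prodMk hg)

lemma measurable_fI (hb : Measurable (Function.uncurry b)) {ψ K : Torus d → ℝ}
    (hψ : ContDiff ℝ 1 (fun x => ψ (projT d x)))
    (hK : ContDiff ℝ 1 (fun x => K (projT d x))) :
    Measurable (fun p : ℝ × (Torus d × Torus d) => fI b ψ K p.1 p.2) := by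
  unfold fI
  refine Measurable.fun_mul (clm_meas ((continuous_DT hψ).measurable.comp (by fun_prop)) ?_) ?_
  · exact hb.comp (by fun_prop : Measurable fun p : ℝ × (Torus d × Torus d) => (p.1, p.2.1))
  · exact (continuous_of_lift hK.continuous).measurable.comp
      ((measurable_fst.comp measurable_snd).sub (measurable_snd.comp measurable_snd))

lemma measurable_fJ (hb : Measurable (Function.uncurry b)) {ψ K : Torus d → ℝ}
    (hψ : ContDiff ℝ 1 (fun x => ψ (projT d x)))
    (hK : ContDiff ℝ 1 (fun x => K (projT d x))) :
    Measurable (fun p : ℝ × (Torus d × Torus d) => fJ b ψ K p.1 p.2) := by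
  unfold fJ
  refine Measurable.fun_mul ((continuous_of_lift hψ.continuous).measurable.comp (by fun_prop))
    (clm_meas ((continuous_DT hK).measurable.comp
      ((measurable_fst.comp measurable_snd).sub (measurable_snd.comp measurable_snd))) ?_)
  refine Measurable.sub ?_ ?_
  · exact hb.comp (by fun_prop : Measurable fun p : ℝ × (Torus d × Torus d) => (p.1, p.2.1))
  · exact hb.comp (by fun_prop : Measurable fun p : ℝ × (Torus d × Torus d) => (p.1, p.2.2))

lemma cont_bdd {f : Torus d → ℝ} (hf : Continuous f) : ∃ C, 0 ≤ C ∧ ∀ y, |f y| ≤ C := by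
  obtain ⟨C, hC⟩ := isCompact_univ.exists_bound_of_continuousOn hf.continuousOn
  exact ⟨C, (norm_nonneg _).trans (hC 0 (mem_univ _)), fun y => hC y (mem_univ _)⟩

lemma fI_bound (b : ℝ → Torus d → Vec d) {ψ K : Torus d → ℝ} (hψ : ContDiff ℝ 1 (fun x => ψ (projT d x)))
    (hK : ContDiff ℝ 1 (fun x => K (projT d x))) :
    ∃ C : ℝ, ∀ r q, ‖fI b ψ K r q‖ₑ ≤ ENNReal.ofReal C * (‖b r q.1‖ₑ + ‖b r q.2‖ₑ) := by
  obtain ⟨C1, h10, h1⟩ := DT_bound hψ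
  obtain ⟨C2, h20, h2⟩ := cont_bdd (continuous_of_lift hK.continuous)
  refine ⟨C1 * C2, fun r q => ?_⟩
  have : ‖fI b ψ K r q‖ ≤ C1 * C2 * (‖b r q.1‖ + ‖b r q.2‖) := by
    unfold fI
    rw [norm_mul]
    calc _ ≤ (C1 * ‖b r q.1‖) * C2 := by
            refine mul_le_mul ?_ (h2 _) (norm_nonneg _) (by positivity)
            exact ((DT ψ q.1).le_opNorm _).trans (mul_le_mul_of_nonneg_right (h1 _) (norm_nonneg _))
      _ ≤ _ := by
        have := mul_nonneg (mul_nonneg h10 h20) (norm_nonneg (b r q.2)); nlinarith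
  rw [← ofReal_norm, ← ofReal_norm (b r q.1), ← ofReal_norm (b r q.2),
    ← ENNReal.ofReal_add (norm_nonneg _) (norm_nonneg _), ← ENNReal.ofReal_mul (by positivity)]
  exact ENNReal.ofReal_le_ofReal this

lemma fJ_bound (b : ℝ → Torus d → Vec d) {ψ K : Torus d → ℝ} (hψ : ContDiff ℝ 1 (fun x => ψ (projT d x)))
    (hK : ContDiff ℝ 1 (fun x => K (projT d x))) :
    ∃ C : ℝ, ∀ r q, ‖fJ b ψ K r q‖ₑ ≤ ENNReal.ofReal C * (‖b r q.1‖ₑ + ‖b r q.2‖ₑ) := by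
  obtain ⟨C1, h10, h1⟩ := DT_bound hK
  obtain ⟨C2, h20, h2⟩ := cont_bdd (continuous_of_lift hψ.continuous)
  refine ⟨C2 * C1, fun r q => ?_⟩
  have : ‖fJ b ψ K r q‖ ≤ C2 * C1 * (‖b r q.1‖ + ‖b r q.2‖) := by
    unfold fJ
    rw [norm_mul, mul_assoc]
    refine mul_le_mul (h2 _) ?_ (norm_nonneg _) h20
    exact ((DT K _).le_opNorm _).trans (mul_le_mul (h1 _) (norm_sub_le _ _) (norm_nonneg _) h10)
  rw [← ofReal_norm, ← ofReal_norm (b r q.1), ← ofReal_norm (b r q.2),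
    ← ENNReal.ofReal_add (norm_nonneg _) (norm_nonneg _), ← ENNReal.ofReal_mul (by positivity)]
  exact ENNReal.ofReal_le_ofReal this

lemma integrable_pair (hb : Measurable (Function.uncurry b))
    (hm : ∀ r, lam.map (fun γ => extendPath hT γ r) ≤ volume)
    (hbI : ∫⁻ t in Ioc 0 T, ∫⁻ x, ‖b t x‖ₑ < ∞)
    {f : ℝ → Torus d × Torus d → ℝ} (hf : Measurable (fun p : ℝ × (Torus d × Torus d) => f p.1 p.2))
    {C : ℝ} (hC : ∀ r q, ‖f r q‖ₑ ≤ ENNReal.ofReal C * (‖b r q.1‖ₑ + ‖b r q.2‖ₑ)) :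
    Integrable (fun p : ℝ × (PathSpace T d × PathSpace T d) =>
      f p.1 (extendPath hT p.2.1 p.1, extendPath hT p.2.2 p.1))
      ((volume.restrict (Ioc 0 T)).prod (lam.prod lam)) := by
  have hmeas : Measurable (fun p : ℝ × (PathSpace T d × PathSpace T d) =>
      f p.1 (extendPath hT p.2.1 p.1, extendPath hT p.2.2 p.1)) := by
    have h1 : Measurable (fun p : ℝ × (PathSpace T d × PathSpace T d) => extendPath hT p.2.1 p.1) :=
      (measurable_extend hT).comp (measurable_fst.prodMk (measurable_fst.comp measurable_snd))
    have h2 : Measurable (fun p : ℝ × (PathSpace T d × PathSpace T d) => extendPath hT p.2.2 p.1) :=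
      (measurable_extend hT).comp (measurable_fst.prodMk (measurable_snd.comp measurable_snd))
    exact hf.comp (measurable_fst.prodMk (h1.prodMk h2))
  refine ⟨hmeas.aestronglyMeasurable, ?_⟩
  rw [hasFiniteIntegral_iff_enorm, lintegral_prod _ hmeas.enorm.aemeasurable]
  have hbr : ∀ r, Measurable (b r) := fun r => hb.comp (measurable_const.prodMk measurable_id)
  have key : ∀ r, ∫⁻ q : PathSpace T d × PathSpace T d,
      ‖f r (extendPath hT q.1 r, extendPath hT q.2 r)‖ₑ ∂(lam.prod lam)
      ≤ ENNReal.ofReal C * (2 * ∫⁻ x, ‖b r x‖ₑ) := by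
    intro r
    have hfr : Measurable (f r) := hf.comp (measurable_const.prodMk measurable_id)
    refine (push_lint_le hT (hm r) hfr.enorm).trans ?_
    refine (lintegral_mono (hC r)).trans ?_
    rw [lintegral_const_mul' _ _ ENNReal.ofReal_ne_top]
    refine mul_le_mul_right (le_of_eq ?_) _
    rw [lintegral_add_left (by exact ((hbr r).comp measurable_fst).enorm),
      lintegral_prod (fun q : Torus d × Torus d => ‖b r q.1‖ₑ)
        ((hbr r).comp measurable_fst).enorm.aemeasurable,
      lintegral_prod (fun q : Torus d × Torus d => ‖b r q.2‖ₑ)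
        ((hbr r).comp measurable_snd).enorm.aemeasurable]
    simp [two_mul]
  refine (lintegral_mono key).trans_lt ?_
  rw [lintegral_const_mul' _ _ ENNReal.ofReal_ne_top, lintegral_const_mul' _ _ (by simp)]
  exact ENNReal.mul_lt_top ENNReal.ofReal_lt_top (ENNReal.mul_lt_top (by simp) hbI)

/-- The doubling identity. -/
lemma doubling_id (hb : Measurable (Function.uncurry b))
    (hc : ∀ᵐ γ ∂lam, IsIntegralCurveOf hT b γ)
    (hm : ∀ r, lam.map (fun γ => extendPath hT γ r) ≤ volume)
    (hbI : ∫⁻ t in Ioc 0 T, ∫⁻ x, ‖b t x‖ₑ < ∞)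
    {ψ K : Torus d → ℝ} (hψ : ContDiff ℝ 1 (fun x => ψ (projT d x)))
    (hK : ContDiff ℝ 1 (fun x => K (projT d x))) {r₁ r₂ : ℝ} (h0 : 0 ≤ r₁) (h12 : r₁ ≤ r₂)
    (h2 : r₂ ≤ T) :
    (∫ q : PathSpace T d × PathSpace T d,
      ψ (extendPath hT q.1 r₂) * K (extendPath hT q.1 r₂ - extendPath hT q.2 r₂) ∂(lam.prod lam))
    - (∫ q : PathSpace T d × PathSpace T d,
      ψ (extendPath hT q.1 r₁) * K (extendPath hT q.1 r₁ - extendPath hT q.2 r₁) ∂(lam.prod lam))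
    = (∫ r in Ioc r₁ r₂, ∫ q : PathSpace T d × PathSpace T d,
        fI b ψ K r (extendPath hT q.1 r, extendPath hT q.2 r) ∂(lam.prod lam))
    + ∫ r in Ioc r₁ r₂, ∫ q : PathSpace T d × PathSpace T d,
        fJ b ψ K r (extendPath hT q.1 r, extendPath hT q.2 r) ∂(lam.prod lam) := by
  obtain ⟨C, hC⟩ := fI_bound b hψ hK
  obtain ⟨C', hC'⟩ := fJ_bound b hψ hK
  have hsub : Ioc r₁ r₂ ⊆ Ioc 0 T := Ioc_subset_Ioc h0 h2
  have hmono : (volume.restrict (Ioc r₁ r₂)).prod (lam.prod lam) ≤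
      (volume.restrict (Ioc 0 T)).prod (lam.prod lam) :=
    Measure.prod_mono (Measure.restrict_mono hsub le_rfl) le_rfl
  have iI := (integrable_pair hT hb hm hbI (measurable_fI hb hψ hK) hC).mono_measure hmono
  have iJ := (integrable_pair hT hb hm hbI (measurable_fJ hb hψ hK) hC').mono_measure hmono
  have hψc := continuous_of_lift hψ.continuous
  have hKc := continuous_of_lift hK.continuous
  have hE : ∀ r, Integrable (fun q : PathSpace T d × PathSpace T d =>
      ψ (extendPath hT q.1 r) * K (extendPath hT q.1 r - extendPath hT q.2 r)) (lam.prod lam) := by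
    intro r
    obtain ⟨A, _, hA⟩ := cont_bdd hψc
    obtain ⟨B, hB0, hB⟩ := cont_bdd hKc
    have h1 : Measurable (fun q : PathSpace T d × PathSpace T d => extendPath hT q.1 r) :=
      (measurable_extend' hT r).comp measurable_fst
    have h2 : Measurable (fun q : PathSpace T d × PathSpace T d => extendPath hT q.2 r) :=
      (measurable_extend' hT r).comp measurable_snd
    refine Integrable.of_bound ((hψc.measurable.comp h1).mul
      (hKc.measurable.comp (h1.sub h2))).aestronglyMeasurable (A * B) (ae_of_all _ fun q => ?_)
    rw [norm_mul]
    exact mul_le_mul (hA _) (hB _) (norm_nonneg _) ((abs_nonneg _).trans (hA 0))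
  rw [← integral_sub (hE _) (hE _), 
    integral_integral_swap (f := fun r (q : PathSpace T d × PathSpace T d) =>
      fI b ψ K r (extendPath hT q.1 r, extendPath hT q.2 r)) iI,
    integral_integral_swap (f := fun r (q : PathSpace T d × PathSpace T d) =>
      fJ b ψ K r (extendPath hT q.1 r, extendPath hT q.2 r)) iJ,
    ← integral_add iI.integral_prod_right iJ.integral_prod_right]
  refine integral_congr_ae ?_
  have a1 : ∀ᵐ q : PathSpace T d × PathSpace T d ∂(lam.prod lam), IsIntegralCurveOf hT b q.1 :=
    Measure.quasiMeasurePreserving_fst.ae hc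
  have a2 : ∀ᵐ q : PathSpace T d × PathSpace T d ∂(lam.prod lam), IsIntegralCurveOf hT b q.2 :=
    Measure.quasiMeasurePreserving_snd.ae hc
  filter_upwards [a1, a2, iI.prod_left_ae, iJ.prod_left_ae] with q hq1 hq2 hI hJ
  obtain ⟨c1, c2⟩ := curve_eq hT hq1
  obtain ⟨c1', c2'⟩ := curve_eq hT hq2
  have hu : uIcc r₁ r₂ ⊆ Icc 0 T := by rw [uIcc_of_le h12]; exact Icc_subset_Icc h0 h2
  rw [chain_torus hψ hK c1 c1' (fun t ht => c2 t (hu ht)) (fun t ht => c2' t (hu ht)),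
    ← integral_add hI hJ, intervalIntegral.integral_of_le h12]
  refine setIntegral_congr_fun measurableSet_Ioc fun t ht => ?_
  simp only [indicator_of_mem (hsub ht), fI, fJ]

end doubling


/-! ### Passing to the limit in the doubling identity -/

/-- `b` has the weak derivative structure with total mass `V`. -/
def BVData {d : ℕ} (w : Torus d → Vec d) (μ : Measure (Torus d))
    (N : Torus d → (Vec d →L[ℝ] Vec d)) : Prop :=
  IsFiniteMeasure μ ∧ Measurable N ∧ (∀ y, ‖N y‖ ≤ d * d) ∧
    (∀ y, LinearMap.trace ℝ (Vec d) (N y).toLinearMap = 0) ∧ IsWeakDer w μ N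

lemma Lbound {d : ℕ} {b : ℝ → Torus d → Vec d} (hb : Measurable (Function.uncurry b)) {r : ℝ}
    {μ : Measure (Torus d)} {N : Torus d → (Vec d →L[ℝ] Vec d)} (hB : BVData (b r) μ N)
    (hbr : Integrable (b r)) {ψ : Torus d → ℝ} (hψ : SmoothT ψ) {C : ℝ} (hC0 : 0 ≤ C)
    (hC : ∀ y, ‖DT ψ y‖ ≤ C) {ρ : Vec d → ℝ} (h : IsKer ρ) {c s : ℝ} (hc : 0 < c)
    (hr : s ≤ 1/4) (hs : ∀ z, s < ‖z‖ → scK c ρ z = 0) :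
    ∫⁻ q, ‖fJ b ψ (KT (scK c ρ)) r q‖ₑ ∂(volume.prod volume) ≤
      ∫⁻ y, (‖ψ y‖ₑ + ENNReal.ofReal (C * s)) * gK ρ (N y) ∂μ := by
  obtain ⟨hf, hNm, hNb, _, hN⟩ := hB
  have hbm : Measurable (b r) := hb.comp (measurable_const.prodMk measurable_id)
  have key := commutator_bound hbm hbr hNm hNb hN hψ hC0 hC (isKer_scK h hc) hr hs
  simp_rw [gK_scK h hc] at key
  refine le_trans (le_of_eq ?_) key
  have hs' : ∀ z, (1/4 : ℝ) < ‖z‖ → scK c ρ z = 0 := fun z hz => hs z (hr.trans_lt hz)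
  have hm : Measurable (fJ b ψ (KT (scK c ρ)) r) :=
    (measurable_fJ hb hψ.contDiff_one (contDiff_KT (isKer_scK h hc) hs')).comp
      (measurable_const.prodMk measurable_id)
  rw [lintegral_prod_symm _ hm.enorm.aemeasurable]
  refine lintegral_congr fun y => lintegral_congr fun x => ?_
  rw [fJ, enorm_mul]

lemma withDensity_le_vol {d : ℕ} {u : Torus d → ℝ} (hu1 : ∀ x, u x ≤ 1) :
    (volume : Measure (Torus d)).withDensity (fun x => ENNReal.ofReal (u x)) ≤ volume := by
  conv_rhs => rw [← withDensity_one (μ := (volume : Measure (Torus d)))]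
  refine withDensity_mono (ae_of_all _ fun x => ?_)
  simpa using hu1 x

lemma doubling_lim {T : ℝ} {d : ℕ} (hT : 0 ≤ T) {b : ℝ → Torus d → Vec d}
    {lam : Measure (PathSpace T d)} [IsFiniteMeasure lam]
    (hb : Measurable (Function.uncurry b))
    (hc : ∀ᵐ γ ∂lam, IsIntegralCurveOf hT b γ)
    {u : ℝ → Torus d → ℝ} (hu : ∀ r, Measurable (u r)) (hu0 : ∀ r x, 0 ≤ u r x)
    (hu1 : ∀ r x, u r x ≤ 1)
    (hmu : ∀ r, lam.map (fun γ => extendPath hT γ r) =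
      volume.withDensity fun x => ENNReal.ofReal (u r x))
    (hbI : ∫⁻ t in Ioc 0 T, ∫⁻ x, ‖b t x‖ₑ < ∞)
    {V : ℝ → ℝ≥0∞}
    (hV : ∀ᵐ r ∂(volume.restrict (Ioc 0 T)), Integrable (b r) ∧ ∃ μ N, μ univ = V r ∧ BVData (b r) μ N)
    {ψ : Torus d → ℝ} (hψ : SmoothT ψ) {ρ : Vec d → ℝ} (h : IsKer ρ) :
    ∃ Λ : ℝ → ℝ≥0∞, Measurable Λ ∧
      (∀ r μ N, BVData (b r) μ N → Integrable (b r) → Λ r ≤ ∫⁻ y, ‖ψ y‖ₑ * gK ρ (N y) ∂μ) ∧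
      ∀ r₁ r₂, 0 ≤ r₁ → r₁ ≤ r₂ → r₂ ≤ T → ∫⁻ r in Ioc r₁ r₂, V r < ∞ →
        IntegrableOn (fun r => ∫ x, (DT ψ x (b r x) * u r x) * u r x) (Ioc r₁ r₂) ∧
        ‖(∫ x, (ψ x * u r₂ x) * u r₂ x) - (∫ x, (ψ x * u r₁ x) * u r₁ x)
          - ∫ r in Ioc r₁ r₂, ∫ x, (DT ψ x (b r x) * u r x) * u r x‖ₑ ≤ ∫⁻ r in Ioc r₁ r₂, Λ r := by
  obtain ⟨R, hR0, hR⟩ := scK_bound h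
  obtain ⟨C, hC0, hC⟩ := DT_bound hψ.contDiff_one
  set c : ℕ → ℝ := fun n => n + 1 + 4 * R with hcdef
  have hc0 : ∀ n, 0 < c n := fun n => by positivity
  have hcinf : Tendsto c atTop atTop := by
    refine tendsto_atTop_add_const_right _ _ (tendsto_atTop_add_const_right _ _
      tendsto_natCast_atTop_atTop)
  have hRc : ∀ n, R / c n ≤ 1/4 := by
    intro n
    rw [div_le_div_iff₀ (hc0 n) (by norm_num)]
    have : (0:ℝ) ≤ n := by positivity
    simp only [hcdef]; linarith
  have hsn : ∀ n z, (1/4 : ℝ) < ‖z‖ → scK (c n) ρ z = 0 :=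
    fun n z hz => hR _ (hc0 n) z ((hRc n).trans_lt hz)
  have hm : ∀ r, lam.map (fun γ => extendPath hT γ r) ≤ volume := fun r => by
    rw [hmu]; exact withDensity_le_vol (hu1 r)
  have hua : ∀ r x, |u r x| ≤ 1 := fun r x => by rw [abs_of_nonneg (hu0 r x)]; exact hu1 r x
  have hbm : ∀ r, Measurable (b r) := fun r => hb.comp (measurable_const.prodMk measurable_id)
  set K : ℕ → Torus d → ℝ := fun n => KT (scK (c n) ρ) with hKdef
  have hK : ∀ n, ContDiff ℝ 1 (fun x => K n (projT d x)) :=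
    fun n => contDiff_KT (isKer_scK h (hc0 n)) (hsn n)
  have hKc : ∀ n, Measurable (K n) := fun n => (continuous_of_lift (hK n).continuous).measurable
  have hψm : Measurable ψ := hψ.continuous.measurable
  have hfJm : ∀ n, Measurable (fun p : ℝ × (Torus d × Torus d) => fJ b ψ (K n) p.1 p.2) :=
    fun n => measurable_fJ hb hψ.contDiff_one (hK n)
  set L : ℕ → ℝ → ℝ≥0∞ := fun n r => ∫⁻ q, ‖fJ b ψ (K n) r q‖ₑ ∂(volume.prod volume) with hL
  have hLm : ∀ n, Measurable (L n) := fun n => (hfJm n).enorm.lintegral_prod_right'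
  have hLb : ∀ n r μ N, BVData (b r) μ N → Integrable (b r) →
      L n r ≤ ∫⁻ y, (‖ψ y‖ₑ + ENNReal.ofReal (C * (R / c n))) * gK ρ (N y) ∂μ :=
    fun n r μ N hB hbr => Lbound hb hB hbr hψ hC0 hC h (hc0 n) (hRc n) (fun z hz => hR _ (hc0 n) z hz)
  obtain ⟨A, hA0, hA⟩ := cont_bdd hψ.continuous
  have hψe : ∀ y, ‖ψ y‖ₑ ≤ ENNReal.ofReal A := fun y => by
    rw [← ofReal_norm]; exact ENNReal.ofReal_le_ofReal (hA y)
  set Cg : ℝ≥0∞ := ENNReal.ofReal (d * d) * gM ρ with hCg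
  have hCgt : Cg < ∞ := ENNReal.mul_lt_top ENNReal.ofReal_lt_top (gM_lt_top h)
  have hgK : ∀ N : Vec d →L[ℝ] Vec d, ‖N‖ ≤ d * d → gK ρ N ≤ Cg := fun N hN => by
    refine (gK_le_gM h N).trans (mul_le_mul_left ?_ _)
    rw [← ofReal_norm]; exact ENNReal.ofReal_le_ofReal hN
  have hLV : ∀ n r μ N, BVData (b r) μ N → Integrable (b r) →
      L n r ≤ ((ENNReal.ofReal A + ENNReal.ofReal (C * (1/4))) * Cg) * μ univ := by
    intro n r μ N hB hbr
    refine (hLb n r μ N hB hbr).trans ?_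
    refine (lintegral_mono (g := fun _ => (ENNReal.ofReal A + ENNReal.ofReal (C * (1/4))) * Cg)
      fun y => ?_).trans (by rw [lintegral_const])
    refine mul_le_mul' (add_le_add (hψe y) (ENNReal.ofReal_le_ofReal ?_)) (hgK _ (hB.2.2.1 y))
    exact mul_le_mul_of_nonneg_left (hRc n) hC0
  refine ⟨fun r => limsup (fun n => L n r) atTop, Measurable.limsup hLm, ?_, ?_⟩
  · intro r μ N hB hbr
    have hfin := hB.1
    have hgm : Measurable fun y => gK ρ (N y) := (measurable_gK h).comp hB.2.1
    have e : ∀ n, ∫⁻ y, (‖ψ y‖ₑ + ENNReal.ofReal (C * (R / c n))) * gK ρ (N y) ∂μ =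
        (∫⁻ y, ‖ψ y‖ₑ * gK ρ (N y) ∂μ) + ENNReal.ofReal (C * (R / c n)) * ∫⁻ y, gK ρ (N y) ∂μ := by
      intro n
      simp_rw [add_mul]
      rw [lintegral_add_left (by exact hψm.enorm.mul hgm), lintegral_const_mul _ hgm]
    have hgi : ∫⁻ y, gK ρ (N y) ∂μ ≠ ∞ := by
      refine ((lintegral_mono fun y => hgK _ (hB.2.2.1 y)).trans_lt ?_).ne
      rw [lintegral_const]
      exact ENNReal.mul_lt_top hCgt (measure_lt_top _ _)
    have ht : Tendsto (fun n => (∫⁻ y, ‖ψ y‖ₑ * gK ρ (N y) ∂μ) +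
        ENNReal.ofReal (C * (R / c n)) * ∫⁻ y, gK ρ (N y) ∂μ) atTop
        (𝓝 ((∫⁻ y, ‖ψ y‖ₑ * gK ρ (N y) ∂μ) + ENNReal.ofReal (C * 0) * ∫⁻ y, gK ρ (N y) ∂μ)) := by
      refine Tendsto.const_add _ (ENNReal.Tendsto.mul_const ?_ (Or.inr hgi))
      exact ENNReal.tendsto_ofReal (((tendsto_const_nhds (x := R)).div_atTop hcinf).const_mul C)
    simp only [mul_zero, ENNReal.ofReal_zero, zero_mul, add_zero] at ht
    rw [← ht.limsup_eq]
    refine limsup_le_limsup (Eventually.of_forall fun n => ?_)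
    exact (hLb n r μ N hB hbr).trans (e n).le
  · intro r₁ r₂ h0 h12 h2 hVi
    have hsub : Ioc r₁ r₂ ⊆ Ioc 0 T := Ioc_subset_Ioc h0 h2
    have hV' := ae_mono (Measure.restrict_mono hsub le_rfl) hV
    -- convergence of E
    have pushE : ∀ n r, ∫ q : PathSpace T d × PathSpace T d,
        ψ (extendPath hT q.1 r) * K n (extendPath hT q.1 r - extendPath hT q.2 r) ∂(lam.prod lam)
        = ∫ q : Torus d × Torus d, (ψ q.1 * u r q.1) * (u r q.2 * K n (q.1 - q.2))
          ∂(volume.prod volume) := by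
      intro n r
      have := push_int hT (hu r) (hu0 r) (hmu r) (g := fun q => ψ q.1 * K n (q.1 - q.2))
        ((hψm.comp measurable_fst).fun_mul ((hKc n).comp (measurable_fst.sub measurable_snd)))
      simp only at this
      rw [this]
      congr 1; funext q; ring
    have hψu : ∀ r, Integrable (fun x => ψ x * u r x) := fun r =>
      int_mul_bdd (integrable_cont _ hψ.continuous) (hu r).aestronglyMeasurable (hua r)
    have limE : ∀ r, Tendsto (fun n => ∫ q : PathSpace T d × PathSpace T d,
        ψ (extendPath hT q.1 r) * K n (extendPath hT q.1 r - extendPath hT q.2 r) ∂(lam.prod lam))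
        atTop (𝓝 (∫ x, (ψ x * u r x) * u r x)) := by
      intro r
      simp_rw [pushE]
      exact conv_tendsto (hψu r) (hu r) (hua r) h hc0 hcinf hsn
    -- convergence of I
    have hDm : ∀ r, Measurable (fun x => DT ψ x (b r x)) := fun r =>
      clm_meas (continuous_DT hψ.contDiff_one).measurable (hbm r)
    have pushI : ∀ n r, ∫ q : PathSpace T d × PathSpace T d,
        fI b ψ (K n) r (extendPath hT q.1 r, extendPath hT q.2 r) ∂(lam.prod lam)
        = ∫ q : Torus d × Torus d, (DT ψ q.1 (b r q.1) * u r q.1) * (u r q.2 * K n (q.1 - q.2))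
          ∂(volume.prod volume) := by
      intro n r
      have hfIm : Measurable (fI b ψ (K n) r) := (measurable_fI hb hψ.contDiff_one (hK n)).comp
        (measurable_const.prodMk measurable_id)
      rw [push_int hT (hu r) (hu0 r) (hmu r) hfIm]
      congr 1; funext q; unfold fI; ring
    have hDn : ∀ r x, |DT ψ x (b r x) * u r x| ≤ C * ‖b r x‖ := fun r x => by
      rw [abs_mul]
      refine (mul_le_of_le_one_right (abs_nonneg _) (hua r x)).trans ?_
      exact ((DT ψ x).le_opNorm _).trans (mul_le_mul_of_nonneg_right (hC x) (norm_nonneg _))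
    have hDu : ∀ r, Integrable (b r) → Integrable (fun x => DT ψ x (b r x) * u r x) := fun r hbr =>
      (hbr.norm.const_mul C).mono' ((hDm r).fun_mul (hu r)).aestronglyMeasurable
        (ae_of_all _ fun x => hDn r x)
    have limI : ∀ r, Integrable (b r) → Tendsto (fun n => ∫ q : PathSpace T d × PathSpace T d,
        fI b ψ (K n) r (extendPath hT q.1 r, extendPath hT q.2 r) ∂(lam.prod lam))
        atTop (𝓝 (∫ x, (DT ψ x (b r x) * u r x) * u r x)) := by
      intro r hbr
      simp_rw [pushI]
      exact conv_tendsto (hDu r hbr) (hu r) (hua r) h hc0 hcinf hsn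
    have bI : ∀ n r, Integrable (b r) → ‖∫ q : PathSpace T d × PathSpace T d,
        fI b ψ (K n) r (extendPath hT q.1 r, extendPath hT q.2 r) ∂(lam.prod lam)‖
        ≤ (C * ∫ x, ‖b r x‖) * ∫ z, |ρ z| := by
      intro n r hbr
      rw [pushI]
      refine (conv_le (hDu r hbr) (hu r) (hua r) h (hc0 n) (hsn n)).trans ?_
      refine mul_le_mul_of_nonneg_right ?_ (integral_nonneg fun _ => abs_nonneg _)
      rw [← integral_const_mul]
      exact integral_mono (hDu r hbr).abs (hbr.norm.const_mul C) (hDn r)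
    have hbint : Integrable (fun p : ℝ × Torus d => b p.1 p.2)
        ((volume.restrict (Ioc r₁ r₂)).prod volume) := by
      have hbm' : Measurable (fun p : ℝ × Torus d => b p.1 p.2) := hb
      refine ⟨hbm'.aestronglyMeasurable, ?_⟩
      rw [hasFiniteIntegral_iff_enorm, lintegral_prod _ hbm'.enorm.aemeasurable]
      exact (lintegral_mono' (Measure.restrict_mono hsub le_rfl) le_rfl).trans_lt hbI
    have hbound : Integrable (fun r => (C * ∫ x, ‖b r x‖) * ∫ z, |ρ z|) (volume.restrict (Ioc r₁ r₂)) :=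
      (hbint.integral_norm_prod_left.const_mul C).mul_const _
    have hmono : (volume.restrict (Ioc r₁ r₂)).prod (lam.prod lam) ≤
        (volume.restrict (Ioc 0 T)).prod (lam.prod lam) :=
      Measure.prod_mono (Measure.restrict_mono hsub le_rfl) le_rfl
    have measI : ∀ n, AEStronglyMeasurable (fun r => ∫ q : PathSpace T d × PathSpace T d,
        fI b ψ (K n) r (extendPath hT q.1 r, extendPath hT q.2 r) ∂(lam.prod lam))
        (volume.restrict (Ioc r₁ r₂)) := by
      intro n
      obtain ⟨C', hC'⟩ := fI_bound b hψ.contDiff_one (hK n)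
      exact ((integrable_pair hT hb hm hbI (measurable_fI hb hψ.contDiff_one (hK n))
        hC').mono_measure hmono).integral_prod_left.aestronglyMeasurable
    have limI' : ∀ᵐ r ∂(volume.restrict (Ioc r₁ r₂)), Tendsto (fun n =>
        ∫ q : PathSpace T d × PathSpace T d,
        fI b ψ (K n) r (extendPath hT q.1 r, extendPath hT q.2 r) ∂(lam.prod lam))
        atTop (𝓝 (∫ x, (DT ψ x (b r x) * u r x) * u r x)) := by
      filter_upwards [hV'] with r hr using limI r hr.1
    have limII := tendsto_integral_of_dominated_convergence _ measI hbound
      (fun n => by filter_upwards [hV'] with r hr using bI n r hr.1) limI'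
    refine ⟨?_, ?_⟩
    · refine hbound.mono' (aestronglyMeasurable_of_tendsto_ae _ measI limI') ?_
      filter_upwards [hV'] with r hr
      exact le_of_tendsto (limI r hr.1).norm (Eventually.of_forall fun n => bI n r hr.1)
    have limD := (((limE r₂).sub (limE r₁)).sub limII).enorm
    rw [← limD.limsup_eq]
    have step : ∀ n, ‖(∫ q : PathSpace T d × PathSpace T d,
        ψ (extendPath hT q.1 r₂) * K n (extendPath hT q.1 r₂ - extendPath hT q.2 r₂) ∂(lam.prod lam))
      - (∫ q : PathSpace T d × PathSpace T d,
        ψ (extendPath hT q.1 r₁) * K n (extendPath hT q.1 r₁ - extendPath hT q.2 r₁) ∂(lam.prod lam))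
      - ∫ r in Ioc r₁ r₂, ∫ q : PathSpace T d × PathSpace T d,
        fI b ψ (K n) r (extendPath hT q.1 r, extendPath hT q.2 r) ∂(lam.prod lam)‖ₑ
      ≤ ∫⁻ r in Ioc r₁ r₂, L n r := by
      intro n
      rw [doubling_id hT hb hc hm hbI hψ.contDiff_one (hK n) h0 h12 h2, add_sub_cancel_left]
      refine (enorm_integral_le_lintegral_enorm _).trans (lintegral_mono fun r => ?_)
      refine (enorm_integral_le_lintegral_enorm _).trans ?_
      exact push_lint_le hT (hm r) (g := fun q => ‖fJ b ψ (K n) r q‖ₑ)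
        ((hfJm n).comp (measurable_const.prodMk measurable_id)).enorm
    refine (limsup_le_limsup (Eventually.of_forall step)).trans ?_
    refine limsup_lintegral_le (g := fun r => ⨆ n, L n r) hLm ?_ ?_
    · exact fun n => ae_of_all _ fun r => le_iSup (fun n => L n r) n
    · refine (lt_of_le_of_lt (lintegral_mono_ae (g := fun r =>
        ((ENNReal.ofReal A + ENNReal.ofReal (C * (1/4))) * Cg) * V r) ?_) ?_).ne
      · filter_upwards [hV'] with r hr
        obtain ⟨hr1, μ, N, hμ, hB⟩ := hr
        refine iSup_le fun n => ?_
        rw [← hμ]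
        exact hLV n r μ N hB hr1
      · have hne : (ENNReal.ofReal A + ENNReal.ofReal (C * (1/4))) * Cg ≠ ∞ :=
          ENNReal.mul_ne_top (by simp) hCgt.ne
        rw [lintegral_const_mul' _ _ hne]
        exact ENNReal.mul_lt_top hne.lt_top hVi


/-! ### Partition argument -/

def kM {d : ℕ} (ρ : Vec d → ℝ) : ℝ := (ENNReal.ofReal (d * d) * gM ρ).toReal

lemma gK_le_kM {d : ℕ} {ρ : Vec d → ℝ} (h : IsKer ρ) {N : Vec d →L[ℝ] Vec d}
    (hN : ‖N‖ ≤ d * d) : gK ρ N ≤ ENNReal.ofReal (kM ρ) := by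
  have hf : ENNReal.ofReal (d * d) * gM ρ ≠ ∞ := ENNReal.mul_ne_top ENNReal.ofReal_ne_top (gM_lt_top h).ne
  rw [kM, ENNReal.ofReal_toReal hf]
  refine (gK_le_gM h N).trans (mul_le_mul_left ?_ _)
  rw [← ofReal_norm]
  exact ENNReal.ofReal_le_ofReal hN

lemma kM_nonneg {d : ℕ} (ρ : Vec d → ℝ) : 0 ≤ kM ρ := ENNReal.toReal_nonneg

lemma lint_part {d : ℕ} {μ : Measure (Torus d)} [IsFiniteMeasure μ]
    {N : Torus d → (Vec d →L[ℝ] Vec d)} (hNm : Measurable N) (hN : ∀ y, ‖N y‖ ≤ d * d)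
    {ρ : Vec d → ℝ} (h : IsKer ρ) {A : Set (Torus d)} (hA : MeasurableSet A) {δ e : ℝ}
    (hδ : 0 ≤ δ) (he : 0 ≤ e)
    (hAδ : ∀ y ∈ A, gK ρ (N y) ≤ ENNReal.ofReal δ) (φ : C(Torus d, ℝ))
    (hφ : ∫ y, |A.indicator 1 y - φ y| ∂μ ≤ e) :
    ∫⁻ y, ‖φ y‖ₑ * gK ρ (N y) ∂μ ≤ ENNReal.ofReal (δ * μ.real A + kM ρ * e) := by
  have hk := kM_nonneg ρ
  have hAi : Integrable (A.indicator (1 : Torus d → ℝ)) μ := (integrable_const 1).indicator hA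
  have h1 : ∀ y, ‖φ y‖ₑ * gK ρ (N y) ≤ A.indicator (fun _ => ENNReal.ofReal δ) y +
      ENNReal.ofReal (kM ρ) * ‖A.indicator (1 : Torus d → ℝ) y - φ y‖ₑ := by
    intro y
    have h2 : ‖φ y‖ₑ ≤ ‖A.indicator (1 : Torus d → ℝ) y‖ₑ +
        ‖A.indicator (1 : Torus d → ℝ) y - φ y‖ₑ := by
      have := enorm_sub_le (a := A.indicator (1 : Torus d → ℝ) y)
        (b := A.indicator (1 : Torus d → ℝ) y - φ y)
      simpa using this
    refine (mul_le_mul_left h2 _).trans ?_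
    rw [add_mul]
    refine add_le_add ?_ ?_
    · by_cases hy : y ∈ A
      · simpa [hy] using hAδ y hy
      · simp [hy]
    · rw [mul_comm]
      exact mul_le_mul_left (gK_le_kM h (hN y)) _
  refine (lintegral_mono h1).trans ?_
  rw [lintegral_add_left (measurable_const.indicator hA), lintegral_indicator hA,
    setLIntegral_const, lintegral_const_mul' _ _ (by simp),
    ENNReal.ofReal_add (by positivity) (by positivity), ENNReal.ofReal_mul hδ,
    ENNReal.ofReal_mul hk, ofReal_measureReal]
  gcongr
  have h3 : Integrable (fun y => A.indicator (1 : Torus d → ℝ) y - φ y) μ :=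
    hAi.sub (integrable_cont μ φ.continuous)
  rw [← ofReal_integral_norm_eq_lintegral_enorm h3]
  exact ENNReal.ofReal_le_ofReal hφ

lemma partition_ind {d : ℕ} {D : AddSubgroup C(Torus d, ℝ)} (hD : Dense (D : Set C(Torus d, ℝ)))
    {μ : Measure (Torus d)} [IsFiniteMeasure μ]
    {N : Torus d → (Vec d →L[ℝ] Vec d)} (hNm : Measurable N) (hN : ∀ y, ‖N y‖ ≤ d * d)
    {Q : C(Torus d, ℝ) → ℝ → Prop} (hadd : ∀ φ ∈ D, ∀ ψ ∈ D, ∀ c c', Q φ c → Q ψ c' → Q (φ + ψ) (c + c'))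
    (hmono : ∀ ψ c c', Q ψ c → c ≤ c' → Q ψ c')
    (h00 : Q 0 0) {δ : ℝ} (hδ : 0 ≤ δ)
    (S : Finset (Vec d → ℝ)) (hS : ∀ ρ ∈ S, IsKer ρ)
    (hQ : ∀ ρ ∈ S, ∀ ψ ∈ D, ∀ c, 0 ≤ c →
      ∫⁻ y, ‖ψ y‖ₑ * gK ρ (N y) ∂μ ≤ ENNReal.ofReal c → Q ψ c) :
    ∀ B : Set (Torus d), MeasurableSet B →
      (∀ y ∈ B, ∃ ρ ∈ S, gK ρ (N y) ≤ ENNReal.ofReal δ) → ∀ ε : ℝ, 0 < ε →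
      ∃ ψ ∈ D, Q ψ (δ * μ.real B + ε) ∧ ∫ y, |B.indicator 1 y - ψ y| ∂μ ≤ ε := by
  classical
  induction S using Finset.induction_on with
  | empty =>
    intro B hB hBS ε hε
    have : B = ∅ := by
      ext y; constructor
      · intro hy; obtain ⟨ρ, hρ, _⟩ := hBS y hy; simp at hρ
      · simp
    subst this
    exact ⟨0, D.zero_mem, hmono _ _ _ h00 (by simp [hε.le]), by simp [hε.le]⟩
  | insert ρ S hρS ih =>
    intro B hB hBS ε hε
    have hρ : IsKer ρ := hS ρ (by simp)
    set E : Set (Torus d) := {y | gK ρ (N y) ≤ ENNReal.ofReal δ} with hE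
    have hEm : MeasurableSet E :=
      measurableSet_le ((measurable_gK hρ).comp hNm) measurable_const
    obtain ⟨ψ, hψD, hψQ, hψ⟩ := ih (fun ρ' h' => hS ρ' (by simp [h']))
      (fun ρ' h' => hQ ρ' (by simp [h'])) (B \ E) (hB.diff hEm) (by
        intro y hy
        obtain ⟨ρ', h1, h2⟩ := hBS y hy.1
        rcases Finset.mem_insert.1 h1 with rfl | h1
        · exact absurd h2 hy.2
        · exact ⟨ρ', h1, h2⟩) (ε / 2) (half_pos hε)
    have hk := kM_nonneg ρ
    set e : ℝ := ε / (2 * (kM ρ + 1)) with he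
    have he0 : 0 < e := by positivity
    have he1 : kM ρ * e ≤ ε / 2 := by
      rw [he, ← mul_div_assoc, div_le_iff₀ (by positivity)]; nlinarith
    have he2 : e ≤ ε / 2 := by
      rw [he, div_le_iff₀ (by positivity)]; nlinarith
    have hBEm := hB.inter hEm
    have hi1 : Integrable ((B ∩ E).indicator (1 : Torus d → ℝ)) μ :=
      (integrable_const 1).indicator hBEm
    have hi2 : Integrable ((B \ E).indicator (1 : Torus d → ℝ)) μ :=
      (integrable_const 1).indicator (hB.diff hEm)
    obtain ⟨φ, hφD, hφ⟩ := dense_approx hD μ hi1 he0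
    have hQφ := hQ ρ (by simp) φ hφD (δ * μ.real (B ∩ E) + kM ρ * e) (by positivity)
      (lint_part hNm hN hρ hBEm hδ he0.le (fun y hy => hy.2) φ hφ)
    refine ⟨φ + ψ, D.add_mem hφD hψD, hmono _ _ _ (hadd φ hφD ψ hψD _ _ hQφ hψQ) ?_, ?_⟩
    · have := measureReal_inter_add_sdiff (μ := μ) (s := B) hEm
      rw [← this]; linarith
    · have h3 : ∀ y, |B.indicator 1 y - (φ + ψ) y| ≤ |(B ∩ E).indicator 1 y - φ y| +
          |(B \ E).indicator 1 y - ψ y| := by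
        intro y
        have : B.indicator (1 : Torus d → ℝ) y = (B ∩ E).indicator 1 y + (B \ E).indicator 1 y := by
          by_cases h1 : y ∈ B <;> by_cases h2 : y ∈ E <;> simp [h1, h2]
        rw [this, ContinuousMap.add_apply]
        refine le_trans (le_of_eq ?_) (abs_add_le _ _)
        congr 1; ring
      have j1 := (hi1.sub (integrable_cont μ φ.continuous)).abs
      have j2 := (hi2.sub (integrable_cont μ ψ.continuous)).abs
      have := integral_mono_of_nonneg (ae_of_all _ fun y => abs_nonneg _) (j1.add j2)
        (ae_of_all _ h3)
      refine this.trans ?_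
      erw [integral_add j1 j2]
      have := add_le_add (hφ.trans he2) hψ
      simpa using this

lemma partition_one {d : ℕ} {D : AddSubgroup C(Torus d, ℝ)} (hD : Dense (D : Set C(Torus d, ℝ)))
    (h1D : 1 ∈ D)
    {μ : Measure (Torus d)} [IsFiniteMeasure μ]
    {N : Torus d → (Vec d →L[ℝ] Vec d)} (hNm : Measurable N) (hN : ∀ y, ‖N y‖ ≤ d * d)
    {Q : C(Torus d, ℝ) → ℝ → Prop} (hadd : ∀ φ ∈ D, ∀ ψ ∈ D, ∀ c c', Q φ c → Q ψ c' → Q (φ + ψ) (c + c'))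
    (hmono : ∀ ψ c c', Q ψ c → c ≤ c' → Q ψ c')
    {δ : ℝ} (hδ : 0 ≤ δ)
    (S : Finset (Vec d → ℝ)) (hS : ∀ ρ ∈ S, IsKer ρ)
    (hcov : ∀ y, ∃ ρ ∈ S, gK ρ (N y) ≤ ENNReal.ofReal δ)
    (hQ : ∀ ρ ∈ S, ∀ ψ ∈ D, ∀ c, 0 ≤ c →
      ∫⁻ y, ‖ψ y‖ₑ * gK ρ (N y) ∂μ ≤ ENNReal.ofReal c → Q ψ c) {ε : ℝ} (hε : 0 < ε) :
    Q 1 (δ * μ.real univ + ε) := by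
  obtain ⟨ρ, hρS, _⟩ := hcov 0
  have hρ := hS ρ hρS
  have hk := kM_nonneg ρ
  have h00 : Q 0 0 := hQ ρ hρS 0 D.zero_mem 0 le_rfl (by simp)
  set e : ℝ := ε / (2 * (kM ρ + 1)) with he
  have he0 : 0 < e := by positivity
  have he1 : kM ρ * e ≤ ε / 2 := by
    rw [he, ← mul_div_assoc, div_le_iff₀ (by positivity)]; nlinarith
  have he2 : e ≤ ε / 2 := by
    rw [he, div_le_iff₀ (by positivity)]; nlinarith
  obtain ⟨ψ, hψD, hψQ, hψ⟩ := partition_ind hD hNm hN hadd hmono h00 hδ S hS hQ univ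
    MeasurableSet.univ (fun y _ => hcov y) e he0
  have h2 := hQ ρ hρS (1 - ψ) (D.sub_mem h1D hψD) (δ * μ.real (∅ : Set (Torus d)) + kM ρ * e)
    (by simp; positivity) (lint_part hNm hN hρ MeasurableSet.empty hδ he0.le (by simp) _ (by
      refine le_trans (le_of_eq ?_) hψ
      refine integral_congr_ae (ae_of_all _ fun y => ?_)
      simp [abs_sub_comm]))
  have h3 := hadd ψ hψD _ (D.sub_mem h1D hψD) _ _ hψQ h2
  rw [add_sub_cancel] at h3
  refine hmono _ _ _ h3 ?_
  simp; linarith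


/-! ### Renormalization -/

lemma DT_one {d : ℕ} (x : Torus d) : DT ((1 : C(Torus d, ℝ)) : Torus d → ℝ) x = 0 := by
  unfold DT
  have : (fun x => (1 : C(Torus d, ℝ)) (projT d x)) = fun _ => (1 : ℝ) := by ext; simp
  rw [this]; simp

lemma DT_add {d : ℕ} {φ ψ : C(Torus d, ℝ)} (hφ : SmoothT (φ : Torus d → ℝ))
    (hψ : SmoothT (ψ : Torus d → ℝ)) (x : Torus d) :
    DT ((φ + ψ : C(Torus d, ℝ)) : Torus d → ℝ) x = DT φ x + DT ψ x := by
  unfold DT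
  rw [← fderiv_fun_add (hφ.differentiable (by simp) _) (hψ.differentiable (by simp) _)]
  rfl

lemma integrable_DT_apply {d : ℕ} {ψ : Torus d → ℝ} (hψ : SmoothT ψ) {w : Torus d → Vec d}
    (hw : Measurable w) (hwi : Integrable w) : Integrable (fun x => DT ψ x (w x)) := by
  obtain ⟨C, hC0, hC⟩ := DT_bound hψ.contDiff_one
  refine (hwi.norm.const_mul C).mono'
    (clm_meas (continuous_DT hψ.contDiff_one).measurable hw).aestronglyMeasurable
    (ae_of_all _ fun x => ?_)
  exact ((DT ψ x).le_opNorm _).trans (by gcongr; exact hC x)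

lemma renorm {T : ℝ} {d : ℕ} (hT : 0 ≤ T) {b : ℝ → Torus d → Vec d}
    {lam : Measure (PathSpace T d)} [IsFiniteMeasure lam]
    (hb : Measurable (Function.uncurry b))
    (hc : ∀ᵐ γ ∂lam, IsIntegralCurveOf hT b γ)
    {u : ℝ → Torus d → ℝ} (hu : ∀ r, Measurable (u r)) (hu0 : ∀ r x, 0 ≤ u r x)
    (hu1 : ∀ r x, u r x ≤ 1)
    (hmu : ∀ r, lam.map (fun γ => extendPath hT γ r) =
      volume.withDensity fun x => ENNReal.ofReal (u r x))
    (hbI : ∫⁻ t in Ioc 0 T, ∫⁻ x, ‖b t x‖ₑ < ∞)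
    {V : ℝ → ℝ≥0∞}
    (hV : ∀ᵐ r ∂(volume.restrict (Ioc 0 T)), Integrable (b r) ∧ ∃ μ N, μ univ = V r ∧ BVData (b r) μ N)
    {a t : ℝ} (ha : 0 ≤ a) (hat : a ≤ t) (ht : t ≤ T) (hVf : ∫⁻ r in Ioc a t, V r < ∞) :
    ∫ x, u a x * u a x = ∫ x, u t x * u t x := by
  obtain ⟨D, hDc, hDs, hD1, hDd⟩ := exists_countable_smooth d
  choose S hSf hSk hScov using fun k : ℕ => kernel_family d (δ := 1 / ((k : ℝ) + 1)) (by positivity)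
  have hRc : (⋃ k, S k).Countable := countable_iUnion fun k => (hSf k).countable
  have hRk : ∀ ρ ∈ ⋃ k, S k, IsKer ρ := by
    intro ρ hρ
    obtain ⟨k, hk⟩ := mem_iUnion.1 hρ
    exact hSk k ρ hk
  have : Countable D := hDc.to_subtype
  have : Countable (⋃ k, S k : Set (Vec d → ℝ)) := hRc.to_subtype
  choose Λ hΛm hΛ hΛd using fun (ψ : D) (ρ : (⋃ k, S k : Set (Vec d → ℝ))) =>
    doubling_lim hT hb hc hu hu0 hu1 hmu hbI hV (hDs ψ.1 ψ.2) (hRk ρ.1 ρ.2)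
  have hVsub : ∀ s r, a ≤ s → r ≤ t → ∫⁻ r in Ioc s r, V r < ∞ := fun s r h1 h2 =>
    (lintegral_mono_set (Ioc_subset_Ioc h1 h2)).trans_lt hVf
  -- a.e. facts on `Ioc a t`
  have hV' : ∀ᵐ r ∂(volume.restrict (Ioc a t)),
      Integrable (b r) ∧ ∃ μ N, μ univ = V r ∧ BVData (b r) μ N :=
    ae_restrict_of_ae_restrict_of_subset (Ioc_subset_Ioc ha ht) hV
  have hΛfin : ∀ ψ ρ, ∫⁻ r in Ioc a t, Λ ψ ρ r < ∞ := by
    intro ψ ρ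
    obtain ⟨C, hC⟩ : ∃ C, ∀ y, ‖(ψ.1 : Torus d → ℝ) y‖ ≤ C :=
      ⟨‖ψ.1‖, fun y => ψ.1.norm_coe_le_norm y⟩
    have h1 : ∀ᵐ r ∂(volume.restrict (Ioc a t)), Λ ψ ρ r ≤
        ENNReal.ofReal C * ENNReal.ofReal (kM ρ.1) * V r := by
      filter_upwards [hV'] with r hr
      obtain ⟨hr1, μ, N, hμ, hB⟩ := hr
      refine (hΛ ψ ρ r μ N hB hr1).trans ?_
      rw [← hμ, ← lintegral_const]
      refine lintegral_mono fun y => mul_le_mul' ?_ (gK_le_kM (hRk ρ.1 ρ.2) (hB.2.2.1 y))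
      rw [← ofReal_norm]
      exact ENNReal.ofReal_le_ofReal (hC y)
    refine (lintegral_mono_ae h1).trans_lt ?_
    rw [lintegral_const_mul' _ _ (by finiteness)]
    exact ENNReal.mul_lt_top (by finiteness) hVf
  have hΛi : ∀ ψ ρ, IntervalIntegrable (fun r => (Λ ψ ρ r).toReal) volume a t := by
    intro ψ ρ
    rw [intervalIntegrable_iff_integrableOn_Ioc_of_le hat]
    exact integrable_toReal_of_lintegral_ne_top (hΛm ψ ρ).aemeasurable (hΛfin ψ ρ).ne
  have hΛint : ∀ ψ ρ s r, a ≤ s → s ≤ r → r ≤ t →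
      ∫⁻ v in Ioc s r, Λ ψ ρ v = ENNReal.ofReal (∫ v in s..r, (Λ ψ ρ v).toReal) := by
    intro ψ ρ s r h1 h2 h3
    have hf : ∫⁻ v in Ioc s r, Λ ψ ρ v ≠ ∞ :=
      ((lintegral_mono_set (Ioc_subset_Ioc h1 h3)).trans_lt (hΛfin ψ ρ)).ne
    rw [intervalIntegral.integral_of_le h2, integral_toReal (hΛm ψ ρ).aemeasurable
      (ae_lt_top (hΛm ψ ρ) hf), ENNReal.ofReal_toReal hf]
  have hne : (⋃ k, S k).Nonempty := by
    obtain ⟨ρ, hρ, _⟩ := hScov 0 0 (by simp; positivity) (by simp)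
    exact ⟨ρ, mem_iUnion.2 ⟨0, hρ⟩⟩
  obtain ⟨ρ0, hρ0⟩ := hne
  -- the functional
  let I : C(Torus d, ℝ) → ℝ → ℝ := fun ψ r => ∫ x, (DT ψ x (b r x) * u r x) * u r x
  let J : C(Torus d, ℝ) → ℝ → ℝ := fun ψ r => ∫ x, (ψ x * u r x) * u r x
  let H : C(Torus d, ℝ) → ℝ → ℝ := fun ψ r => J ψ r - ∫ v in a..r, I ψ v
  have hIint : ∀ ψ ∈ D, IntervalIntegrable (I ψ) volume a t := by
    intro ψ hψ
    rw [intervalIntegrable_iff_integrableOn_Ioc_of_le hat]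
    exact (hΛd ⟨ψ, hψ⟩ ⟨ρ0, hρ0⟩ a t ha hat ht hVf).1
  have hHd : ∀ (ψ : D) ρ s r, a ≤ s → s ≤ r → r ≤ t →
      |H ψ r - H ψ s| ≤ ∫ v in s..r, (Λ ψ ρ v).toReal := by
    intro ψ ρ s r h1 h2 h3
    have h4 := (hΛd ψ ρ s r (ha.trans h1) h2 (h3.trans ht) (hVsub s r h1 h3)).2
    rw [hΛint ψ ρ s r h1 h2 h3, ← ofReal_norm, ENNReal.ofReal_le_ofReal_iff
      (intervalIntegral.integral_nonneg h2 fun v _ => ENNReal.toReal_nonneg), Real.norm_eq_abs,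
      ← intervalIntegral.integral_of_le h2] at h4
    refine le_trans (le_of_eq ?_) h4
    congr 1
    have hs : IntervalIntegrable (I ψ) volume a s :=
      (hIint ψ ψ.2).mono_set (uIcc_subset_uIcc left_mem_uIcc (by
        rw [uIcc_of_le hat]; exact ⟨h1, h2.trans h3⟩))
    have hr : IntervalIntegrable (I ψ) volume s r :=
      (hIint ψ ψ.2).mono_set (uIcc_subset_uIcc (by
        rw [uIcc_of_le hat]; exact ⟨h1, h2.trans h3⟩) (by
        rw [uIcc_of_le hat]; exact ⟨h1.trans h2, h3⟩))
    have := intervalIntegral.integral_add_adjacent_intervals hs hr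
    simp only [H, J]
    rw [← this]
    simp only [I]
    ring
  have hder : ∀ᵐ r, r ∈ Ioo a t → HasDerivAt (H 1) 0 r := by
    have e1 : ∀ᵐ r, ∀ (ψ : D) (ρ : (⋃ k, S k : Set (Vec d → ℝ))), r ∈ uIcc a t →
        ∀ c ∈ uIcc a t, HasDerivAt (fun x => ∫ v in c..x, (Λ ψ ρ v).toReal) (Λ ψ ρ r).toReal r :=
      ae_all_iff.2 fun ψ => ae_all_iff.2 fun ρ => (hΛi ψ ρ).ae_hasDerivAt_integral
    filter_upwards [e1, (ae_restrict_iff' measurableSet_Ioc).1 hV'] with r hr hrV hrI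
    obtain ⟨hbr, μ, N, hμ, hB⟩ := hrV (Ioo_subset_Ioc_self hrI)
    have hB' := hB
    obtain ⟨hμf, hNm, hN, hNt, -⟩ := hB
    let Q : C(Torus d, ℝ) → ℝ → Prop := fun ψ c => ∀ ε : ℝ, 0 < ε → ∀ᶠ s in 𝓝 r,
      |H ψ s - H ψ r| ≤ (c + ε) * |s - r|
    have hnb : ∀ᶠ s in 𝓝 r, s ∈ Ioo a t := Ioo_mem_nhds hrI.1 hrI.2
    have hmono : ∀ ψ c c', Q ψ c → c ≤ c' → Q ψ c' := by
      intro ψ c c' h hcc ε hε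
      filter_upwards [h ε hε] with s hs
      exact hs.trans (by gcongr)
    have hHadd : ∀ φ ∈ D, ∀ ψ ∈ D, ∀ s ∈ Icc a t, H (φ + ψ) s = H φ s + H ψ s := by
      intro φ hφ ψ hψ s hs
      have hua : ∀ v x, |u v x| ≤ 1 := fun v x => abs_le.2 ⟨by linarith [hu0 v x], hu1 v x⟩
      have hJ : J (φ + ψ) s = J φ s + J ψ s := by
        simp only [J]
        rw [← integral_add]
        · refine integral_congr_ae (ae_of_all _ fun x => ?_)
          simp only [ContinuousMap.add_apply]; ring
        · exact int_mul_bdd (int_mul_bdd (integrable_cont _ φ.continuous)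
            (hu s).aestronglyMeasurable (hua s)) (hu s).aestronglyMeasurable (hua s)
        · exact int_mul_bdd (int_mul_bdd (integrable_cont _ ψ.continuous)
            (hu s).aestronglyMeasurable (hua s)) (hu s).aestronglyMeasurable (hua s)
      have hI : ∫ v in a..s, I (φ + ψ) v = (∫ v in a..s, I φ v) + ∫ v in a..s, I ψ v := by
        have hsub : uIcc a s ⊆ uIcc a t := uIcc_subset_uIcc left_mem_uIcc (by
          rw [uIcc_of_le hat]; exact hs)
        rw [← intervalIntegral.integral_add ((hIint φ hφ).mono_set hsub)
          ((hIint ψ hψ).mono_set hsub), intervalIntegral.integral_of_le hs.1,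
          intervalIntegral.integral_of_le hs.1]
        refine integral_congr_ae ?_
        filter_upwards [ae_restrict_of_ae_restrict_of_subset (Ioc_subset_Ioc_right hs.2) hV'] with v hv
        have hbm : Measurable (b v) := hb.comp (measurable_const.prodMk measurable_id)
        simp only [I]
        rw [← integral_add]
        · refine integral_congr_ae (ae_of_all _ fun x => ?_)
          simp only [DT_add (hDs φ hφ) (hDs ψ hψ), add_apply]; ring
        · exact int_mul_bdd (int_mul_bdd (integrable_DT_apply (hDs φ hφ) hbm hv.1)
            (hu v).aestronglyMeasurable (hua v)) (hu v).aestronglyMeasurable (hua v)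
        · exact int_mul_bdd (int_mul_bdd (integrable_DT_apply (hDs ψ hψ) hbm hv.1)
            (hu v).aestronglyMeasurable (hua v)) (hu v).aestronglyMeasurable (hua v)
      simp only [H]
      rw [hJ, hI]; ring
    have hadd : ∀ φ ∈ D, ∀ ψ ∈ D, ∀ c c', Q φ c → Q ψ c' → Q (φ + ψ) (c + c') := by
      intro φ hφ ψ hψ c c' h1 h2 ε hε
      filter_upwards [h1 _ (half_pos hε), h2 _ (half_pos hε), hnb] with s hs1 hs2 hs
      rw [hHadd φ hφ ψ hψ s (Ioo_subset_Icc_self hs), hHadd φ hφ ψ hψ r (Ioo_subset_Icc_self hrI)]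
      calc |H φ s + H ψ s - (H φ r + H ψ r)| = |(H φ s - H φ r) + (H ψ s - H ψ r)| := by
            congr 1; ring
        _ ≤ |H φ s - H φ r| + |H ψ s - H ψ r| := abs_add_le _ _
        _ ≤ _ := add_le_add hs1 hs2
        _ = _ := by ring
    have hQ : ∀ ρ ∈ ⋃ k, S k, ∀ ψ ∈ D, ∀ c, 0 ≤ c →
        ∫⁻ y, ‖ψ y‖ₑ * gK ρ (N y) ∂μ ≤ ENNReal.ofReal c → Q ψ c := by
      intro ρ hρ ψ hψ c hc0 hle ε hε
      have hL : (Λ ⟨ψ, hψ⟩ ⟨ρ, hρ⟩ r).toReal ≤ c :=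
        ENNReal.toReal_le_of_le_ofReal hc0 ((hΛ ⟨ψ, hψ⟩ ⟨ρ, hρ⟩ r μ N hB' hbr).trans hle)
      have hd := hr ⟨ψ, hψ⟩ ⟨ρ, hρ⟩ (by rw [uIcc_of_le hat]; exact Ioo_subset_Icc_self hrI) r
        (by rw [uIcc_of_le hat]; exact Ioo_subset_Icc_self hrI)
      have hd2 := (hasDerivAt_iff_isLittleO.1 hd).def hε
      filter_upwards [hd2, hnb] with s hs hsI
      set G := fun v => (Λ ⟨ψ, hψ⟩ ⟨ρ, hρ⟩ v).toReal
      have hbase : |H ψ s - H ψ r| ≤ |∫ v in r..s, G v| := by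
        rcases le_total r s with h | h
        · exact (hHd ⟨ψ, hψ⟩ ⟨ρ, hρ⟩ r s hrI.1.le h hsI.2.le).trans (le_abs_self _)
        · rw [intervalIntegral.integral_symm, abs_neg, abs_sub_comm]
          exact (hHd ⟨ψ, hψ⟩ ⟨ρ, hρ⟩ s r hsI.1.le h hrI.2.le).trans (le_abs_self _)
      simp only [intervalIntegral.integral_same, sub_zero, smul_eq_mul, Real.norm_eq_abs] at hs
      refine hbase.trans ?_
      have h5 : |∫ v in r..s, G v| ≤ |(s - r) * G r| + ε * |s - r| := by
        have := abs_add_le ((∫ v in r..s, G v) - (s - r) * G r) ((s - r) * G r)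
        rw [sub_add_cancel] at this
        linarith
      rw [abs_mul, abs_of_nonneg (a := G r) ENNReal.toReal_nonneg] at h5
      have := mul_le_mul_of_nonneg_left hL (abs_nonneg (s - r))
      simp only [G] at *
      linarith
    have hQ1 : ∀ ε : ℝ, 0 < ε → Q 1 ε := by
      intro ε hε
      obtain ⟨k, hk⟩ : ∃ k : ℕ, 1 / ((k : ℝ) + 1) * μ.real univ ≤ ε / 2 := by
        have h1 : Tendsto (fun k : ℕ => 1 / ((k : ℝ) + 1) * μ.real univ) atTop (𝓝 (0 * μ.real univ)) :=
          tendsto_one_div_add_atTop_nhds_zero_nat.mul_const _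
        rw [zero_mul] at h1
        exact ((h1.eventually (ge_mem_nhds (half_pos hε))).exists)
      have := partition_one hDd hD1 hNm hN hadd hmono (δ := 1 / ((k : ℝ) + 1)) (by positivity)
        (hSf k).toFinset (fun ρ hρ => hSk k ρ (by simpa using hρ))
        (fun y => by
          obtain ⟨ρ, h1, h2⟩ := hScov k (N y) (hN y) (hNt y)
          exact ⟨ρ, by simpa using h1, h2⟩)
        (fun ρ hρ => hQ ρ (mem_iUnion.2 ⟨k, by simpa using hρ⟩)) (half_pos hε)
      exact hmono _ _ _ this (by linarith)
    rw [hasDerivAt_iff_isLittleO]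
    refine Asymptotics.IsLittleO.of_bound fun ε hε => ?_
    filter_upwards [hQ1 _ (half_pos hε) _ (half_pos hε)] with s hs
    simpa using hs
  have key := const_of_dom hat (hΛi ⟨1, hD1⟩ ⟨ρ0, hρ0⟩) (hHd ⟨1, hD1⟩ ⟨ρ0, hρ0⟩) hder
  have hI1 : I 1 = 0 := by
    funext v
    simp only [I, DT_one, zero_apply, zero_mul, integral_zero, Pi.zero_apply]
  simpa [H, J, hI1] using key


/-! ### Uniqueness -/

lemma determ {T : ℝ} {d : ℕ} (hT : 0 ≤ T) {b : ℝ → Torus d → Vec d}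
    {η : Measure (PathSpace T d)} [IsProbabilityMeasure η]
    (hb : Measurable (Function.uncurry b))
    (hc : ∀ᵐ γ ∂η, IsIntegralCurveOf hT b γ)
    (hm : ∀ r, η.map (fun γ => extendPath hT γ r) = volume)
    (hbI : ∫⁻ t in Ioc 0 T, ∫⁻ x, ‖b t x‖ₑ < ∞)
    {V : ℝ → ℝ≥0∞}
    (hV : ∀ᵐ r ∂(volume.restrict (Ioc 0 T)), Integrable (b r) ∧ ∃ μ N, μ univ = V r ∧ BVData (b r) μ N)
    {r : ℝ} (hr0 : 0 ≤ r) (hrT : r ≤ T) (hVf : ∫⁻ r in Ioc r T, V r < ∞)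
    {B : Set (Torus d)} (hB : MeasurableSet B) :
    ∃ C : Set (Torus d), MeasurableSet C ∧
      (fun γ => extendPath hT γ r) ⁻¹' B =ᵐ[η] (fun γ => extendPath hT γ T) ⁻¹' C := by
  have hE := measurable_extend' (d := d) hT
  set A := (fun γ : PathSpace T d => extendPath hT γ r) ⁻¹' B with hA
  have hAm : MeasurableSet A := hE r hB
  set lam := η.restrict A with hlam
  have hle : ∀ v, lam.map (fun γ => extendPath hT γ v) ≤ volume := fun v => by
    rw [← hm v]; exact Measure.map_mono Measure.restrict_le_self (hE v)
  choose u hu hu0 hu1 hmu using fun v =>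
    exists_density (volume : Measure (Torus d)) (lam.map (fun γ => extendPath hT γ v)) (hle v)
  have hcl : ∀ᵐ γ ∂lam, IsIntegralCurveOf hT b γ := ae_restrict_of_ae hc
  have hren := renorm hT hb hcl hu hu0 hu1 hmu hbI hV hr0 hrT le_rfl hVf
  have hui : ∀ v, Integrable (u v) := fun v =>
    (integrable_const (1:ℝ)).mono' (hu v).aestronglyMeasurable (ae_of_all _ fun x => by
      rw [Real.norm_eq_abs, abs_of_nonneg (hu0 v x)]; exact hu1 v x)
  have hmass : ∀ v, ∫ x, u v x = η.real A := by
    intro v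
    rw [integral_eq_lintegral_of_nonneg_ae (ae_of_all _ (hu0 v)) (hu v).aestronglyMeasurable,
      ← setLIntegral_univ, ← withDensity_apply _ MeasurableSet.univ, ← hmu v,
      Measure.map_apply (hE v) MeasurableSet.univ]
    simp [hlam, Measure.real]
  -- at time `r`
  have hur : ∀ᵐ x, u r x * u r x = u r x := by
    have h1 : (volume : Measure (Torus d)).withDensity (fun x => ENNReal.ofReal (u r x)) =
        volume.withDensity (B.indicator 1) := by
      rw [← hmu r, withDensity_indicator_one hB]
      rw [hlam, ← Measure.restrict_map (hE r) hB, hm r]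
    rw [withDensity_eq_iff_of_sigmaFinite (hu r).ennreal_ofReal.aemeasurable
      (measurable_one.indicator hB).aemeasurable] at h1
    filter_upwards [h1] with x hx
    by_cases hxB : x ∈ B
    · have : u r x = 1 := by simpa [hxB] using hx
      rw [this, one_mul]
    · have : u r x ≤ 0 := by simpa [hxB] using hx
      rw [le_antisymm this (hu0 r x), mul_zero]
  have huu : ∀ v, Integrable (fun x => u v x * u v x) := fun v =>
    int_mul_bdd (hui v) (hu v).aestronglyMeasurable (C := 1)
      fun x => by rw [abs_of_nonneg (hu0 v x)]; exact hu1 v x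
  have hdiff : ∫ x, (u T x - u T x * u T x) = 0 := by
    rw [integral_sub (hui T) (huu T), ← hren, integral_congr_ae hur, hmass, hmass, sub_self]
  have h01 : ∀ᵐ x, u T x - u T x * u T x = 0 :=
    (integral_eq_zero_iff_of_nonneg (fun x => by
      simp only [Pi.zero_apply, Pi.sub_apply]; nlinarith [hu0 T x, hu1 T x]) ((hui T).sub (huu T))).1 hdiff
  set C : Set (Torus d) := {x | u T x ≠ 0} with hC
  have hCm : MeasurableSet C := (hu T (measurableSet_singleton 0)).compl
  refine ⟨C, hCm, ?_⟩
  have hsub : A ≤ᵐ[η] (fun γ => extendPath hT γ T) ⁻¹' C := by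
    have h1 : lam ((fun γ => extendPath hT γ T) ⁻¹' Cᶜ) = 0 := by
      rw [← Measure.map_apply (hE T) hCm.compl, hmu T, withDensity_apply _ hCm.compl]
      rw [setLIntegral_congr_fun hCm.compl (g := fun _ => 0)]
      · simp
      · intro x hx
        have : u T x = 0 := by simpa [hC] using hx
        simp [this]
    have h2 : ∀ᵐ γ ∂lam, extendPath hT γ T ∈ C := by
      rw [ae_iff]; exact h1
    exact (ae_restrict_iff' hAm).1 h2
  refine ae_eq_of_ae_subset_of_measure_ge hsub ?_ hAm.nullMeasurableSet (measure_ne_top _ _)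
  rw [← Measure.map_apply (hE T) hCm, hm T]
  have : (volume : Measure (Torus d)).real C = η.real A := by
    rw [← hmass T, ← integral_indicator_one hCm]
    refine integral_congr_ae ?_
    filter_upwards [h01] with x hx
    by_cases hxC : x ∈ C
    · have h5 : u T x * (1 - u T x) = 0 := by rw [← hx]; ring
      rcases mul_eq_zero.1 h5 with h | h
      · exact absurd h hxC
      · simp [hxC]; linarith
    · have : u T x = 0 := by simpa [hC] using hxC
      simp [hxC, this]
  exact ((measureReal_eq_measureReal_iff).1 this).le

lemma path_ext {T : ℝ} {d : ℕ} (hT : 0 < T) {γ₁ γ₂ : PathSpace T d}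
    (h : ∀ q : ℚ, (q : ℝ) ∈ Ioo 0 T → extendPath hT.le γ₁ q = extendPath hT.le γ₂ q) : γ₁ = γ₂ := by
  have hc : ∀ γ : PathSpace T d, Continuous (extendPath hT.le γ) := fun γ =>
    γ.continuous.comp continuous_projIcc
  have hcl : IsClosed {s | extendPath hT.le γ₁ s = extendPath hT.le γ₂ s} :=
    isClosed_eq (hc _) (hc _)
  have h1 : Ioo 0 T ∩ range ((↑) : ℚ → ℝ) ⊆ {s | extendPath hT.le γ₁ s = extendPath hT.le γ₂ s} := by
    rintro s ⟨hs, q, rfl⟩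
    exact h q hs
  have h2 : Icc 0 T ⊆ {s | extendPath hT.le γ₁ s = extendPath hT.le γ₂ s} := by
    rw [← closure_Ioo hT.ne]
    refine closure_minimal ?_ hcl
    exact (Dense.open_subset_closure_inter Rat.denseRange_cast isOpen_Ioo).trans
      (closure_minimal h1 hcl)
  ext1 t
  have := h2 t.2
  simpa [extendPath] using this

lemma measure_ext_path {T : ℝ} {d : ℕ} (hT : 0 < T) {η₁ η₂ : Measure (PathSpace T d)}
    [IsProbabilityMeasure η₁] [IsProbabilityMeasure η₂]
    (h : ∀ (s : Finset {q : ℚ // (q : ℝ) ∈ Ioo 0 T}) (B : {q : ℚ // (q : ℝ) ∈ Ioo 0 T} → Set (Torus d)),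
      (∀ q, MeasurableSet (B q)) →
      η₁ (⋂ q ∈ s, (fun γ => extendPath hT.le γ q) ⁻¹' B q) =
      η₂ (⋂ q ∈ s, (fun γ => extendPath hT.le γ q) ⁻¹' B q)) : η₁ = η₂ := by
  let Φ : PathSpace T d → ({q : ℚ // (q : ℝ) ∈ Ioo 0 T} → Torus d) :=
    fun γ q => extendPath hT.le γ q
  have hΦ : Measurable Φ := measurable_pi_lambda _ fun q => measurable_extend' hT.le _
  have hinj : Function.Injective Φ := fun γ₁ γ₂ h12 =>
    path_ext hT fun q hq => congrFun h12 ⟨q, hq⟩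
  have hemb : MeasurableEmbedding Φ := hΦ.measurableEmbedding hinj
  have hmap : η₁.map Φ = η₂.map Φ := by
    have : IsProbabilityMeasure (η₁.map Φ) := Measure.isProbabilityMeasure_map hΦ.aemeasurable
    have : IsProbabilityMeasure (η₂.map Φ) := Measure.isProbabilityMeasure_map hΦ.aemeasurable
    refine ext_of_generate_finite _ (generateFrom_squareCylinders).symm
      (isPiSystem_squareCylinders (fun _ => MeasurableSpace.isPiSystem_measurableSet)
        fun _ => by simp) ?_ (by simp)
    rintro S ⟨s, B, hB, rfl⟩
    have hBm : ∀ q, MeasurableSet (B q) := fun q => hB q trivial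
    have hm : MeasurableSet ((s : Set {q : ℚ // (q : ℝ) ∈ Ioo 0 T}).pi B) :=
      MeasurableSet.pi s.countable_toSet fun q _ => hBm q
    have hpre : Φ ⁻¹' ((s : Set {q : ℚ // (q : ℝ) ∈ Ioo 0 T}).pi B) =
        ⋂ q ∈ s, (fun γ => extendPath hT.le γ q) ⁻¹' B q := by
      ext γ; simp [Φ, Set.mem_pi]
    rw [Measure.map_apply hΦ hm, Measure.map_apply hΦ hm, hpre]
    exact h s B hBm
  rw [← hemb.comap_map η₁, hmap, hemb.comap_map]

lemma unique_core {T : ℝ} {d : ℕ} (hT : 0 < T) {b : ℝ → Torus d → Vec d}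
    {η₁ η₂ : Measure (PathSpace T d)} [IsProbabilityMeasure η₁] [IsProbabilityMeasure η₂]
    (hb : Measurable (Function.uncurry b))
    (hc1 : ∀ᵐ γ ∂η₁, IsIntegralCurveOf hT.le b γ)
    (hc2 : ∀ᵐ γ ∂η₂, IsIntegralCurveOf hT.le b γ)
    (hm1 : ∀ r, η₁.map (fun γ => extendPath hT.le γ r) = volume)
    (hm2 : ∀ r, η₂.map (fun γ => extendPath hT.le γ r) = volume)
    (hbI : ∫⁻ t in Ioc 0 T, ∫⁻ x, ‖b t x‖ₑ < ∞)
    {V : ℝ → ℝ≥0∞}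
    (hV : ∀ᵐ r ∂(volume.restrict (Ioc 0 T)), Integrable (b r) ∧ ∃ μ N, μ univ = V r ∧ BVData (b r) μ N)
    (hVf : ∀ r ∈ Ioo 0 T, ∫⁻ r in Ioc r T, V r < ∞) : η₁ = η₂ := by
  set η : Measure (PathSpace T d) := (2⁻¹ : ℝ≥0∞) • (η₁ + η₂) with hη
  have h2 : (2⁻¹ : ℝ≥0∞) ≠ 0 := by simp
  have hac1 : η₁ ≪ η := Measure.AbsolutelyContinuous.trans
    (Measure.absolutelyContinuous_of_le (Measure.le_add_right le_rfl))
    (Measure.absolutelyContinuous_smul h2)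
  have hac2 : η₂ ≪ η := Measure.AbsolutelyContinuous.trans
    (Measure.absolutelyContinuous_of_le (Measure.le_add_left le_rfl))
    (Measure.absolutelyContinuous_smul h2)
  have hpr : IsProbabilityMeasure η := ⟨by
    simp [hη, ENNReal.inv_two_add_inv_two]⟩
  have hc : ∀ᵐ γ ∂η, IsIntegralCurveOf hT.le b γ :=
    Measure.ae_smul_measure (ae_add_measure_iff.2 ⟨hc1, hc2⟩) _
  have hE := measurable_extend' (d := d) hT.le
  have hm : ∀ r, η.map (fun γ => extendPath hT.le γ r) = volume := by
    intro r
    rw [hη, Measure.map_smul, Measure.map_add _ _ (hE r), hm1, hm2, ← two_smul ℝ≥0∞, smul_smul,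
      ENNReal.inv_mul_cancel (by simp) (by simp), one_smul]
  refine measure_ext_path hT fun s B hB => ?_
  choose C hCm hC using fun q : {q : ℚ // (q : ℝ) ∈ Ioo 0 T} =>
    determ hT.le hb hc hm hbI hV q.2.1.le q.2.2.le (hVf q q.2) (hB q)
  have key : (⋂ q ∈ s, (fun γ => extendPath hT.le γ q) ⁻¹' B q : Set (PathSpace T d)) =ᵐ[η]
      (⋂ q ∈ s, (fun γ => extendPath hT.le γ T) ⁻¹' C q : Set (PathSpace T d)) :=
    Filter.EventuallyEq.countable_bInter s.countable_toSet fun q _ => hC q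
  have hpre : (⋂ q ∈ s, (fun γ => extendPath hT.le γ T) ⁻¹' C q : Set (PathSpace T d)) =
      (fun γ => extendPath hT.le γ T) ⁻¹' (⋂ q ∈ s, C q) := by
    simp only [preimage_iInter]
  have hCm' : MeasurableSet (⋂ q ∈ s, C q) := s.measurableSet_biInter fun q _ => hCm q
  rw [measure_congr (hac1.ae_eq key), measure_congr (hac2.ae_eq key), hpre,
    ← Measure.map_apply (hE T) hCm', ← Measure.map_apply (hE T) hCm', hm1, hm2]


/-! ### Integrability consequences of the Prodi-Serrin condition -/

lemma ps_time {T : ℝ} {d : ℕ} {b : ℝ → Torus d → Vec d} (hb : Measurable (Function.uncurry b))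
    {p q r : ℝ≥0∞} (hr : r ≤ p) (hq : 2 ≤ q) (h : MemLqLp T d p q b) :
    ∫⁻ t in Ioc 0 T, (eLpNorm (b t) r volume) ^ 2 < ∞ := by
  have hbm : ∀ t, Measurable (b t) := fun t => hb.comp (measurable_const.prodMk measurable_id)
  have hle : ∀ t, eLpNorm (b t) r volume ≤ eLpNorm (b t) p volume := fun t =>
    eLpNorm_le_eLpNorm_of_exponent_le hr (hbm t).aestronglyMeasurable
  rw [setLIntegral_congr Ioo_ae_eq_Ioc.symm]
  by_cases hq' : q = ∞
  · have h1 := h.2 hq'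
    set M := essSup (fun t => eLpNorm (b t) p (volume : Measure (Torus d)))
      (volume.restrict (Set.Ioo 0 T)) with hM
    have h2 : ∀ᵐ t ∂(volume.restrict (Ioo 0 T)), (eLpNorm (b t) r volume) ^ 2 ≤ M ^ 2 := by
      filter_upwards [ENNReal.ae_le_essSup (μ := volume.restrict (Ioo 0 T))
        (fun t => eLpNorm (b t) p (volume : Measure (Torus d)))] with t ht
      gcongr
      exact (hle t).trans ht
    refine (lintegral_mono_ae h2).trans_lt ?_
    simp only [lintegral_const, Measure.restrict_apply MeasurableSet.univ, univ_inter, Real.volume_Ioo]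
    exact ENNReal.mul_lt_top (ENNReal.pow_lt_top h1) ENNReal.ofReal_lt_top
  · have h1 := h.1 hq'
    have hq2 : (2:ℝ) ≤ q.toReal := by
      have := ENNReal.toReal_mono hq' hq
      simpa using this
    have h2 : ∀ t, (eLpNorm (b t) r volume) ^ 2 ≤ 1 + (eLpNorm (b t) p volume) ^ q.toReal := by
      intro t
      refine (pow_le_pow_left' (hle t) 2).trans ?_
      rcases le_total (eLpNorm (b t) p volume) 1 with h3 | h3
      · exact (pow_le_one' h3 2).trans le_self_add
      · refine le_trans ?_ le_add_self
        rw [← ENNReal.rpow_natCast]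
        exact ENNReal.rpow_le_rpow_of_exponent_le h3 (by simpa using hq2)
    refine (lintegral_mono h2).trans_lt ?_
    rw [lintegral_add_left measurable_const]
    refine ENNReal.add_lt_top.2 ⟨?_, h1⟩
    simp

/-- In dimension one, divergence-free fields are constant. -/
lemma const_of_divFree_one {w : Torus 1 → Vec 1} (hw : Measurable w) (hwi : Integrable w)
    (hdiv : ∀ ψ : Torus 1 → ℝ, SmoothT ψ → ∫ y, DT ψ y (w y) = 0) :
    ∃ c : Vec 1, w =ᵐ[volume] fun _ => c := by
  have hWD : IsWeakDer w (0 : Measure (Torus 1)) (fun _ => 0) := by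
    intro a z ψ hψ
    simp only [integral_zero_measure, neg_zero]
    have h1 : ∀ v : Vec 1, v = v 0 • EuclideanSpace.single 0 1 := by
      intro v; ext i; fin_cases i; simp
    have h2 : ∀ y, a (w y) * DT ψ y z = (a (EuclideanSpace.single 0 1) * z 0) * DT ψ y (w y) := by
      intro y
      rw [h1 (w y), h1 z]
      simp only [map_smul, smul_eq_mul]
      simp
      ring
    simp_rw [h2]
    rw [integral_const_mul, hdiv ψ hψ, mul_zero]
  obtain ⟨D, -, hDs, -, hDd⟩ := exists_countable_smooth 1
  let f : Torus 1 → ℝ := fun y => w y 0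
  have hfm : Measurable f := (EuclideanSpace.proj (𝕜 := ℝ) (0 : Fin 1)).continuous.measurable.comp hw
  have hfi : Integrable f := (EuclideanSpace.proj (𝕜 := ℝ) (0 : Fin 1)).integrable_comp hwi
  -- translation invariance against smooth functions
  have htr : ∀ ξ : Torus 1 → ℝ, SmoothT ξ → ∀ z : Torus 1, ∫ x, ξ x * f x = ∫ x, ξ x * f (x - z) := by
    intro ξ hξ z
    have := test_diff hwi hWD (EuclideanSpace.proj (𝕜 := ℝ) (0 : Fin 1)) (liftT 1 z) hξ
    simp only [integral_zero_measure, integral_zero, projT_liftT] at this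
    obtain ⟨C, _, hC⟩ := cont_bdd hξ.continuous
    have hi1 : Integrable fun x => ξ x * f x := by
      simp_rw [mul_comm (ξ _)]
      exact int_mul_bdd hfi hξ.continuous.measurable.aestronglyMeasurable hC
    have hi2 : Integrable fun x => ξ x * f (x - z) := by
      simp_rw [mul_comm (ξ _)]
      exact int_mul_bdd (hfi.comp_sub_right z) hξ.continuous.measurable.aestronglyMeasurable hC
    rw [← sub_eq_zero, ← integral_sub hi1 hi2, ← this]
    refine integral_congr_ae (ae_of_all _ fun x => ?_)
    simp [f, mul_sub]
  set m := ∫ x, f x with hm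
  have hmean : ∀ ξ : Torus 1 → ℝ, SmoothT ξ → ∫ x, ξ x * (f x - m) = 0 := by
    intro ξ hξ
    have hξi : Integrable ξ := integrable_cont _ hξ.continuous
    obtain ⟨C, hC0, hC⟩ := cont_bdd hξ.continuous
    have hpi : Integrable (fun q : Torus 1 × Torus 1 => ξ q.1 * f (q.1 + q.2)) (volume.prod volume) := by
      have hmeas : Measurable (fun q : Torus 1 × Torus 1 => ξ q.1 * f (q.1 + q.2)) :=
        (hξ.continuous.measurable.comp measurable_fst).mul (hfm.comp measurable_add)
      rw [integrable_prod_iff hmeas.aestronglyMeasurable]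
      refine ⟨ae_of_all _ fun x => by exact (hfi.comp_add_left x).const_mul (ξ x), ?_⟩
      have h3 : ∀ x, ∫ y, ‖ξ x * f (x + y)‖ = ‖ξ x‖ * ∫ y, ‖f y‖ := by
        intro x
        simp_rw [norm_mul]
        rw [integral_const_mul, integral_add_left_eq_self (fun y => ‖f y‖) x]
      simp_rw [h3]
      exact hξi.norm.mul_const _
    have h1 : ∫ z : Torus 1, ∫ x, ξ x * f (x + z) = ∫ x, ξ x * m := by
      rw [integral_integral_swap (f := fun z x => ξ x * f (x + z)) (by exact hpi.swap)]
      refine integral_congr_ae (ae_of_all _ fun x => ?_)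
      simp only
      rw [integral_const_mul, integral_add_left_eq_self f x]
    have h2 : ∫ z : Torus 1, ∫ x, ξ x * f (x + z) = ∫ x, ξ x * f x := by
      have : ∀ z : Torus 1, ∫ x, ξ x * f (x + z) = ∫ x, ξ x * f x := by
        intro z
        rw [htr ξ hξ (-z)]
        simp
      simp_rw [this]
      simp
    simp_rw [mul_sub]
    rw [integral_sub, ← h1, h2, sub_self]
    · simp_rw [mul_comm (ξ _)]
      exact int_mul_bdd hfi hξ.continuous.measurable.aestronglyMeasurable hC
    · exact hξi.mul_const _
  have h4 := dual_le volume (0 : Measure (Torus 1)) (f := fun x => f x - m) (hfm.sub_const m)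
    (hfi.sub (integrable_const m)) (fun ξ hξ => by rw [hmean ξ hξ]; simp)
  have h5 : (volume : Measure (Torus 1)).withDensity (fun y => ‖f y - m‖ₑ) = 0 :=
    le_antisymm h4 (Measure.zero_le _)
  rw [withDensity_eq_zero_iff (hfm.sub_const m).enorm.aemeasurable] at h5
  refine ⟨EuclideanSpace.single 0 m, ?_⟩
  filter_upwards [h5] with x hx
  have hx' : f x - m = 0 := by simpa using hx
  ext i
  fin_cases i
  simpa [f] using sub_eq_zero.1 hx'

lemma ps_exponents {d : ℕ} {p q : ℝ≥0∞} (hpq : (d : ℝ≥0∞) / p + 2 / q < 1) :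
    2 ≤ q ∧ (d : ℝ≥0∞) ≤ p := by
  constructor
  · by_contra hlt
    push Not at hlt
    have : (1 : ℝ≥0∞) ≤ 2 / q := by
      rw [ENNReal.le_div_iff_mul_le (Or.inr (by simp)) (Or.inr (by simp)), one_mul]
      exact hlt.le
    exact absurd (hpq.trans_le (this.trans le_add_self)) (lt_irrefl _)
  · by_contra hlt
    push Not at hlt
    have : (1 : ℝ≥0∞) ≤ d / p := by
      by_cases hp0 : p = 0
      · subst hp0
        rw [ENNReal.div_zero (by intro h; simp [h] at hlt)]
        simp
      rw [ENNReal.le_div_iff_mul_le (Or.inl hp0) (Or.inr (by simp)), one_mul]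
      exact hlt.le
    exact absurd (hpq.trans_le (this.trans le_self_add)) (lt_irrefl _)

lemma divFree_ae {T : ℝ} {d : ℕ} {b : ℝ → Torus d → Vec d} (hb : Measurable (Function.uncurry b))
    (hdiv : DivergenceFree T d b) : ∀ᵐ t ∂(volume.restrict (Ioc 0 T)),
      ∀ ψ : Torus d → ℝ, SmoothT ψ → ∫ y, DT ψ y (b t y) = 0 := by
  have hdiv' := hdiv
  unfold DivergenceFree at hdiv'
  rw [Measure.restrict_congr_set Ioo_ae_eq_Ioc] at hdiv'
  filter_upwards [hdiv'] with t ht ψ hψ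
  exact divFree_torus (hb.comp (measurable_const.prodMk measurable_id)) ht hψ

lemma ps_L1 {T : ℝ} {d : ℕ} {b : ℝ → Torus d → Vec d} (hb : Measurable (Function.uncurry b))
    {p q : ℝ≥0∞} (hp : 1 < p) (hpq : (d : ℝ≥0∞) / p + 2 / q < 1) (h : MemLqLp T d p q b) :
    ∫⁻ t in Ioc 0 T, ∫⁻ x, ‖b t x‖ₑ < ∞ := by
  have h1 := ps_time hb hp.le (ps_exponents hpq).1 h
  have h2 : ∀ t, ∫⁻ x, ‖b t x‖ₑ ≤ 1 + (eLpNorm (b t) 1 volume) ^ 2 := by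
    intro t
    rw [← eLpNorm_one_eq_lintegral_enorm]
    rcases le_total (eLpNorm (b t) 1 volume) 1 with h3 | h3
    · exact h3.trans le_self_add
    · refine le_trans ?_ le_add_self
      exact le_self_pow₀ h3 (by norm_num)
  refine (lintegral_mono h2).trans_lt ?_
  rw [lintegral_add_left measurable_const]
  exact ENNReal.add_lt_top.2 ⟨by simp, h1⟩

lemma ps_int {T : ℝ} {d : ℕ} {b : ℝ → Torus d → Vec d} (hb : Measurable (Function.uncurry b))
    (hbI : ∫⁻ t in Ioc 0 T, ∫⁻ x, ‖b t x‖ₑ < ∞) :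
    ∀ᵐ t ∂(volume.restrict (Ioc 0 T)), Integrable (b t) := by
  have hm : Measurable fun t => ∫⁻ x, ‖b t x‖ₑ := by
    exact Measurable.lintegral_prod_right' (f := fun q : ℝ × Torus d => ‖b q.1 q.2‖ₑ) (by exact hb.enorm)
  filter_upwards [ae_lt_top hm hbI.ne] with t ht
  exact ⟨(hb.comp (measurable_const.prodMk measurable_id)).aestronglyMeasurable, ht⟩

lemma ps_L2 {T : ℝ} {d : ℕ} {b : ℝ → Torus d → Vec d} (hb : Measurable (Function.uncurry b))
    (hdiv : DivergenceFree T d b)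
    {p q : ℝ≥0∞} (hp : 1 < p) (hpq : (d : ℝ≥0∞) / p + 2 / q < 1) (h : MemLqLp T d p q b) :
    ∫⁻ t in Ioc 0 T, ∫⁻ x, ‖b t x‖ₑ ^ 2 < ∞ := by
  have hq := (ps_exponents hpq).1
  have hdp := (ps_exponents hpq).2
  have h2 : ∀ t, ∫⁻ x, ‖b t x‖ₑ ^ 2 = (eLpNorm (b t) 2 volume) ^ 2 := by
    intro t
    rw [eLpNorm_eq_lintegral_rpow_enorm_toReal (by simp) (by simp), ← ENNReal.rpow_natCast,
      ← ENNReal.rpow_mul]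
    simp
  simp_rw [h2]
  by_cases hd2 : 2 ≤ d
  · exact ps_time hb (le_trans (by exact_mod_cast hd2) hdp) hq h
  by_cases hd1 : d = 1
  · subst hd1
    refine lt_of_le_of_lt (lintegral_mono_ae ?_) (ps_time hb hp.le hq h)
    filter_upwards [divFree_ae hb hdiv, ps_int hb (ps_L1 hb hp hpq h)] with t ht hti
    obtain ⟨c, hc⟩ := const_of_divFree_one (w := b t) (hb.comp (measurable_const.prodMk measurable_id)) hti ht
    rw [eLpNorm_congr_ae (p := 2) hc, eLpNorm_congr_ae (p := 1) hc,
      eLpNorm_const _ (by simp) (NeZero.ne _), eLpNorm_const _ (by simp) (NeZero.ne _)]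
    simp
  · have hd0 : d = 0 := by omega
    subst hd0
    have : ∀ t, b t = 0 := fun t => by ext x i; exact i.elim0
    simp [this]

lemma bv_ae {T : ℝ} {d : ℕ} {b : ℝ → Torus d → Vec d} (hb : Measurable (Function.uncurry b))
    (hdiv : DivergenceFree T d b) (hbI : ∫⁻ t in Ioc 0 T, ∫⁻ x, ‖b t x‖ₑ < ∞)
    (hBV : MemL1locBVIoc T d b) : ∃ V : ℝ → ℝ≥0∞,
      (∀ᵐ r ∂(volume.restrict (Ioc 0 T)), Integrable (b r) ∧ ∃ μ N, μ univ = V r ∧ BVData (b r) μ N) ∧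
      ∀ r ∈ Ioo 0 T, ∫⁻ r in Ioc r T, V r < ∞ := by
  obtain ⟨Dp, Dm, h1, h2⟩ := hBV
  refine ⟨fun t => ∑ i, ∑ j, (Dp t i j univ + Dm t i j univ), ?_, h2⟩
  filter_upwards [h1, ps_int hb hbI, divFree_ae hb hdiv] with r hr1 hr2 hr3
  obtain ⟨μ, N, a1, a2, a3, a4, a5, a6⟩ :=
    exists_weakDer (hb.comp (measurable_const.prodMk measurable_id)) hr2 hr3 hr1
  exact ⟨hr2, μ, N, a2, a1, a3, a4, a5, a6⟩


/-! ### Shear maps -/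

lemma shear_mp_int {d : ℕ} (g : Torus d → ℤ) (hg : Measurable g) (τ : ℤ → Torus d)
    (hinv : ∀ j x, g (x + τ j) = g x) :
    MeasurePreserving (fun x : Torus d => x + τ (g x)) volume volume := by
  have hm : Measurable (fun x : Torus d => x + τ (g x)) :=
    measurable_id.add ((measurable_of_countable τ).comp hg)
  refine ⟨hm, ?_⟩
  ext E hE
  rw [Measure.map_apply hm hE]
  have hdec : ∀ F : Set (Torus d), MeasurableSet F → volume F = ∑' j, volume (g ⁻¹' {j} ∩ F) := by
    intro F hF
    rw [← measure_iUnion]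
    · congr 1
      ext x; simp
    · intro i j hij
      refine Set.disjoint_left.2 fun x hx hx' => hij ?_
      have h1 : g x = i := hx.1
      have h2 : g x = j := hx'.1
      rw [← h1, h2]
    · exact fun j => (hg (measurableSet_singleton j)).inter hF
  rw [hdec _ (hm hE), hdec E hE]
  congr 1; funext j
  have : g ⁻¹' {j} ∩ (fun x => x + τ (g x)) ⁻¹' E = (fun x => x + τ j) ⁻¹' (g ⁻¹' {j} ∩ E) := by
    ext x
    simp only [mem_inter_iff, mem_preimage, mem_singleton_iff, hinv]
    constructor
    · rintro ⟨rfl, h⟩; exact ⟨rfl, h⟩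
    · rintro ⟨rfl, h⟩; exact ⟨rfl, h⟩
  rw [this]
  exact measure_preimage_add_right _ _ _

lemma shear_mp {d : ℕ} {φ : Torus d → ℝ} (hφ : Measurable φ) (c : Vec d)
    (hinv : ∀ (s : ℝ) x, φ (x + projT d (s • c)) = φ x) :
    MeasurePreserving (fun x : Torus d => x + projT d (φ x • c)) volume volume := by
  have hm : Measurable (fun x : Torus d => x + projT d (φ x • c)) :=
    measurable_id.add (measurable_projT.comp (hφ.smul_const c))
  refine ⟨hm, ?_⟩
  have : IsFiniteMeasure (Measure.map (fun x : Torus d => x + projT d (φ x • c)) volume) :=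
    Measure.isFiniteMeasure_map _ _
  refine ext_of_forall_integral_eq_of_IsFiniteMeasure fun f => ?_
  rw [integral_map hm.aemeasurable f.continuous.aestronglyMeasurable]
  let S : ℕ → Torus d → Torus d := fun n x =>
    x + projT d (((⌊((n:ℝ) + 1) * φ x⌋ : ℝ) / ((n:ℝ) + 1)) • c)
  have hS : ∀ n, MeasurePreserving (S n) volume volume := fun n =>
    shear_mp_int (fun x => ⌊((n:ℝ) + 1) * φ x⌋) (Int.measurable_floor.comp (hφ.const_mul _))
      (fun j => projT d (((j : ℝ) / ((n:ℝ) + 1)) • c)) (fun j x => by simp only [hinv])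
  have hlim : ∀ x, Tendsto (fun n => f (S n x)) atTop (𝓝 (f (x + projT d (φ x • c)))) := by
    intro x
    refine (f.continuous.tendsto _).comp (tendsto_const_nhds.add
      ((continuous_projT.tendsto _).comp (Tendsto.smul_const ?_ c)))
    rw [tendsto_iff_dist_tendsto_zero]
    refine squeeze_zero (fun _ => dist_nonneg) (fun n => ?_) tendsto_one_div_add_atTop_nhds_zero_nat
    rw [Real.dist_eq]
    have hn : (0:ℝ) < (n:ℝ) + 1 := by positivity
    have h1 := Int.floor_le (((n:ℝ) + 1) * φ x)
    have h2 := Int.lt_floor_add_one (((n:ℝ) + 1) * φ x)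
    rw [abs_le]
    constructor
    · rw [neg_le_sub_iff_le_add, ← add_div, le_div_iff₀ hn]; nlinarith
    · have h3 : 1 / ((n:ℝ) + 1) * ((n:ℝ) + 1) = 1 := one_div_mul_cancel hn.ne'
      rw [sub_le_iff_le_add, div_le_iff₀ hn]; nlinarith
  have hIntg : ∀ n, ∫ x, f (S n x) = ∫ x, f x := fun n => by
    rw [← (hS n).map_eq, integral_map (hS n).measurable.aemeasurable
      f.continuous.aestronglyMeasurable, (hS n).map_eq]
  have := tendsto_integral_of_dominated_convergence (μ := (volume : Measure (Torus d)))
    (F := fun n x => f (S n x)) (fun _ => ‖f‖)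
    (fun n => (f.continuous.measurable.comp (hS n).measurable).aestronglyMeasurable)
    (integrable_const _) (fun n => ae_of_all _ fun x => f.norm_coe_le_norm _) (ae_of_all _ hlim)
  simp_rw [hIntg] at this
  exact tendsto_nhds_unique this tendsto_const_nhds

/-- Fields that are approximated by measure-preserving one-step maps. -/
def NiceField {d : ℕ} (f : ℝ → Torus d → Vec d) : Prop :=
  UniformContinuous (Function.uncurry f) ∧ (∃ M : ℝ, ∀ t y, ‖f t y‖ ≤ M) ∧
  ∀ ε : ℝ, 0 < ε → ∃ h₀ : ℝ, 0 < h₀ ∧ ∀ h : ℝ, 0 < h → h ≤ h₀ →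
    ∃ D : ℝ → Torus d → Vec d, (∀ t, Measurable (D t)) ∧
      (∀ t, MeasurePreserving (fun y => y + projT d (h • D t y)) volume volume) ∧
      ∀ t y, ‖D t y - f t y‖ ≤ ε

lemma NiceField.zero {d : ℕ} : NiceField (fun _ _ => (0 : Vec d)) := by
  refine ⟨uniformContinuous_const, ⟨0, by simp⟩, fun ε hε => ⟨1, one_pos, fun h _ _ =>
    ⟨fun _ _ => 0, fun _ => measurable_const, fun _ => ?_, by simp [hε.le]⟩⟩⟩
  simp only [smul_zero, projT_zero, add_zero]
  exact MeasurePreserving.id _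

lemma NiceField.add {d : ℕ} {f g : ℝ → Torus d → Vec d} (hf : NiceField f) (hg : NiceField g) :
    NiceField (fun t y => f t y + g t y) := by
  obtain ⟨hf1, ⟨M, hM⟩, hf3⟩ := hf
  obtain ⟨hg1, ⟨M', hM'⟩, hg3⟩ := hg
  refine ⟨hf1.add hg1, ⟨M + M', fun t y => (norm_add_le _ _).trans (add_le_add (hM t y) (hM' t y))⟩,
    fun ε hε => ?_⟩
  have hM0 : 0 ≤ M := (norm_nonneg _).trans (hM 0 0)
  obtain ⟨δ, hδ, hgδ⟩ := Metric.uniformContinuous_iff.1 hg1 (ε / 3) (by positivity)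
  obtain ⟨h1, h10, H1⟩ := hf3 (ε / 3) (by positivity)
  obtain ⟨h2, h20, H2⟩ := hg3 (ε / 3) (by positivity)
  refine ⟨min (min h1 h2) (δ / (2 * (M + ε))), by positivity, fun h hh hle => ?_⟩
  obtain ⟨D, hDm, hDp, hD⟩ := H1 h hh (hle.trans ((min_le_left _ _).trans (min_le_left _ _)))
  obtain ⟨E, hEm, hEp, hE⟩ := H2 h hh (hle.trans ((min_le_left _ _).trans (min_le_right _ _)))
  refine ⟨fun t y => D t y + E t (y + projT d (h • D t y)), fun t =>
    (hDm t).add ((hEm t).comp (hDp t).measurable), fun t => ?_, fun t y => ?_⟩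
  · convert (hEp t).comp (hDp t) using 1
    funext y
    simp only [Function.comp, smul_add, projT_add, add_assoc]
  · set z := y + projT d (h • D t y) with hz
    have hzy : dist (t, z) (t, y) < δ := by
      rw [Prod.dist_eq, dist_self, max_eq_right dist_nonneg, dist_eq_norm, hz, add_sub_cancel_left]
      refine (norm_projT_le _).trans_lt ?_
      rw [norm_smul, Real.norm_eq_abs, abs_of_pos hh]
      have hDb : ‖D t y‖ ≤ M + ε := by
        have := norm_add_le (D t y - f t y) (f t y)
        rw [sub_add_cancel] at this
        linarith [hD t y, hM t y]
      have h5 : h ≤ δ / (2 * (M + ε)) := hle.trans (min_le_right _ _)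
      rw [le_div_iff₀ (by positivity)] at h5
      nlinarith [mul_le_mul_of_nonneg_left hDb hh.le]
    have h6 := (hgδ hzy).le
    rw [dist_eq_norm] at h6
    simp only [Function.uncurry] at h6
    calc ‖D t y + E t z - (f t y + g t y)‖ = ‖(D t y - f t y) + (E t z - g t z) + (g t z - g t y)‖ := by
          congr 1; abel
      _ ≤ ‖D t y - f t y‖ + ‖E t z - g t z‖ + ‖g t z - g t y‖ := norm_add₃_le
      _ ≤ ε / 3 + ε / 3 + ε / 3 := add_le_add (add_le_add (hD t y) (hE t z)) h6
      _ = ε := by ring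

lemma NiceField.shear {d : ℕ} {θ : ℝ → ℝ} (hθ : Continuous θ) (hθc : HasCompactSupport θ)
    {φ : Torus d → ℝ} (hφ : Continuous φ) (c : Vec d)
    (hinv : ∀ (s : ℝ) x, φ (x + projT d (s • c)) = φ x) :
    NiceField (fun t y => (θ t * φ y) • c) := by
  have hcont : Continuous (Function.uncurry fun t y => (θ t * φ y) • c) :=
    ((hθ.comp continuous_fst).mul (hφ.comp continuous_snd)).smul continuous_const
  have hcs : HasCompactSupport (Function.uncurry fun t y => (θ t * φ y) • c) := by
    refine HasCompactSupport.intro (K := tsupport θ ×ˢ univ) (hθc.prod isCompact_univ) ?_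
    rintro ⟨t, y⟩ hty
    have : θ t = 0 := image_eq_zero_of_notMem_tsupport (by simpa using hty)
    simp [Function.uncurry, this]
  refine ⟨HasCompactSupport.uniformContinuous_of_continuous hcs hcont, ?_, fun ε hε => ⟨1, one_pos, fun h _ _ =>
    ⟨fun t y => (θ t * φ y) • c, fun t => ((hφ.const_mul (θ t)).smul continuous_const).measurable,
      fun t => ?_, by simp [hε.le]⟩⟩⟩
  · obtain ⟨M, hM⟩ := hcs.exists_bound_of_continuous hcont
    exact ⟨M, fun t y => hM (t, y)⟩
  · have := shear_mp (φ := fun y => h * (θ t * φ y)) (((hφ.const_mul _).const_mul _).measurable) c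
      (fun s x => by simp only [hinv])
    simpa only [smul_smul] using this


/-! ### Fourier analysis on the torus -/

lemma parseval_haar {d : ℕ} {μ : Measure (Torus d)}
    (hμ : μ = Measure.pi (fun _ => (AddCircle.haarAddCircle : Measure (AddCircle (1:ℝ)))))
    {u v : Torus d → ℂ} (hu : MemLp u 2 μ) (hv : MemLp v 2 μ) :
    HasSum (fun k : Fin d → ℤ =>
      (starRingEnd ℂ) (∫ x, UnitAddTorus.mFourier (-k) x * u x ∂μ) *
        ∫ x, UnitAddTorus.mFourier (-k) x * v x ∂μ)
      (∫ x, (starRingEnd ℂ) (u x) * v x ∂μ) := by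
  subst hμ
  have h := UnitAddTorus.hasSum_prod_mFourierCoeff (d := Fin d) (MemLp.toLp u hu) (MemLp.toLp v hv)
  have hu' := MemLp.coeFn_toLp hu
  have hv' := MemLp.coeFn_toLp hv
  have h1 : ∫ x, (starRingEnd ℂ) (u x) * v x ∂(Measure.pi (fun _ => (AddCircle.haarAddCircle : Measure (AddCircle (1:ℝ)))))
      = ∫ x, (starRingEnd ℂ) ((MemLp.toLp u hu) x) * (MemLp.toLp v hv) x ∂(Measure.pi (fun _ => (AddCircle.haarAddCircle : Measure (AddCircle (1:ℝ))))) := by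
    refine integral_congr_ae ?_
    filter_upwards [hu', hv'] with x h1 h2
    rw [h1, h2]
  rw [h1]
  refine HasSum.congr_fun h fun k => ?_
  have e1 : ∀ {w : Torus d → ℂ} (hw : MemLp w 2 (Measure.pi (fun _ => (AddCircle.haarAddCircle : Measure (AddCircle (1:ℝ)))))),
    ∫ x, UnitAddTorus.mFourier (-k) x * w x ∂(Measure.pi (fun _ => (AddCircle.haarAddCircle : Measure (AddCircle (1:ℝ)))))
      = UnitAddTorus.mFourierCoeff (MemLp.toLp w hw) k := by
    intro w hw
    unfold UnitAddTorus.mFourierCoeff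
    refine integral_congr_ae ?_
    filter_upwards [MemLp.coeFn_toLp hw] with x hx
    rw [hx, smul_eq_mul]
  rw [e1 hu, e1 hv]

lemma parseval {d : ℕ} {u v : Torus d → ℂ} (hu : MemLp u 2 volume) (hv : MemLp v 2 volume) :
    HasSum (fun k : Fin d → ℤ =>
      (starRingEnd ℂ) (∫ x, UnitAddTorus.mFourier (-k) x * u x) *
        ∫ x, UnitAddTorus.mFourier (-k) x * v x)
      (∫ x, (starRingEnd ℂ) (u x) * v x) := by
  have hv0 : (volume : Measure (Torus d)) =
      Measure.pi (fun _ => (AddCircle.haarAddCircle : Measure (AddCircle (1:ℝ)))) := by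
    rw [volume_pi]
    congr 1; funext i
    rw [AddCircle.volume_eq_smul_haarAddCircle]; simp
  exact parseval_haar hv0 hu hv

lemma mFourier_projT {d : ℕ} (k : Fin d → ℤ) (x : Vec d) :
    UnitAddTorus.mFourier k (projT d x) =
      Complex.exp (((2 * Real.pi * ∑ i, (k i : ℝ) * x i : ℝ) : ℂ) * Complex.I) := by
  change ∏ i, fourier (k i) (projT d x i) = _
  simp_rw [projT_apply, fourier_coe_apply]
  rw [← Complex.exp_sum]
  congr 1
  push_cast
  rw [Finset.mul_sum, Finset.sum_mul]
  refine Finset.sum_congr rfl fun i _ => ?_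
  ring

/-- real trigonometric monomials -/
def cosT {d : ℕ} (k : Fin d → ℤ) (y : Torus d) : ℝ := (UnitAddTorus.mFourier k y).re
/-- real trigonometric monomials -/
def sinT {d : ℕ} (k : Fin d → ℤ) (y : Torus d) : ℝ := (UnitAddTorus.mFourier k y).im

/-- the phase `2π k·x` as a linear map -/
def phaseT {d : ℕ} (k : Fin d → ℤ) : Vec d →L[ℝ] ℝ :=
  (2 * Real.pi) • ∑ i, (k i : ℝ) • EuclideanSpace.proj (𝕜 := ℝ) i

lemma phaseT_apply {d : ℕ} (k : Fin d → ℤ) (x : Vec d) :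
    phaseT k x = 2 * Real.pi * ∑ i, (k i : ℝ) * x i := by
  simp [phaseT]

lemma cosT_projT {d : ℕ} (k : Fin d → ℤ) (x : Vec d) : cosT k (projT d x) = Real.cos (phaseT k x) := by
  rw [cosT, mFourier_projT, phaseT_apply, Complex.exp_ofReal_mul_I_re]

lemma sinT_projT {d : ℕ} (k : Fin d → ℤ) (x : Vec d) : sinT k (projT d x) = Real.sin (phaseT k x) := by
  rw [sinT, mFourier_projT, phaseT_apply, Complex.exp_ofReal_mul_I_im]

lemma smooth_cosT {d : ℕ} (k : Fin d → ℤ) : SmoothT (cosT (d := d) k) := by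
  unfold SmoothT
  simp_rw [cosT_projT]
  exact Real.contDiff_cos.comp (phaseT k).contDiff

lemma smooth_sinT {d : ℕ} (k : Fin d → ℤ) : SmoothT (sinT (d := d) k) := by
  unfold SmoothT
  simp_rw [sinT_projT]
  exact Real.contDiff_sin.comp (phaseT k).contDiff

lemma DT_cosT {d : ℕ} (k : Fin d → ℤ) (y : Torus d) (v : Vec d) :
    DT (cosT k) y v = - sinT k y * phaseT k v := by
  conv_lhs => rw [← projT_liftT y]
  rw [DT_projT]
  simp_rw [cosT_projT]
  rw [((phaseT k).hasFDerivAt.cos).fderiv]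
  conv_rhs => rw [← projT_liftT y, sinT_projT]
  simp

lemma DT_sinT {d : ℕ} (k : Fin d → ℤ) (y : Torus d) (v : Vec d) :
    DT (sinT k) y v = cosT k y * phaseT k v := by
  conv_lhs => rw [← projT_liftT y]
  rw [DT_projT]
  simp_rw [sinT_projT]
  rw [((phaseT k).hasFDerivAt.sin).fderiv]
  conv_rhs => rw [← projT_liftT y, cosT_projT]
  simp

lemma cosT_inv {d : ℕ} (k : Fin d → ℤ) (c : Vec d) (hc : ∑ i, (k i : ℝ) * c i = 0) (s : ℝ)
    (y : Torus d) : cosT k (y + projT d (s • c)) = cosT k y := by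
  conv_lhs => rw [← projT_liftT y, ← projT_add, cosT_projT, map_add, map_smul, phaseT_apply k c, hc]
  conv_rhs => rw [← projT_liftT y, cosT_projT]
  simp

lemma sinT_inv {d : ℕ} (k : Fin d → ℤ) (c : Vec d) (hc : ∑ i, (k i : ℝ) * c i = 0) (s : ℝ)
    (y : Torus d) : sinT k (y + projT d (s • c)) = sinT k y := by
  conv_lhs => rw [← projT_liftT y, ← projT_add, sinT_projT, map_add, map_smul, phaseT_apply k c, hc]
  conv_rhs => rw [← projT_liftT y, sinT_projT]
  simp

lemma mFourier_eq_cs {d : ℕ} (k : Fin d → ℤ) (y : Torus d) :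
    UnitAddTorus.mFourier k y = (cosT k y : ℂ) + (sinT k y : ℂ) * Complex.I :=
  (Complex.re_add_im _).symm

lemma four_zero {d : ℕ} {f : Torus d → ℝ} (hf : Integrable f) (k : Fin d → ℤ)
    (h1 : ∫ y, cosT k y * f y = 0) (h2 : ∫ y, sinT k y * f y = 0) :
    ∫ y, UnitAddTorus.mFourier k y * (f y : ℂ) = 0 := by
  have e : ∀ y, UnitAddTorus.mFourier k y * (f y : ℂ) =
      ((cosT k y * f y : ℝ) : ℂ) + ((sinT k y * f y : ℝ) : ℂ) * Complex.I := by
    intro y; rw [mFourier_eq_cs]; push_cast; ring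
  simp_rw [e]
  obtain ⟨C, -, hC⟩ := cont_bdd (smooth_cosT (d := d) k).continuous
  obtain ⟨C', -, hC'⟩ := cont_bdd (smooth_sinT (d := d) k).continuous
  have i1 : Integrable (fun y => cosT k y * f y) :=
    hf.bdd_mul (smooth_cosT k).continuous.aestronglyMeasurable (ae_of_all _ hC)
  have i2 : Integrable (fun y => sinT k y * f y) :=
    hf.bdd_mul (smooth_sinT k).continuous.aestronglyMeasurable (ae_of_all _ hC')
  rw [integral_add i1.ofReal (i2.ofReal.mul_const _), integral_mul_const, integral_complex_ofReal, integral_complex_ofReal,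
    h1, h2]
  simp

/-- Divergence-free fields are orthogonal to fields whose Fourier coefficients are parallel
to the frequency. -/
lemma four_orth {d : ℕ} {u v : Torus d → Vec d} (hu : MemLp u 2 volume) (hv : MemLp v 2 volume)
    (hdu : ∀ ψ : Torus d → ℝ, SmoothT ψ → ∫ y, DT ψ y (u y) = 0)
    (hdv : ∀ k c : Fin d → ℤ, ∑ i, k i * c i = 0 →
      (∫ y, cosT k y * ∑ i, (c i : ℝ) * v y i = 0) ∧ (∫ y, sinT k y * ∑ i, (c i : ℝ) * v y i = 0)) :
    ∫ y, ∑ i, u y i * v y i = 0 := by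
  have comp : ∀ {w : Torus d → Vec d}, MemLp w 2 volume → ∀ i, MemLp (fun y => w y i) 2 volume := by
    intro w hw i
    exact hw.of_le ((EuclideanSpace.proj (𝕜 := ℝ) i).continuous.comp_aestronglyMeasurable hw.1)
      (ae_of_all _ fun y => PiLp.norm_apply_le (w y) i)
  have compI : ∀ {w : Torus d → Vec d}, MemLp w 2 volume → ∀ i, Integrable (fun y => w y i) := by
    intro w hw i
    exact (comp hw i).integrable (by norm_num)
  have compc : ∀ {w : Torus d → Vec d}, MemLp w 2 volume → ∀ i, MemLp (fun y => ((w y i : ℝ) : ℂ)) 2 volume :=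
    fun hw i => (comp hw i).ofReal
  -- linear combos
  have lin : ∀ {w : Torus d → Vec d}, MemLp w 2 volume → ∀ (k : Fin d → ℤ) (a : Fin d → ℝ),
      ∑ i, (a i : ℂ) * ∫ x, UnitAddTorus.mFourier k x * ((w x i : ℝ) : ℂ) =
      ∫ x, UnitAddTorus.mFourier k x * ((∑ i, a i * w x i : ℝ) : ℂ) := by
    intro w hw k a
    simp_rw [← integral_const_mul]
    rw [← integral_finsetSum]
    · congr 1; funext x; push_cast; rw [Finset.mul_sum]
      exact Finset.sum_congr rfl fun i _ => by ring
    · intro i _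
      refine Integrable.const_mul ?_ _
      exact (compI hw i).ofReal.bdd_mul (c := 1) (UnitAddTorus.mFourier k).continuous.aestronglyMeasurable
        (ae_of_all _ fun x => ((UnitAddTorus.mFourier k).norm_coe_le_norm x).trans UnitAddTorus.mFourier_norm.le)
  have linI : ∀ {w : Torus d → Vec d}, MemLp w 2 volume → ∀ (a : Fin d → ℝ),
      Integrable (fun x => ∑ i, a i * w x i) := fun hw a =>
    integrable_finsetSum _ fun i _ => (compI hw i).const_mul _
  have hU : ∀ k : Fin d → ℤ, ∑ i, ((k i : ℝ) : ℂ) * ∫ x, UnitAddTorus.mFourier (-k) x * ((u x i : ℝ) : ℂ) = 0 := by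
    intro k
    rw [lin hu (-k) (fun i => (k i : ℝ))]
    have e1 := hdu _ (smooth_sinT (-k))
    have e2 := hdu _ (smooth_cosT (-k))
    simp_rw [DT_sinT] at e1
    simp_rw [DT_cosT] at e2
    have ph : ∀ y, phaseT (-k) (u y) = (-(2 * Real.pi)) * ∑ i, (k i : ℝ) * u y i := by
      intro y; rw [phaseT_apply]; simp
    refine four_zero (linI hu _) _ ?_ ?_
    · have : ∀ y, cosT (-k) y * phaseT (-k) (u y) = (-(2 * Real.pi)) * (cosT (-k) y * ∑ i, (k i : ℝ) * u y i) := by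
        intro y; rw [ph]; ring
      simp_rw [this, integral_const_mul] at e1
      simpa [Real.pi_ne_zero] using e1
    · have : ∀ y, -sinT (-k) y * phaseT (-k) (u y) = ((2 * Real.pi)) * (sinT (-k) y * ∑ i, (k i : ℝ) * u y i) := by
        intro y; rw [ph]; ring
      simp_rw [this, integral_const_mul] at e2
      simpa [Real.pi_ne_zero] using e2
  have hV : ∀ k c : Fin d → ℤ, ∑ i, k i * c i = 0 →
      ∑ i, ((c i : ℝ) : ℂ) * ∫ x, UnitAddTorus.mFourier (-k) x * ((v x i : ℝ) : ℂ) = 0 := by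
    intro k c hkc
    rw [lin hv (-k) (fun i => (c i : ℝ))]
    obtain ⟨h1, h2⟩ := hdv (-k) c (by simp [hkc])
    exact four_zero (linI hv _) _ h1 h2
  have key : ∀ k : Fin d → ℤ, ∑ i, (starRingEnd ℂ) (∫ x, UnitAddTorus.mFourier (-k) x * ((u x i : ℝ) : ℂ)) *
        ∫ x, UnitAddTorus.mFourier (-k) x * ((v x i : ℝ) : ℂ) = 0 := by
    intro k
    set U : Fin d → ℂ := fun i => ∫ x, UnitAddTorus.mFourier (-k) x * ((u x i : ℝ) : ℂ) with hUd
    set V : Fin d → ℂ := fun i => ∫ x, UnitAddTorus.mFourier (-k) x * ((v x i : ℝ) : ℂ) with hVd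
    have hU' : ∑ i, ((k i : ℝ) : ℂ) * U i = 0 := hU k
    have hV' : ∀ c : Fin d → ℤ, ∑ i, k i * c i = 0 → ∑ i, ((c i : ℝ) : ℂ) * V i = 0 := hV k
    change ∑ i, (starRingEnd ℂ) (U i) * V i = 0
    clear_value U V
    set S : ℤ := ∑ i, k i * k i with hS
    by_cases hk : S = 0
    · have hk0 : ∀ i, k i = 0 := by
        intro i
        have := (Finset.sum_eq_zero_iff_of_nonneg (fun i _ => mul_self_nonneg (k i))).1 hk i (Finset.mem_univ i)
        simpa using this
      refine Finset.sum_eq_zero fun i _ => ?_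
      have := hV' (Pi.single i 1) (by simp [hk0])
      simp only [Pi.single_apply] at this
      have e : ∀ x, (((if x = i then (1:ℤ) else 0 : ℤ) : ℝ) : ℂ) * V x = if x = i then V x else 0 := by
        intro x; split_ifs <;> simp
      simp_rw [e, Finset.sum_ite_eq', Finset.mem_univ, if_true] at this
      rw [this, mul_zero]
    · have hcomb : ∀ i, (S : ℂ) * V i = (k i : ℂ) * ∑ j, (k j : ℂ) * V j := by
        intro i
        have h := hV' (fun j => S * (if j = i then 1 else 0) - k i * k j) (by
          simp only [mul_sub, Finset.sum_sub_distrib]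
          have : ∑ j, k j * (k i * k j) = k i * S := by
            rw [hS, Finset.mul_sum]; exact Finset.sum_congr rfl fun j _ => by ring
          rw [this]; simp [mul_comm])
        have e : ∀ x, (((S * (if x = i then (1:ℤ) else 0) - k i * k x : ℤ) : ℝ) : ℂ) * V x
            = (if x = i then (S : ℂ) * V x else 0) - (k i : ℂ) * ((k x : ℂ) * V x) := by
          intro x; split_ifs <;> (push_cast; ring)
        simp_rw [e, Finset.sum_sub_distrib, Finset.sum_ite_eq', Finset.mem_univ, if_true, ← Finset.mul_sum] at h
        linear_combination h
      have hS0 : (S : ℂ) ≠ 0 := by exact_mod_cast hk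
      refine (mul_eq_zero.1 (?_ : (S : ℂ) * _ = 0)).resolve_left hS0
      rw [Finset.mul_sum]
      have : ∀ i, (S : ℂ) * ((starRingEnd ℂ) (U i) * V i) =
          ((starRingEnd ℂ) (((k i : ℝ) : ℂ) * U i)) * ∑ j, (k j : ℂ) * V j := by
        intro i
        rw [map_mul, Complex.conj_ofReal]
        push_cast
        linear_combination ((starRingEnd ℂ) (U i)) * hcomb i
      simp_rw [this]
      rw [← Finset.sum_mul, ← map_sum, hU']
      simp
  have hs := hasSum_sum (s := Finset.univ) (fun i _ => parseval (compc hu i) (compc hv i))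
  simp_rw [key] at hs
  have h0 := hs.unique hasSum_zero
  have : ∀ i, ∫ x, (starRingEnd ℂ) ((u x i : ℝ) : ℂ) * ((v x i : ℝ) : ℂ) = ((∫ x, u x i * v x i : ℝ) : ℂ) := by
    intro i
    rw [← integral_complex_ofReal]
    congr 1; funext x
    simp
  simp_rw [this] at h0
  rw [integral_finsetSum _ (fun i _ => by exact (comp hu i).integrable_mul (comp hv i))]
  exact_mod_cast h0


/-! ### Density of nice fields among divergence-free `L²` fields -/

/-- The space-time measure. -/
def spT (T : ℝ) (d : ℕ) : Measure (ℝ × Torus d) := (volume.restrict (Ioc 0 T)).prod volume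

instance instFinStM (T : ℝ) (d : ℕ) : IsFiniteMeasure (spT T d) := by unfold spT; infer_instance

lemma NiceField.memLp {d : ℕ} {f : ℝ → Torus d → Vec d} (hf : NiceField f) (T : ℝ) :
    MemLp (Function.uncurry f) 2 (spT T d) := by
  obtain ⟨h1, ⟨M, hM⟩, -⟩ := hf
  exact MemLp.of_bound h1.continuous.aestronglyMeasurable M (ae_of_all _ fun z => hM z.1 z.2)

lemma spT_slice {T : ℝ} {d : ℕ} {f : ℝ × Torus d → Vec d} (hf : Measurable f)
    (h : MemLp f 2 (spT T d)) :
    ∀ᵐ t ∂(volume.restrict (Ioc 0 T)), MemLp (fun x => f (t, x)) 2 volume := by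
  have h1 := h.2
  rw [eLpNorm_lt_top_iff_lintegral_rpow_enorm_lt_top (by simp) (by simp)] at h1
  unfold spT at h1
  rw [lintegral_prod _ (by fun_prop)] at h1
  filter_upwards [ae_lt_top (by
    exact Measurable.lintegral_prod_right' (f := fun z => ‖f z‖ₑ ^ (ENNReal.toReal 2)) (by fun_prop)) h1.ne] with t ht
  refine ⟨(hf.comp (measurable_const.prodMk measurable_id)).aestronglyMeasurable, ?_⟩
  rw [eLpNorm_lt_top_iff_lintegral_rpow_enorm_lt_top (by simp) (by simp)]
  exact ht

lemma nice_dense {T : ℝ} {d : ℕ} {b : ℝ → Torus d → Vec d}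
    (hb : Measurable (Function.uncurry b))
    (hdiv : ∀ᵐ t ∂(volume.restrict (Ioc 0 T)),
      ∀ ψ : Torus d → ℝ, SmoothT ψ → ∫ y, DT ψ y (b t y) = 0)
    (hL : MemLp (Function.uncurry b) 2 (spT T d)) {ε : ℝ} (hε : 0 < ε) :
    ∃ f, NiceField f ∧
      eLpNorm (fun z : ℝ × Torus d => b z.1 z.2 - f z.1 z.2) 2 (spT T d) ≤ ENNReal.ofReal ε := by
  classical
  let S : Set (Lp (Vec d) 2 (spT T d)) := {F | ∃ (θ : ℝ → ℝ) (φ : Torus d → ℝ) (c : Vec d),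
    Continuous θ ∧ HasCompactSupport θ ∧ Continuous φ ∧
    (∀ (s : ℝ) x, φ (x + projT d (s • c)) = φ x) ∧
    F =ᵐ[spT T d] fun z => (θ z.1 * φ z.2) • c}
  let K := Submodule.span ℝ S
  have hK : ∀ F ∈ K, ∃ f, NiceField f ∧ F =ᵐ[spT T d] Function.uncurry f := by
    intro F hF
    refine Submodule.closure_induction
      (p := fun (F : Lp (Vec d) 2 (spT T d)) _ => ∃ f, NiceField f ∧ F =ᵐ[spT T d] Function.uncurry f) ?_ ?_ ?_ hF
    · exact ⟨_, NiceField.zero, Lp.coeFn_zero _ _ _⟩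
    · rintro F G - - ⟨f, hf, hFf⟩ ⟨g, hg, hGg⟩
      refine ⟨_, hf.add hg, ?_⟩
      filter_upwards [hFf, hGg, Lp.coeFn_add F G] with z h1 h2 h3
      rw [h3, Pi.add_apply, h1, h2]; rfl
    · rintro r F ⟨θ, φ, c, h1, h2, h3, h4, h5⟩
      refine ⟨_, NiceField.shear (θ := fun t => r * θ t) (h1.const_mul r) (h2.mul_left) h3 c h4, ?_⟩
      filter_upwards [h5, Lp.coeFn_smul r F] with z h6 h7
      rw [h7, Pi.smul_apply, h6, smul_smul]
      simp [Function.uncurry, mul_assoc]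
  have hBmem : hL.toLp _ ∈ closure (K : Set (Lp (Vec d) 2 (spT T d))) := by
    have : closure (K : Set (Lp (Vec d) 2 (spT T d))) = (Kᗮᗮ : Submodule ℝ _) := by
      rw [Submodule.orthogonal_orthogonal_eq_closure]; rfl
    rw [this]
    simp only [SetLike.mem_coe]
    rw [Submodule.mem_orthogonal]
    intro g hg
    rw [Submodule.mem_orthogonal] at hg
    have hgm : Measurable (g : ℝ × Torus d → Vec d) := (Lp.stronglyMeasurable g).measurable
    have hgL : MemLp (g : ℝ × Torus d → Vec d) 2 (spT T d) := Lp.memLp g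
    have hgI : Integrable (g : ℝ × Torus d → Vec d) (spT T d) := hgL.integrable (by norm_num)
    -- test
    have htest : ∀ (φ : Torus d → ℝ) (c : Vec d), Continuous φ →
        (∀ (s : ℝ) x, φ (x + projT d (s • c)) = φ x) →
        ∀ᵐ t ∂(volume.restrict (Ioc 0 T)), ∫ x, φ x * inner ℝ c (g (t, x)) = 0 := by
      intro φ c hφ hinv
      obtain ⟨C, -, hC⟩ := cont_bdd hφ
      have hI : Integrable (fun z : ℝ × Torus d => φ z.2 * inner ℝ c (g z)) (spT T d) :=
        Integrable.bdd_mul (c := C) (hgI.const_inner c)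
          (hφ.comp continuous_snd).aestronglyMeasurable (ae_of_all _ fun z => hC z.2)
      have hI2 := hI
      unfold spT at hI2
      have hI3 := hI2.integral_prod_left
      refine ae_eq_zero_of_integral_contDiff_smul_eq_zero hI3.locallyIntegrable fun θ hθ hθc => ?_
      have hn := NiceField.shear hθ.continuous hθc hφ c hinv
      have hm := hn.memLp T
      have h0 := hg (hm.toLp _) (Submodule.subset_span
        ⟨θ, φ, c, hθ.continuous, hθc, hφ, hinv, MemLp.coeFn_toLp hm⟩)
      rw [L2.inner_def] at h0
      have h1 : ∫ z, θ z.1 * (φ z.2 * inner ℝ c (g z)) ∂(spT T d) = 0 := by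
        rw [← h0]
        refine integral_congr_ae ?_
        filter_upwards [MemLp.coeFn_toLp hm] with z hz
        rw [hz]
        simp only [Function.uncurry]
        rw [real_inner_smul_left]; ring
      obtain ⟨C', hC'⟩ := hθc.exists_bound_of_continuous hθ.continuous
      have hI4 : Integrable (fun z : ℝ × Torus d => θ z.1 * (φ z.2 * inner ℝ c (g z))) (spT T d) :=
        Integrable.bdd_mul (c := C') hI
          (hθ.continuous.comp continuous_fst).aestronglyMeasurable (ae_of_all _ fun z => hC' z.1)
      unfold spT at h1 hI4
      rw [integral_prod _ hI4] at h1
      refine Eq.trans ?_ h1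
      congr 1; funext t
      rw [smul_eq_mul, ← integral_const_mul]
      rfl
    have hall : ∀ᵐ t ∂(volume.restrict (Ioc 0 T)), ∀ k c : Fin d → ℤ, ∑ i, k i * c i = 0 →
      (∫ y, cosT k y * ∑ i, (c i : ℝ) * g (t, y) i = 0) ∧
      (∫ y, sinT k y * ∑ i, (c i : ℝ) * g (t, y) i = 0) := by
      rw [ae_all_iff]; intro k
      rw [ae_all_iff]; intro c
      by_cases hkc : ∑ i, k i * c i = 0
      · let cc : Vec d := WithLp.toLp 2 fun i => (c i : ℝ)
        have hcc : ∑ i, (k i : ℝ) * cc i = 0 := by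
          have : ∑ i, (k i : ℝ) * (c i : ℝ) = 0 := by exact_mod_cast hkc
          exact this
        have hin : ∀ w : Vec d, inner ℝ cc w = ∑ i, (c i : ℝ) * w i := by
          intro w
          rw [PiLp.inner_apply]
          refine Finset.sum_congr rfl fun i _ => ?_
          simp [cc, mul_comm]
        filter_upwards [htest _ cc (smooth_cosT k).continuous (cosT_inv k cc hcc),
          htest _ cc (smooth_sinT k).continuous (sinT_inv k cc hcc)] with t h1 h2 _
        simp_rw [hin] at h1 h2
        exact ⟨h1, h2⟩
      · exact ae_of_all _ fun t h => absurd h hkc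
    rw [L2.inner_def]
    have hI : Integrable (fun z : ℝ × Torus d => ∑ i, b z.1 z.2 i * g z i) (spT T d) := by
      have := (L2.integrable_inner (𝕜 := ℝ) g (hL.toLp _))
      refine this.congr ?_
      filter_upwards [MemLp.coeFn_toLp hL] with z hz
      rw [hz, PiLp.inner_apply]
      refine Finset.sum_congr rfl fun i _ => ?_
      simp [Function.uncurry]
    have h2 : ∫ z, inner ℝ (g z) ((hL.toLp _ : Lp (Vec d) 2 (spT T d)) z) ∂(spT T d) =
        ∫ z, ∑ i, b z.1 z.2 i * g z i ∂(spT T d) := by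
      refine integral_congr_ae ?_
      filter_upwards [MemLp.coeFn_toLp hL] with z hz
      rw [hz, PiLp.inner_apply]
      refine Finset.sum_congr rfl fun i _ => ?_
      simp [Function.uncurry]
    rw [h2]
    unfold spT at hI ⊢
    rw [integral_prod _ hI]
    refine integral_eq_zero_of_ae ?_
    filter_upwards [hall, hdiv, spT_slice hb hL, spT_slice hgm hgL] with t h3 h4 h5 h6
    exact four_orth (u := b t) (v := fun x => g (t, x)) h5 h6 h4 h3
  obtain ⟨F, hFK, hF⟩ := Metric.mem_closure_iff.1 hBmem ε hε
  obtain ⟨f, hf, hFf⟩ := hK F hFK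
  refine ⟨f, hf, ?_⟩
  rw [dist_eq_norm, Lp.norm_def] at hF
  have h1 : eLpNorm (fun z : ℝ × Torus d => b z.1 z.2 - f z.1 z.2) 2 (spT T d) =
      eLpNorm (hL.toLp _ - F : Lp (Vec d) 2 (spT T d)) 2 (spT T d) := by
    refine eLpNorm_congr_ae ?_
    filter_upwards [MemLp.coeFn_toLp hL, hFf, Lp.coeFn_sub (hL.toLp _) F] with z h1 h2 h3
    rw [h3, Pi.sub_apply, h1, h2]; rfl
  rw [h1, ENNReal.le_ofReal_iff_toReal_le (Lp.eLpNorm_ne_top _) hε.le]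
  exact hF.le


/-! ### Approximate flows -/

lemma measurable_to_path {T : ℝ} {d : ℕ} (hT : 0 < T) {Ω : Type*} [MeasurableSpace Ω]
    {Γ : Ω → PathSpace T d} (h : ∀ t : Icc (0:ℝ) T, Measurable fun ω => Γ ω t) : Measurable Γ := by
  let Φ : PathSpace T d → ({q : ℚ // (q : ℝ) ∈ Ioo 0 T} → Torus d) :=
    fun γ q => extendPath hT.le γ q
  have hΦ : Measurable Φ := measurable_pi_lambda _ fun q => measurable_extend' hT.le _
  have hinj : Function.Injective Φ := fun γ₁ γ₂ h12 =>
    path_ext hT fun q hq => congrFun h12 ⟨q, hq⟩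
  have hemb : MeasurableEmbedding Φ := hΦ.measurableEmbedding hinj
  rw [← hemb.measurable_comp_iff]
  exact measurable_pi_lambda _ fun q => h _

/-- Iterated one-step maps. -/
def stepX {d : ℕ} (h : ℝ) (D : ℝ → Torus d → Vec d) : ℕ → Torus d → Torus d
  | 0 => id
  | n + 1 => fun x => stepX h D n x + projT d (h • D (n * h) (stepX h D n x))

/-- Total displacement. -/
def stepA {d : ℕ} (h : ℝ) (D : ℝ → Torus d → Vec d) (n : ℕ) (x : Torus d) : Vec d :=
  ∑ j ∈ Finset.range n, h • D (j * h) (stepX h D j x)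

lemma stepX_eq {d : ℕ} (h : ℝ) (D : ℝ → Torus d → Vec d) (n : ℕ) (x : Torus d) :
    stepX h D n x = x + projT d (stepA h D n x) := by
  induction n with
  | zero => simp [stepX, stepA, projT_zero]
  | succ n ih =>
    rw [stepA, Finset.sum_range_succ, projT_add, ← add_assoc, ← stepA, ← ih]
    rfl

lemma stepX_mp {d : ℕ} {h : ℝ} {D : ℝ → Torus d → Vec d}
    (hD : ∀ t, MeasurePreserving (fun y => y + projT d (h • D t y)) volume volume) (n : ℕ) :
    MeasurePreserving (stepX h D n) volume volume := by
  induction n with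
  | zero => exact MeasurePreserving.id _
  | succ n ih => exact (hD (n * h)).comp ih

/-- Piecewise constant velocity. -/
def stepV {d : ℕ} (h : ℝ) (D : ℝ → Torus d → Vec d) (s : ℝ) (x : Torus d) : Vec d :=
  D (⌊s / h⌋₊ * h) (stepX h D ⌊s / h⌋₊ x)

lemma measurable_stepV {d : ℕ} {h : ℝ} {D : ℝ → Torus d → Vec d} (hDm : ∀ t, Measurable (D t))
    (hD : ∀ t, MeasurePreserving (fun y => y + projT d (h • D t y)) volume volume) :
    Measurable (Function.uncurry (stepV h D)) := by
  have h1 : Measurable (fun p : ℕ × Torus d => D (p.1 * h) (stepX h D p.1 p.2)) :=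
    measurable_from_prod_countable_right fun n => (hDm (n * h)).comp (stepX_mp hD n).measurable
  exact h1.comp ((Nat.measurable_floor.comp (measurable_fst.div_const h)).prodMk measurable_snd)

lemma stepV_int {d : ℕ} {h : ℝ} (hh : 0 < h) {D : ℝ → Torus d → Vec d}
    (hDm : ∀ t, Measurable (D t))
    (hD : ∀ t, MeasurePreserving (fun y => y + projT d (h • D t y)) volume volume)
    {C : ℝ} (hC : ∀ t y, ‖D t y‖ ≤ C) (x : Torus d) (a c : ℝ) :
    IntervalIntegrable (fun s => stepV h D s x) volume a c := by
  rw [intervalIntegrable_iff, uIoc]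
  refine Integrable.of_bound (C := C)
    ((measurable_stepV hDm hD).comp (measurable_id.prodMk measurable_const)).aestronglyMeasurable
    (ae_of_all _ fun s => hC _ _)

lemma stepV_integral {d : ℕ} {h : ℝ} (hh : 0 < h) {D : ℝ → Torus d → Vec d}
    (hDm : ∀ t, Measurable (D t))
    (hD : ∀ t, MeasurePreserving (fun y => y + projT d (h • D t y)) volume volume)
    {C : ℝ} (hC : ∀ t y, ‖D t y‖ ≤ C) (x : Torus d) (n : ℕ) :
    ∫ s in (0:ℝ)..(n * h), stepV h D s x = stepA h D n x := by
  induction n with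
  | zero => simp [stepA]
  | succ n ih =>
    rw [← intervalIntegral.integral_add_adjacent_intervals
      (stepV_int hh hDm hD hC x 0 (n * h)) (stepV_int hh hDm hD hC x _ _), ih]
    have : ∫ s in (n * h : ℝ)..((n + 1 : ℕ) * h), stepV h D s x =
        ∫ s in (n * h : ℝ)..((n + 1 : ℕ) * h), D (n * h) (stepX h D n x) := by
      refine intervalIntegral.integral_congr_ae ?_
      have hne : ∀ᵐ s : ℝ, s ≠ (n + 1 : ℕ) * h := by simp [ae_iff, measure_singleton]
      filter_upwards [hne] with s hs hmem
      have hle : (n * h : ℝ) ≤ (n + 1 : ℕ) * h := by gcongr; simp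
      rw [uIoc_of_le hle] at hmem
      have : ⌊s / h⌋₊ = n := by
        rw [Nat.floor_eq_iff (div_nonneg ((by positivity : (0:ℝ) ≤ n * h).trans hmem.1.le) hh.le)]
        constructor
        · rw [le_div_iff₀ hh]; exact hmem.1.le
        · rw [div_lt_iff₀ hh]
          have := lt_of_le_of_ne hmem.2 hs
          push_cast at this; exact this
      simp only [stepV, this]
    rw [this, intervalIntegral.integral_const, stepA, stepA, Finset.sum_range_succ]
    congr 2
    push_cast; ring

lemma approx_exists {T : ℝ} {d : ℕ} (hT : 0 < T) {f : ℝ → Torus d → Vec d} (hf : NiceField f)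
    {ε : ℝ} (hε : 0 < ε) :
    ∃ (Γ : Torus d → PathSpace T d) (X : ℝ → Torus d → Torus d) (v : ℝ → Torus d → Vec d),
      Measurable Γ ∧ Measurable (Function.uncurry X) ∧ Measurable (Function.uncurry v) ∧
      (∀ s, MeasurePreserving (X s) volume volume) ∧ (∃ C, ∀ s x, ‖v s x‖ ≤ C) ∧
      (∀ s, 0 ≤ s → ∀ x, ‖v s x - f s (X s x)‖ ≤ ε) ∧
      (∀ x (t : Icc (0:ℝ) T), dist (Γ x t) (X t x) ≤ ε) ∧
      ∀ x (t : Icc (0:ℝ) T), Γ x t = x + projT d (∫ s in Ioc (0:ℝ) t, v s x) := by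
  obtain ⟨hu, ⟨M, hM⟩, hf3⟩ := hf
  have hM0 : 0 ≤ M := (norm_nonneg _).trans (hM 0 0)
  obtain ⟨h₀, h₀pos, H⟩ := hf3 (ε / 2) (by positivity)
  obtain ⟨δ, hδ, hfδ⟩ := Metric.uniformContinuous_iff.1 hu (ε / 2) (by positivity)
  obtain ⟨h, hh, hh1, hh2, hh3⟩ : ∃ h : ℝ, 0 < h ∧ h ≤ h₀ ∧ h < δ ∧ h * (M + ε) ≤ ε := by
    refine ⟨min (min h₀ (δ / 2)) (ε / (M + ε)), by positivity,
      (min_le_left _ _).trans (min_le_left _ _),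
      ((min_le_left _ _).trans (min_le_right _ _)).trans_lt (by linarith), ?_⟩
    rw [← le_div_iff₀ (by positivity)]
    exact min_le_right _ _
  obtain ⟨D, hDm, hDp, hD⟩ := H h hh hh1
  have hDb : ∀ t y, ‖D t y‖ ≤ M + ε := by
    intro t y
    have := norm_add_le (D t y - f t y) (f t y)
    rw [sub_add_cancel] at this
    linarith [hD t y, hM t y]
  have hIntg := fun x => stepV_int hh hDm hDp hDb x
  have hcont : ∀ x, Continuous fun t : Icc (0:ℝ) T =>
      x + projT d (∫ s in Ioc (0:ℝ) t, stepV h D s x) := by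
    intro x
    have h1 : Continuous fun t : ℝ => ∫ s in (0:ℝ)..t, stepV h D s x :=
      intervalIntegral.continuous_primitive (fun a c => hIntg x a c) 0
    have h2 : (fun t : Icc (0:ℝ) T => x + projT d (∫ s in Ioc (0:ℝ) t, stepV h D s x)) =
        fun t : Icc (0:ℝ) T => x + projT d (∫ s in (0:ℝ)..(t:ℝ), stepV h D s x) := by
      funext t; rw [intervalIntegral.integral_of_le t.2.1]
    rw [h2]
    exact continuous_const.add (continuous_projT.comp (h1.comp continuous_subtype_val))
  refine ⟨fun x => ⟨_, hcont x⟩, fun s => stepX h D ⌊s / h⌋₊, stepV h D, ?_, ?_,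
    measurable_stepV hDm hDp, fun s => stepX_mp hDp _, ⟨M + ε, fun s x => hDb _ _⟩, ?_, ?_, fun x t => rfl⟩
  · refine measurable_to_path hT fun t => ?_
    refine measurable_id.add (measurable_projT.comp ?_)
    have := (measurable_stepV hDm hDp)
    exact (StronglyMeasurable.integral_prod_left (μ := volume.restrict (Ioc (0:ℝ) t))
      (f := fun (s : ℝ) (x : Torus d) => stepV h D s x) this.stronglyMeasurable).measurable
  · have h1 : Measurable (fun p : ℕ × Torus d => stepX h D p.1 p.2) :=
      measurable_from_prod_countable_right fun n => (stepX_mp hDp n).measurable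
    exact h1.comp ((Nat.measurable_floor.comp (measurable_fst.div_const h)).prodMk measurable_snd)
  · intro s hs x
    set n := ⌊s / h⌋₊ with hn
    have h1 : (n * h : ℝ) ≤ s := by
      rw [← le_div_iff₀ hh]; exact Nat.floor_le (by positivity)
    have h2 : s < (n + 1) * h := by
      rw [← div_lt_iff₀ hh]; exact Nat.lt_floor_add_one _
    have h3 : dist ((n * h : ℝ), stepX h D n x) (s, stepX h D n x) < δ := by
      rw [Prod.dist_eq, dist_self, max_eq_left dist_nonneg, Real.dist_eq, abs_lt]
      constructor <;> nlinarith
    have h4 := (hfδ h3).le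
    rw [dist_eq_norm] at h4
    simp only [Function.uncurry] at h4
    calc ‖stepV h D s x - f s (stepX h D n x)‖
        = ‖(D (n * h) (stepX h D n x) - f (n * h) (stepX h D n x)) +
          (f (n * h) (stepX h D n x) - f s (stepX h D n x))‖ := by
          rw [sub_add_sub_cancel]; rfl
      _ ≤ ε / 2 + ε / 2 := (norm_add_le _ _).trans (add_le_add (hD _ _) h4)
      _ = ε := by ring
  · intro x t
    set n := ⌊(t:ℝ) / h⌋₊ with hn
    have h1 : (n * h : ℝ) ≤ t := by
      rw [← le_div_iff₀ hh]; exact Nat.floor_le (div_nonneg t.2.1 hh.le)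
    have h2 : (t:ℝ) < (n + 1) * h := by
      rw [← div_lt_iff₀ hh]; exact Nat.lt_floor_add_one _
    change dist (x + projT d (∫ s in Ioc (0:ℝ) t, stepV h D s x)) (stepX h D n x) ≤ ε
    rw [stepX_eq, dist_eq_norm, add_sub_add_left_eq_sub, ← projT_sub,
      ← stepV_integral hh hDm hDp hDb x n, ← intervalIntegral.integral_of_le t.2.1,
      intervalIntegral.integral_interval_sub_left (hIntg x _ _) (hIntg x _ _)]
    refine (norm_projT_le _).trans ?_
    refine (intervalIntegral.norm_integral_le_of_norm_le_const (C := M + ε) fun s _ => hDb _ _).trans ?_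
    rw [abs_of_nonneg (by linarith)]
    nlinarith


/-! ### Compactness of path measures -/

/-- Hölder balls in path space. -/
def holK (T : ℝ) (d : ℕ) (R : ℝ) : Set (PathSpace T d) :=
  {γ | ∀ s t : Icc (0:ℝ) T, dist (γ s) (γ t) ≤ R * Real.sqrt (dist s t)}

lemma isCompact_holK (T : ℝ) (d : ℕ) (R : ℝ) : IsCompact (holK T d R) := by
  have hmod : Tendsto (fun r : ℝ => R * Real.sqrt r) (𝓝 0) (𝓝 0) := by
    have : Continuous fun r : ℝ => R * Real.sqrt r := by fun_prop
    simpa using this.tendsto 0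
  refine ArzelaAscoli.isCompact_of_equicontinuous _ ?_ ?_
  · have : ContinuousMap.toFun '' (holK T d R) =
        {g : Icc (0:ℝ) T → Torus d | ∀ s t, dist (g s) (g t) ≤ R * Real.sqrt (dist s t)} := by
      ext g
      constructor
      · rintro ⟨γ, hγ, rfl⟩; exact hγ
      · intro hg
        have hgc : Continuous g := by
          have := (Metric.equicontinuous_of_continuity_modulus _ hmod (fun _ : Unit => g)
            (fun x y _ => hg x y)).continuous ()
          exact this
        exact ⟨⟨g, hgc⟩, hg, rfl⟩
    rw [this]
    refine IsClosed.isCompact ?_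
    simp only [Set.ofPred_forall]
    refine isClosed_iInter fun s => isClosed_iInter fun t => ?_
    exact isClosed_le ((continuous_apply s).dist (continuous_apply t)) continuous_const
  · exact Metric.equicontinuous_of_continuity_modulus _ hmod _ (fun x y γ => γ.2 x y)

lemma holK_mem {T : ℝ} {d : ℕ} {γ : PathSpace T d} {x : Torus d} {w : ℝ → Vec d}
    (hw : ∀ a c, IntervalIntegrable w volume a c)
    (hγ : ∀ t : Icc (0:ℝ) T, γ t = x + projT d (∫ s in Ioc (0:ℝ) t, w s))
    {R : ℝ} (hR : 0 ≤ R) (hI : ∫⁻ s in Ioc 0 T, ‖w s‖ₑ ^ 2 ≤ ENNReal.ofReal R) :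
    γ ∈ holK T d (R + 1) := by
  have key : ∀ s t : Icc (0:ℝ) T, s < t → dist (γ t) (γ s) ≤ (R + 1) * Real.sqrt (dist t s) := by
    intro s t hst
    have hst' : (s:ℝ) < t := hst
    set δ := dist t s with hδ
    have hδe : δ = t - s := by
      rw [hδ, Subtype.dist_eq, Real.dist_eq, abs_of_pos (by linarith)]
    have hδ0 : 0 < δ := by rw [hδe]; linarith
    have hq : 0 < Real.sqrt δ := Real.sqrt_pos.2 hδ0
    rw [hγ t, hγ s, dist_eq_norm, add_sub_add_left_eq_sub, ← projT_sub,
      ← intervalIntegral.integral_of_le t.2.1, ← intervalIntegral.integral_of_le s.2.1,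
      intervalIntegral.integral_interval_sub_left (hw _ _) (hw _ _),
      intervalIntegral.integral_of_le hst'.le]
    refine (norm_projT_le _).trans ?_
    have h1 : ‖∫ r in Ioc (s:ℝ) t, w r‖ₑ ≤ ENNReal.ofReal ((R + 1) * Real.sqrt δ) := by
      refine (enorm_integral_le_lintegral_enorm _).trans ?_
      have h2 : ∀ r, ‖w r‖ₑ ≤ ENNReal.ofReal (Real.sqrt δ) * ‖w r‖ₑ ^ 2 + ENNReal.ofReal (1 / Real.sqrt δ) := by
        intro r
        rw [← ofReal_norm, ← ENNReal.ofReal_pow (norm_nonneg _), ← ENNReal.ofReal_mul hq.le,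
          ← ENNReal.ofReal_add (by positivity) (by positivity)]
        refine ENNReal.ofReal_le_ofReal ?_
        rw [← sub_nonneg]
        have : Real.sqrt δ * ‖w r‖ ^ 2 + 1 / Real.sqrt δ - ‖w r‖ =
          ((Real.sqrt δ * ‖w r‖ - 1 / 2) ^ 2 + 3 / 4) / Real.sqrt δ := by
          field_simp; ring
        rw [this]; positivity
      calc ∫⁻ r in Ioc (s:ℝ) t, ‖w r‖ₑ
          ≤ ∫⁻ r in Ioc (s:ℝ) t, (ENNReal.ofReal (Real.sqrt δ) * ‖w r‖ₑ ^ 2 + ENNReal.ofReal (1 / Real.sqrt δ)) :=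
            lintegral_mono h2
        _ = ENNReal.ofReal (Real.sqrt δ) * (∫⁻ r in Ioc (s:ℝ) t, ‖w r‖ₑ ^ 2)
            + ENNReal.ofReal (1 / Real.sqrt δ) * ENNReal.ofReal δ := by
            rw [lintegral_add_right _ measurable_const, lintegral_const_mul' _ _ ENNReal.ofReal_ne_top,
              lintegral_const, Measure.restrict_apply_univ, Real.volume_Ioc, ← hδe]
        _ ≤ ENNReal.ofReal (Real.sqrt δ) * ENNReal.ofReal R
            + ENNReal.ofReal (1 / Real.sqrt δ) * ENNReal.ofReal δ := by
            gcongr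
            refine (lintegral_mono_set ?_).trans hI
            exact Ioc_subset_Ioc s.2.1 t.2.2
        _ = ENNReal.ofReal ((R + 1) * Real.sqrt δ) := by
            rw [← ENNReal.ofReal_mul hq.le, ← ENNReal.ofReal_mul (by positivity),
              ← ENNReal.ofReal_add (by positivity) (by positivity)]
            congr 1
            have : 1 / Real.sqrt δ * δ = Real.sqrt δ := by
              rw [one_div, inv_mul_eq_div, Real.div_sqrt]
            rw [this]; ring
    rw [← ofReal_norm] at h1
    exact (ENNReal.ofReal_le_ofReal_iff (by positivity)).1 h1
  intro s t
  rcases lt_trichotomy s t with h | h | h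
  · rw [dist_comm, dist_comm s t]; exact key s t h
  · subst h; simp
  · exact key t s h

lemma approx_mp {T : ℝ} {d : ℕ} {X : ℝ → Torus d → Torus d} (hX : Measurable (Function.uncurry X))
    (hXp : ∀ s, MeasurePreserving (X s) volume volume) :
    MeasurePreserving (fun z : ℝ × Torus d => (z.1, X z.1 z.2)) (spT T d) (spT T d) := by
  unfold spT
  exact (MeasurePreserving.id (volume.restrict (Ioc 0 T))).skew_product hX
    (ae_of_all _ fun s => (hXp s).map_eq)

lemma ae_spT_pos (T : ℝ) (d : ℕ) : ∀ᵐ z ∂(spT T d), z.1 ∈ Ioc 0 T := by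
  unfold spT
  have h : ∀ᵐ s ∂(volume.restrict (Ioc 0 T)), s ∈ Ioc 0 T := ae_restrict_mem measurableSet_Ioc
  exact Measure.quasiMeasurePreserving_fst.ae h

lemma energy_le {T : ℝ} {d : ℕ} {b f v : ℝ → Torus d → Vec d} {X : ℝ → Torus d → Torus d}
    (hb : Measurable (Function.uncurry b)) (hf : Continuous (Function.uncurry f))
    (hv : Measurable (Function.uncurry v))
    (hX : Measurable (Function.uncurry X)) (hXp : ∀ s, MeasurePreserving (X s) volume volume)
    {ε : ℝ} (hε : 0 < ε) (hε1 : ε ≤ 1) (hvf : ∀ s, 0 ≤ s → ∀ x, ‖v s x - f s (X s x)‖ ≤ ε)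
    (hbf : eLpNorm (fun z : ℝ × Torus d => b z.1 z.2 - f z.1 z.2) 2 (spT T d) ≤ ENNReal.ofReal ε) :
    eLpNorm (Function.uncurry v) 2 (spT T d) ≤
      eLpNorm (Function.uncurry b) 2 (spT T d) + 1 + (spT T d univ) ^ (1 / (2:ℝ)) := by
  have hΦ := approx_mp (T := T) hX hXp
  have hvΦ : Measurable fun z : ℝ × Torus d => f z.1 (X z.1 z.2) := hf.measurable.comp hΦ.measurable
  have hv1 : Function.uncurry v = (fun z : ℝ × Torus d => v z.1 z.2 - f z.1 (X z.1 z.2)) +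
      (fun z : ℝ × Torus d => f z.1 (X z.1 z.2)) := by
    funext z
    exact (sub_add_cancel (v z.1 z.2) (f z.1 (X z.1 z.2))).symm
  have hf1 : Function.uncurry f = Function.uncurry b - (fun z : ℝ × Torus d => b z.1 z.2 - f z.1 z.2) := by
    funext z
    exact (sub_sub_cancel (b z.1 z.2) (f z.1 z.2)).symm
  have hvm : AEStronglyMeasurable (fun z : ℝ × Torus d => v z.1 z.2 - f z.1 (X z.1 z.2)) (spT T d) :=
    (Measurable.sub (f := fun z : ℝ × Torus d => v z.1 z.2) hv hvΦ).aestronglyMeasurable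
  have hbm : AEStronglyMeasurable (fun z : ℝ × Torus d => b z.1 z.2 - f z.1 z.2) (spT T d) :=
    (Measurable.sub (f := fun z : ℝ × Torus d => b z.1 z.2) hb hf.measurable).aestronglyMeasurable
  have h1 : eLpNorm (Function.uncurry v) 2 (spT T d) ≤
      eLpNorm (fun z : ℝ × Torus d => v z.1 z.2 - f z.1 (X z.1 z.2)) 2 (spT T d) +
      eLpNorm (fun z : ℝ × Torus d => f z.1 (X z.1 z.2)) 2 (spT T d) := by
    rw [hv1]
    exact eLpNorm_add_le hvm hvΦ.aestronglyMeasurable one_le_two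
  have h2 : eLpNorm (fun z : ℝ × Torus d => f z.1 (X z.1 z.2)) 2 (spT T d) =
      eLpNorm (Function.uncurry f) 2 (spT T d) := by
    have hfm : AEStronglyMeasurable (Function.uncurry f) (spT T d) := hf.measurable.aestronglyMeasurable
    have h21 := eLpNorm_comp_measurePreserving (p := 2) hfm hΦ
    rw [← h21]
    rfl
  have h3 : eLpNorm (Function.uncurry f) 2 (spT T d) ≤ eLpNorm (Function.uncurry b) 2 (spT T d) + 1 := by
    have h31 : eLpNorm (Function.uncurry f) 2 (spT T d) ≤ eLpNorm (Function.uncurry b) 2 (spT T d) +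
        eLpNorm (fun z : ℝ × Torus d => b z.1 z.2 - f z.1 z.2) 2 (spT T d) := by
      rw [hf1]
      exact eLpNorm_sub_le hb.aestronglyMeasurable hbm one_le_two
    have h32 : ENNReal.ofReal ε ≤ 1 := by
      rw [← ENNReal.ofReal_one]; exact ENNReal.ofReal_le_ofReal hε1
    exact h31.trans (add_le_add le_rfl (hbf.trans h32))
  have h4 : eLpNorm (fun z : ℝ × Torus d => v z.1 z.2 - f z.1 (X z.1 z.2)) 2 (spT T d) ≤
      (spT T d univ) ^ (1 / (2:ℝ)) := by
    have h41 := eLpNorm_le_of_ae_bound (p := 2) (μ := spT T d) (f := fun z : ℝ × Torus d => v z.1 z.2 - f z.1 (X z.1 z.2))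
      (C := ε) (by filter_upwards [ae_spT_pos T d] with z hz using hvf z.1 hz.1.le z.2)
    have h32 : ENNReal.ofReal ε ≤ 1 := by
      rw [← ENNReal.ofReal_one]; exact ENNReal.ofReal_le_ofReal hε1
    have h42 : (2:ℝ≥0∞).toReal⁻¹ = 1 / (2:ℝ) := by simp
    rw [h42] at h41
    refine h41.trans ((mul_le_mul' le_rfl h32).trans (mul_one _).le)
  rw [h2] at h1
  have h5 := h1.trans (add_le_add h4 h3)
  rwa [add_comm] at h5

lemma tight_bound {T : ℝ} {d : ℕ} {v : ℝ → Torus d → Vec d} {Γ : Torus d → PathSpace T d}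
    (hv : Measurable (Function.uncurry v)) {C : ℝ} (hC : ∀ s x, ‖v s x‖ ≤ C)
    (hΓ : Measurable Γ)
    (hΓv : ∀ x (t : Icc (0:ℝ) T), Γ x t = x + projT d (∫ s in Ioc (0:ℝ) t, v s x))
    {E : ℝ≥0∞} (hE : eLpNorm (Function.uncurry v) 2 (spT T d) ≤ E) {R : ℝ} (hR : 0 ≤ R) :
    ENNReal.ofReal R * (volume.map Γ) (holK T d (R + 1))ᶜ ≤ E ^ 2 := by
  have hm : MeasurableSet (holK T d (R + 1))ᶜ := (isCompact_holK T d _).isClosed.measurableSet.compl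
  rw [Measure.map_apply hΓ hm]
  have hIm : Measurable fun x => ∫⁻ s in Ioc 0 T, ‖v s x‖ₑ ^ 2 :=
    Measurable.lintegral_prod_left' (f := fun z : ℝ × Torus d => ‖v z.1 z.2‖ₑ ^ 2) (hv.enorm.pow_const 2)
  have hsub : Γ ⁻¹' (holK T d (R + 1))ᶜ ⊆ {x | ENNReal.ofReal R ≤ ∫⁻ s in Ioc 0 T, ‖v s x‖ₑ ^ 2} := by
    intro x hx
    by_contra h
    simp only [Set.mem_ofPred_eq, not_le] at h
    refine hx (holK_mem (w := fun s => v s x) (fun a c => ?_) (hΓv x) hR h.le)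
    rw [intervalIntegrable_iff, uIoc]
    exact Integrable.of_bound (C := C)
      (hv.comp (measurable_id.prodMk measurable_const)).aestronglyMeasurable
      (ae_of_all _ fun s => hC _ _)
  calc _ ≤ ENNReal.ofReal R * volume {x | ENNReal.ofReal R ≤ ∫⁻ s in Ioc 0 T, ‖v s x‖ₑ ^ 2} := by
        gcongr
    _ ≤ ∫⁻ x, ∫⁻ s in Ioc 0 T, ‖v s x‖ₑ ^ 2 := mul_meas_ge_le_lintegral hIm _
    _ = ∫⁻ z, ‖v z.1 z.2‖ₑ ^ 2 ∂(spT T d) := by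
        unfold spT
        rw [lintegral_prod_symm (fun z : ℝ × Torus d => ‖v z.1 z.2‖ₑ ^ 2) (by exact (hv.enorm.pow_const 2).aemeasurable)]
    _ = (eLpNorm (Function.uncurry v) 2 (spT T d)) ^ 2 := by
        rw [eLpNorm_eq_lintegral_rpow_enorm_toReal (by simp) (by simp), ← ENNReal.rpow_natCast,
          ← ENNReal.rpow_mul]
        simp [Function.uncurry]
    _ ≤ E ^ 2 := by gcongr


/-! ### Passing to the limit -/

/-- The data of an approximate incompressible flow, with accuracy `ε`. -/
def GoodApprox {T : ℝ} {d : ℕ} (b : ℝ → Torus d → Vec d) (ε : ℝ) (f : ℝ → Torus d → Vec d)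
    (Γ : Torus d → PathSpace T d) (X : ℝ → Torus d → Torus d) (v : ℝ → Torus d → Vec d) : Prop :=
  NiceField f ∧ eLpNorm (fun z : ℝ × Torus d => b z.1 z.2 - f z.1 z.2) 2 (spT T d) ≤ ENNReal.ofReal ε ∧
  Measurable Γ ∧ Measurable (Function.uncurry X) ∧ Measurable (Function.uncurry v) ∧
  (∀ s, MeasurePreserving (X s) volume volume) ∧ (∃ C : ℝ, ∀ s x, ‖v s x‖ ≤ C) ∧
  (∀ s, 0 ≤ s → ∀ x, ‖v s x - f s (X s x)‖ ≤ ε) ∧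
  (∀ x (t : Icc (0:ℝ) T), dist (Γ x t) (X t x) ≤ ε) ∧
  ∀ x (t : Icc (0:ℝ) T), Γ x t = x + projT d (∫ s in Ioc (0:ℝ) t, v s x)

lemma good_exists {T : ℝ} {d : ℕ} (hT : 0 < T) {b : ℝ → Torus d → Vec d}
    (hb : Measurable (Function.uncurry b))
    (hdiv : ∀ᵐ t ∂(volume.restrict (Ioc 0 T)), ∀ ψ : Torus d → ℝ, SmoothT ψ → ∫ y, DT ψ y (b t y) = 0)
    (hL : MemLp (Function.uncurry b) 2 (spT T d)) {ε : ℝ} (hε : 0 < ε) :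
    ∃ (f : ℝ → Torus d → Vec d) (Γ : Torus d → PathSpace T d) (X : ℝ → Torus d → Torus d)
      (v : ℝ → Torus d → Vec d), GoodApprox b ε f Γ X v := by
  obtain ⟨f, hf, hfb⟩ := nice_dense hb hdiv hL hε
  obtain ⟨Γ, X, v, h⟩ := approx_exists hT hf hε
  exact ⟨f, Γ, X, v, hf, hfb, h⟩

lemma L1_of_L2 {T : ℝ} {d : ℕ} {g : ℝ × Torus d → Vec d} (hg : AEStronglyMeasurable g (spT T d)) {ε : ℝ}
    (h : eLpNorm g 2 (spT T d) ≤ ENNReal.ofReal ε) :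
    ∫⁻ z, ‖g z‖ₑ ∂(spT T d) ≤ ENNReal.ofReal ε * (spT T d univ) ^ (1 / (2:ℝ)) := by
  have h1 := eLpNorm_le_eLpNorm_mul_rpow_measure_univ (p := 1) (q := 2) one_le_two hg
  rw [eLpNorm_one_eq_lintegral_enorm] at h1
  have h2 : 1 / (1:ℝ≥0∞).toReal - 1 / (2:ℝ≥0∞).toReal = 1 / (2:ℝ) := by norm_num
  rw [h2] at h1
  exact h1.trans (mul_le_mul' h le_rfl)

lemma good_tight {T : ℝ} {d : ℕ} {b : ℝ → Torus d → Vec d}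
    (hb : Measurable (Function.uncurry b))
    (hL : MemLp (Function.uncurry b) 2 (spT T d)) {ε : ℕ → ℝ} (hε : ∀ n, 0 < ε n) (hε1 : ∀ n, ε n ≤ 1)
    {f : ℕ → ℝ → Torus d → Vec d} {Γ : ℕ → Torus d → PathSpace T d} {X : ℕ → ℝ → Torus d → Torus d}
    {v : ℕ → ℝ → Torus d → Vec d} (hG : ∀ n, GoodApprox b (ε n) (f n) (Γ n) (X n) (v n))
    (U : Ultrafilter ℕ) :
    ∃ η : ProbabilityMeasure (PathSpace T d), ∀ F : BoundedContinuousFunction (PathSpace T d) NNReal,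
      Tendsto (fun n => ∫⁻ x, F (Γ n x)) U (𝓝 (∫⁻ γ, F γ ∂(η : Measure (PathSpace T d)))) := by
  have hΓ : ∀ n, Measurable (Γ n) := fun n => (hG n).2.2.1
  set P : ℕ → ProbabilityMeasure (PathSpace T d) := fun n =>
    ⟨volume.map (Γ n), Measure.isProbabilityMeasure_map (hΓ n).aemeasurable⟩ with hP
  have htight : IsTightMeasureSet {((μ : ProbabilityMeasure (PathSpace T d)) : Measure (PathSpace T d)) | μ ∈ range P} := by
    rw [isTightMeasureSet_iff_exists_isCompact_measure_compl_le]
    intro e he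
    set E : ℝ≥0∞ := eLpNorm (Function.uncurry b) 2 (spT T d) + 1 + (spT T d univ) ^ (1 / (2:ℝ)) with hE
    have hEf : E ^ 2 < ∞ := by
      refine ENNReal.pow_lt_top ?_
      rw [hE]
      refine ENNReal.add_lt_top.2 ⟨ENNReal.add_lt_top.2 ⟨hL.2, ENNReal.one_lt_top⟩, ?_⟩
      exact ENNReal.rpow_lt_top_of_nonneg (by norm_num) (measure_ne_top _ _)
    obtain ⟨R, hR, hRe⟩ : ∃ R : ℝ, 0 < R ∧ E ^ 2 ≤ e * ENNReal.ofReal R := by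
      by_cases he' : e = ∞
      · refine ⟨1, one_pos, ?_⟩
        rw [he']; simp
      refine ⟨(E ^ 2 / e).toReal + 1, by positivity, ?_⟩
      have : E ^ 2 / e ≤ ENNReal.ofReal ((E ^ 2 / e).toReal + 1) := by
        have h1 : E ^ 2 / e ≠ ∞ := (ENNReal.div_lt_top hEf.ne he.ne').ne
        nth_rewrite 1 [← ENNReal.ofReal_toReal h1]
        exact ENNReal.ofReal_le_ofReal (by linarith)
      rwa [ENNReal.div_le_iff_le_mul (Or.inl he.ne') (Or.inl he'), mul_comm] at this
    refine ⟨holK T d (R + 1), isCompact_holK _ _ _, ?_⟩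
    rintro _ ⟨_, ⟨n, rfl⟩, rfl⟩
    obtain ⟨h1, h2, h3, h4, h5, h6, ⟨C, hC⟩, h8, h9, h10⟩ := hG n
    have hen := energy_le hb h1.1.continuous h5 h4 h6 (hε n) (hε1 n) h8 h2
    have ht := tight_bound h5 hC h3 h10 hen hR.le
    have h0 : ENNReal.ofReal R ≠ 0 := by simpa using hR
    have ht' : ENNReal.ofReal R * (volume.map (Γ n)) (holK T d (R + 1))ᶜ ≤ ENNReal.ofReal R * e := by
      rw [mul_comm _ e]; exact ht.trans hRe
    exact (ENNReal.mul_le_mul_iff_right h0 ENNReal.ofReal_ne_top).1 ht'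
  have hcpt := isCompact_closure_of_isTightMeasureSet htight
  obtain ⟨η, -, hη⟩ := hcpt.ultrafilter_le_nhds (U.map P)
    (.trans (by simp) (monotone_principal subset_closure))
  refine ⟨η, fun F => ?_⟩
  have hη' : Tendsto P U (𝓝 η) := hη
  have := (ProbabilityMeasure.tendsto_iff_forall_lintegral_tendsto.1 hη') F
  refine this.congr fun n => ?_
  exact lintegral_map (by fun_prop) (hΓ n)

lemma good_marginal {T : ℝ} {d : ℕ} {b : ℝ → Torus d → Vec d}
    {ε : ℕ → ℝ} (hε0 : Tendsto ε atTop (𝓝 0))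
    {f : ℕ → ℝ → Torus d → Vec d} {Γ : ℕ → Torus d → PathSpace T d} {X : ℕ → ℝ → Torus d → Torus d}
    {v : ℕ → ℝ → Torus d → Vec d} (hG : ∀ n, GoodApprox b (ε n) (f n) (Γ n) (X n) (v n))
    {U : Ultrafilter ℕ} (hU : (U : Filter ℕ) ≤ atTop)
    {η : ProbabilityMeasure (PathSpace T d)} (hη : ∀ F : BoundedContinuousFunction (PathSpace T d) NNReal,
      Tendsto (fun n => ∫⁻ x, F (Γ n x)) U (𝓝 (∫⁻ γ, F γ ∂(η : Measure (PathSpace T d)))))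
    (t : Icc (0:ℝ) T) :
    Measure.map (fun γ : PathSpace T d => γ t) (η : Measure (PathSpace T d)) = volume := by
  have hev : Continuous (fun γ : PathSpace T d => γ t) := continuous_eval_const t
  have : IsProbabilityMeasure (Measure.map (fun γ : PathSpace T d => γ t) (η : Measure (PathSpace T d))) :=
    Measure.isProbabilityMeasure_map hev.measurable.aemeasurable
  refine ext_of_forall_lintegral_eq_of_IsFiniteMeasure fun ψ => ?_
  rw [lintegral_map (by fun_prop) hev.measurable]
  have h1 := hη (ψ.compContinuous ⟨_, hev⟩)
  refine tendsto_nhds_unique h1 ?_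
  have hψu : UniformContinuous ψ := CompactSpace.uniformContinuous_of_continuous ψ.continuous
  have hX : ∀ n, ∫⁻ x, (ψ (X n t x) : ℝ≥0∞) = ∫⁻ x, (ψ x : ℝ≥0∞) := fun n =>
    ((hG n).2.2.2.2.2.1 t).lintegral_comp (f := fun x => (ψ x : ℝ≥0∞)) (by fun_prop)
  have hXm : ∀ n, Measurable (X n t) := fun n => ((hG n).2.2.2.2.2.1 t).measurable
  have hΓm : ∀ n, Measurable (fun x => Γ n x t) := fun n => hev.measurable.comp (hG n).2.2.1
  rw [ENNReal.tendsto_nhds (ψ.lintegral_lt_top_of_nnreal volume).ne]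
  intro e he
  obtain ⟨κ, hκ, hκe⟩ : ∃ κ : NNReal, 0 < κ ∧ (κ : ℝ≥0∞) ≤ e := by
    obtain ⟨κ, h1, h2⟩ := ENNReal.lt_iff_exists_nnreal_btwn.1 he
    exact ⟨κ, by exact_mod_cast h1, h2.le⟩
  obtain ⟨r, hr, hru⟩ := Metric.uniformContinuous_iff.1 hψu κ hκ
  have hev2 : ∀ᶠ n in (U : Filter ℕ), ε n < r := hU (hε0.eventually_lt_const hr)
  filter_upwards [hev2] with n hn
  have hd : ∀ x, dist (ψ (Γ n x t)) (ψ (X n t x)) < κ := fun x =>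
    hru (((hG n).2.2.2.2.2.2.2.2.1 x t).trans_lt hn)
  have hle : ∀ a c : NNReal, dist a c < κ → (a : ℝ≥0∞) ≤ c + κ := by
    intro a c h
    rw [NNReal.dist_eq, abs_lt] at h
    have : (a:ℝ) ≤ c + κ := by linarith
    exact_mod_cast this
  constructor
  · refine tsub_le_iff_right.2 ?_
    rw [← hX n]
    calc ∫⁻ x, (ψ (X n t x) : ℝ≥0∞) ≤ ∫⁻ x, ((ψ (Γ n x t) : ℝ≥0∞) + κ) :=
          lintegral_mono fun x => hle _ _ (by rw [dist_comm]; exact hd x)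
      _ = (∫⁻ x, (ψ (Γ n x t) : ℝ≥0∞)) + κ := by
          rw [lintegral_add_right _ measurable_const]; simp
      _ ≤ _ := add_le_add le_rfl hκe
  · rw [← hX n]
    calc ∫⁻ x, (ψ (Γ n x t) : ℝ≥0∞) ≤ ∫⁻ x, ((ψ (X n t x) : ℝ≥0∞) + κ) :=
          lintegral_mono fun x => hle _ _ (hd x)
      _ = (∫⁻ x, (ψ (X n t x) : ℝ≥0∞)) + κ := by
          rw [lintegral_add_right _ measurable_const]; simp
      _ ≤ _ := add_le_add le_rfl hκe


/-! ### The limit is concentrated on integral curves -/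

lemma mass_swap {T : ℝ} {d : ℕ} (hT : 0 ≤ T) {η : Measure (PathSpace T d)} [SFinite η]
    (hm : ∀ r : ℝ, η.map (fun γ => extendPath hT γ r) = volume)
    {g : ℝ × Torus d → ℝ≥0∞} (hg : Measurable g) :
    (∫⁻ γ, (∫⁻ s in Ioc 0 T, g (s, extendPath hT γ s)) ∂η) = ∫⁻ z, g z ∂(spT T d) := by
  have hme : Measurable fun p : PathSpace T d × ℝ => g (p.2, extendPath hT p.1 p.2) :=
    hg.comp (measurable_snd.prodMk ((measurable_extend hT).comp measurable_swap))
  rw [lintegral_lintegral_swap (by exact hme.aemeasurable)]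
  unfold spT
  rw [lintegral_prod _ hg.aemeasurable]
  refine lintegral_congr fun s => ?_
  rw [← hm s, lintegral_map (f := fun y => g (s, y)) (hg.comp (measurable_const.prodMk measurable_id))
    (measurable_extend' hT s)]

lemma good_curve {T : ℝ} {d : ℕ} (hT : 0 < T) {b c f : ℝ → Torus d → Vec d} {ε κ δ : ℝ}
    {Γ : Torus d → PathSpace T d} {X v : ℝ → Torus d → _}
    (hb : Measurable (Function.uncurry b))
    (hG : GoodApprox b ε f Γ X v) (hc : NiceField c)
    (hcb : eLpNorm (fun z : ℝ × Torus d => b z.1 z.2 - c z.1 z.2) 2 (spT T d) ≤ ENNReal.ofReal δ)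
    (hκ0 : 0 ≤ κ) (hε0 : 0 ≤ ε)
    (hκ : ∀ s x y, dist x y ≤ ε → ‖c s x - c s y‖ ≤ κ) (t : Icc (0:ℝ) T) :
    ∫⁻ x, ‖Γ x t - Γ x ⟨0, left_mem_Icc.2 hT.le⟩ -
        projT d (∫ s in Ioc (0:ℝ) t, c s (extendPath hT.le (Γ x) s))‖ₑ ≤
      ENNReal.ofReal (ε + κ) * (spT T d univ) +
        (ENNReal.ofReal ε + ENNReal.ofReal δ) * (spT T d univ) ^ (1 / (2:ℝ)) := by
  obtain ⟨h1, h2, h3, h4, h5, h6, ⟨C, hC⟩, h8, h9, h10⟩ := hG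
  have hcc := hc.1.continuous
  obtain ⟨M, hM⟩ := hc.2.1
  have hfc := h1.1.continuous
  -- measurability
  have hmX : Measurable fun z : ℝ × Torus d => (z.1, X z.1 z.2) := measurable_fst.prodMk h4
  have hmΓ : Measurable fun z : ℝ × Torus d => extendPath hT.le (Γ z.2) z.1 :=
    (measurable_extend hT.le).comp (measurable_fst.prodMk (h3.comp measurable_snd))
  have hcΓ : Measurable fun z : ℝ × Torus d => c z.1 (extendPath hT.le (Γ z.2) z.1) :=
    hcc.measurable.comp (measurable_fst.prodMk hmΓ)
  have hfcm : Measurable fun z : ℝ × Torus d => f z.1 z.2 - c z.1 z.2 :=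
    Measurable.sub (f := fun z : ℝ × Torus d => f z.1 z.2) hfc.measurable hcc.measurable
  have hI : ∀ x, Measurable fun s => c s (extendPath hT.le (Γ x) s) := fun x =>
    hcΓ.comp (measurable_id.prodMk measurable_const)
  have hIv : ∀ x, Measurable fun s => v s x := fun x => h5.comp (measurable_id.prodMk measurable_const)
  -- pointwise in `x`
  have hpt : ∀ x, ‖Γ x t - Γ x ⟨0, left_mem_Icc.2 hT.le⟩ -
        projT d (∫ s in Ioc (0:ℝ) t, c s (extendPath hT.le (Γ x) s))‖ₑ ≤
        ∫⁻ s in Ioc 0 T, (ENNReal.ofReal (ε + κ) + ‖f s (X s x) - c s (X s x)‖ₑ) := by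
    intro x
    have e1 : Γ x t - Γ x ⟨0, left_mem_Icc.2 hT.le⟩ -
        projT d (∫ s in Ioc (0:ℝ) t, c s (extendPath hT.le (Γ x) s)) =
        projT d (∫ s in Ioc (0:ℝ) t, (v s x - c s (extendPath hT.le (Γ x) s))) := by
      rw [integral_sub, projT_sub, h10 x t, h10 x ⟨0, _⟩]
      · simp [projT_zero]
      · exact Integrable.of_bound (C := C) (hIv x).aestronglyMeasurable (ae_of_all _ fun s => hC s x)
      · exact Integrable.of_bound (C := M) (hI x).aestronglyMeasurable (ae_of_all _ fun s => hM s _)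
    rw [e1]
    have e2 : ‖projT d (∫ s in Ioc (0:ℝ) t, (v s x - c s (extendPath hT.le (Γ x) s)))‖ₑ ≤
        ‖∫ s in Ioc (0:ℝ) t, (v s x - c s (extendPath hT.le (Γ x) s))‖ₑ := by
      rw [← ofReal_norm, ← ofReal_norm]
      exact ENNReal.ofReal_le_ofReal (norm_projT_le _)
    refine e2.trans ((enorm_integral_le_lintegral_enorm _).trans ?_)
    refine (lintegral_mono_set (Ioc_subset_Ioc_right t.2.2)).trans ?_
    refine setLIntegral_mono' measurableSet_Ioc fun s hs => ?_
    have hst : dist (X s x) (extendPath hT.le (Γ x) s) ≤ ε := by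
      have := h9 x ⟨s, hs.1.le, hs.2⟩
      rw [dist_comm]
      unfold extendPath
      rwa [projIcc_of_mem hT.le ⟨hs.1.le, hs.2⟩]
    have e3 : v s x - c s (extendPath hT.le (Γ x) s) = ((v s x - f s (X s x)) +
        (c s (X s x) - c s (extendPath hT.le (Γ x) s))) + (f s (X s x) - c s (X s x)) := by abel
    rw [e3]
    refine (enorm_add_le _ _).trans (add_le_add ?_ le_rfl)
    rw [← ofReal_norm]
    exact ENNReal.ofReal_le_ofReal ((norm_add_le _ _).trans (add_le_add (h8 s hs.1.le x) (hκ _ _ _ hst)))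
  have hmp := approx_mp (T := T) h4 h6
  have hgm : Measurable fun z : ℝ × Torus d => ENNReal.ofReal (ε + κ) + ‖f z.1 (X z.1 z.2) - c z.1 (X z.1 z.2)‖ₑ :=
    measurable_const.add (hfcm.comp hmX).enorm
  have hsum : ∫⁻ x, (∫⁻ s in Ioc 0 T, (ENNReal.ofReal (ε + κ) + ‖f s (X s x) - c s (X s x)‖ₑ)) =
      ENNReal.ofReal (ε + κ) * (spT T d univ) + ∫⁻ z, ‖f z.1 z.2 - c z.1 z.2‖ₑ ∂(spT T d) := by
    have a1 : ∫⁻ z, (ENNReal.ofReal (ε + κ) + ‖f z.1 (X z.1 z.2) - c z.1 (X z.1 z.2)‖ₑ) ∂(spT T d) =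
        ∫⁻ x, (∫⁻ s in Ioc 0 T, (ENNReal.ofReal (ε + κ) + ‖f s (X s x) - c s (X s x)‖ₑ)) := by
      unfold spT
      exact lintegral_prod_symm (fun z : ℝ × Torus d =>
        ENNReal.ofReal (ε + κ) + ‖f z.1 (X z.1 z.2) - c z.1 (X z.1 z.2)‖ₑ) hgm.aemeasurable
    have a2 : ∫⁻ z, ‖f z.1 (X z.1 z.2) - c z.1 (X z.1 z.2)‖ₑ ∂(spT T d) =
        ∫⁻ z, ‖f z.1 z.2 - c z.1 z.2‖ₑ ∂(spT T d) := by
      have := hmp.lintegral_comp (f := fun z : ℝ × Torus d => ‖f z.1 z.2 - c z.1 z.2‖ₑ) hfcm.enorm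
      exact this
    rw [← a1, lintegral_add_left measurable_const, lintegral_const, a2]
  have hbf : AEStronglyMeasurable (fun z : ℝ × Torus d => b z.1 z.2 - f z.1 z.2) (spT T d) :=
    (Measurable.sub (f := fun z : ℝ × Torus d => b z.1 z.2) hb hfc.measurable).aestronglyMeasurable
  have hbc : AEStronglyMeasurable (fun z : ℝ × Torus d => b z.1 z.2 - c z.1 z.2) (spT T d) :=
    (Measurable.sub (f := fun z : ℝ × Torus d => b z.1 z.2) hb hcc.measurable).aestronglyMeasurable
  have hlast : ∫⁻ z, ‖f z.1 z.2 - c z.1 z.2‖ₑ ∂(spT T d) ≤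
      (ENNReal.ofReal ε + ENNReal.ofReal δ) * (spT T d univ) ^ (1 / (2:ℝ)) := by
    have a3 : ∀ z : ℝ × Torus d, ‖f z.1 z.2 - c z.1 z.2‖ₑ ≤ ‖b z.1 z.2 - f z.1 z.2‖ₑ + ‖b z.1 z.2 - c z.1 z.2‖ₑ := by
      intro z
      have : f z.1 z.2 - c z.1 z.2 = -(b z.1 z.2 - f z.1 z.2) + (b z.1 z.2 - c z.1 z.2) := by abel
      rw [this]
      refine (enorm_add_le _ _).trans ?_
      rw [enorm_neg]
    refine (lintegral_mono a3).trans ?_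
    rw [lintegral_add_left' hbf.enorm, add_mul]
    exact add_le_add (L1_of_L2 hbf h2) (L1_of_L2 hbc hcb)
  refine (lintegral_mono hpt).trans ?_
  rw [hsum]
  exact add_le_add le_rfl hlast

lemma limit_curve {T : ℝ} {d : ℕ} (hT : 0 < T) {b c : ℝ → Torus d → Vec d} {δ : ℝ} (hδ : 0 < δ)
    (hb : Measurable (Function.uncurry b))
    (hc : NiceField c)
    (hcb : eLpNorm (fun z : ℝ × Torus d => b z.1 z.2 - c z.1 z.2) 2 (spT T d) ≤ ENNReal.ofReal δ)
    {ε : ℕ → ℝ} (hεp : ∀ n, 0 < ε n) (hε0 : Tendsto ε atTop (𝓝 0))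
    {f : ℕ → ℝ → Torus d → Vec d} {Γ : ℕ → Torus d → PathSpace T d} {X : ℕ → ℝ → Torus d → Torus d}
    {v : ℕ → ℝ → Torus d → Vec d} (hG : ∀ n, GoodApprox b (ε n) (f n) (Γ n) (X n) (v n))
    {U : Ultrafilter ℕ} (hU : (U : Filter ℕ) ≤ atTop)
    {η : ProbabilityMeasure (PathSpace T d)} (hη : ∀ F : BoundedContinuousFunction (PathSpace T d) NNReal,
      Tendsto (fun n => ∫⁻ x, F (Γ n x)) U (𝓝 (∫⁻ γ, F γ ∂(η : Measure (PathSpace T d)))))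
    (t : Icc (0:ℝ) T) :
    ∫⁻ γ, ‖γ t - γ ⟨0, left_mem_Icc.2 hT.le⟩ -
        projT d (∫ s in Ioc (0:ℝ) t, c s (extendPath hT.le γ s))‖ₑ ∂(η : Measure (PathSpace T d)) ≤
      ENNReal.ofReal (δ + δ) * (spT T d univ) +
        (ENNReal.ofReal δ + ENNReal.ofReal δ) * (spT T d univ) ^ (1 / (2:ℝ)) := by
  have hcc := hc.1.continuous
  have hFc : Continuous fun γ : PathSpace T d => ‖γ t - γ ⟨0, left_mem_Icc.2 hT.le⟩ -
        projT d (∫ s in Ioc (0:ℝ) t, c s (extendPath hT.le γ s))‖₊ := by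
    have h1 : Continuous fun γ : PathSpace T d => ∫ s in Ioc (0:ℝ) t, c s (extendPath hT.le γ s) := by
      simp_rw [← intervalIntegral.integral_of_le t.2.1]
      refine intervalIntegral.continuous_parametric_intervalIntegral_of_continuous'
        (f := fun (γ : PathSpace T d) s => c s (extendPath hT.le γ s)) ?_ _ _
      exact hcc.comp (continuous_snd.prodMk ((continuous_extend hT.le).comp continuous_swap))
    exact (((continuous_eval_const t).sub (continuous_eval_const _)).sub (continuous_projT.comp h1)).nnnorm
  obtain ⟨K, hK⟩ : ∃ K : ℝ, ∀ y : Torus d, ‖y‖ ≤ K := by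
    obtain ⟨K, hK⟩ := (isCompact_univ (X := Torus d)).isBounded.exists_norm_le
    exact ⟨K, fun y => hK y (mem_univ _)⟩
  let F : BoundedContinuousFunction (PathSpace T d) NNReal :=
    BoundedContinuousFunction.mkOfBound ⟨_, hFc⟩ (K + K) (fun x y => by
      have hh : ∀ a e : Torus d, dist (‖a‖₊) (‖e‖₊) ≤ K + K := by
        intro a e
        rw [NNReal.dist_eq, coe_nnnorm, coe_nnnorm, abs_le]
        have := hK a; have := hK e; have := norm_nonneg a; have := norm_nonneg e
        constructor <;> linarith
      exact hh _ _)
  have hF : ∀ γ, (F γ : ℝ≥0∞) = ‖γ t - γ ⟨0, left_mem_Icc.2 hT.le⟩ -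
        projT d (∫ s in Ioc (0:ℝ) t, c s (extendPath hT.le γ s))‖ₑ := fun γ => rfl
  have hlim := hη F
  simp_rw [hF] at hlim
  refine le_of_tendsto hlim ?_
  obtain ⟨r, hr, hru⟩ := Metric.uniformContinuous_iff.1 hc.1 δ hδ
  filter_upwards [hU (hε0.eventually_lt_const hr), hU (hε0.eventually_lt_const hδ)] with n hn1 hn2
  refine (good_curve hT hb (hG n) hc hcb hδ.le (hεp n).le (κ := δ) ?_ t).trans ?_
  · intro s x y hxy
    have : dist ((s, x) : ℝ × Torus d) (s, y) < r := by
      rw [Prod.dist_eq]; simpa using hxy.trans_lt hn1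
    have := hru this
    rw [dist_eq_norm] at this
    exact this.le
  · gcongr


/-! ### Existence and conclusion -/

lemma exists_core {T : ℝ} {d : ℕ} (hT : 0 < T) {b : ℝ → Torus d → Vec d}
    (hb : Measurable (Function.uncurry b))
    (hdiv : ∀ᵐ t ∂(volume.restrict (Ioc 0 T)), ∀ ψ : Torus d → ℝ, SmoothT ψ → ∫ y, DT ψ y (b t y) = 0)
    (hL : MemLp (Function.uncurry b) 2 (spT T d))
    (hbI : ∫⁻ t in Ioc 0 T, (∫⁻ x, ‖b t x‖ₑ) < ∞) :
    ∃ η : Measure (PathSpace T d), IsProbabilityMeasure η ∧ ConcentratedOnCurves hT.le b η ∧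
      ∀ t : Icc (0:ℝ) T, Measure.map (fun γ : PathSpace T d => γ t) η = volume := by
  set ε : ℕ → ℝ := fun n => 1 / ((n:ℝ) + 1) with hεdef
  have hεp : ∀ n, 0 < ε n := fun n => by rw [hεdef]; positivity
  have hε1 : ∀ n, ε n ≤ 1 := fun n => by
    rw [hεdef]
    have : (0:ℝ) ≤ n := Nat.cast_nonneg n
    exact (div_le_one (by positivity)).2 (by linarith)
  have hε0 : Tendsto ε atTop (𝓝 0) := tendsto_one_div_add_atTop_nhds_zero_nat
  choose f Γ X v hG using fun n => good_exists hT hb hdiv hL (hεp n)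
  let U : Ultrafilter ℕ := Ultrafilter.of atTop
  have hU : (U : Filter ℕ) ≤ atTop := Ultrafilter.of_le atTop
  obtain ⟨η, hη⟩ := good_tight hb hL hεp hε1 hG U
  have hmarg := good_marginal hε0 hG hU hη
  have hm : ∀ r : ℝ, (η : Measure (PathSpace T d)).map (fun γ => extendPath hT.le γ r) = volume :=
    fun r => hmarg _
  refine ⟨η, inferInstance, ?_, hmarg⟩
  -- integrability along almost every curve
  have hbm : Measurable fun p : PathSpace T d × ℝ => b p.2 (extendPath hT.le p.1 p.2) :=
    hb.comp (measurable_snd.prodMk ((measurable_extend hT.le).comp measurable_swap))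
  have hIntg : ∀ᵐ γ ∂(η : Measure (PathSpace T d)),
      IntegrableOn (fun s => b s (extendPath hT.le γ s)) (Ioc 0 T) volume := by
    have h1 := mass_swap hT.le hm (g := fun z => ‖b z.1 z.2‖ₑ) hb.enorm
    have h2 : ∫⁻ z, ‖b z.1 z.2‖ₑ ∂(spT T d) < ∞ := by
      unfold spT
      rw [lintegral_prod (fun z : ℝ × Torus d => ‖b z.1 z.2‖ₑ) (by exact hb.enorm.aemeasurable)]
      exact hbI
    rw [← h1] at h2
    have h3 := ae_lt_top (Measurable.lintegral_prod_right'
      (f := fun p : PathSpace T d × ℝ => ‖b p.2 (extendPath hT.le p.1 p.2)‖ₑ) hbm.enorm) h2.ne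
    filter_upwards [h3] with γ hγ
    exact ⟨(hbm.comp (measurable_const.prodMk measurable_id)).aestronglyMeasurable, hγ⟩
  -- the equation at a fixed time
  have hfix : ∀ t : Icc (0:ℝ) T, ∀ᵐ γ ∂(η : Measure (PathSpace T d)),
      γ t - γ ⟨0, left_mem_Icc.2 hT.le⟩ - projT d (∫ s in Ioc (0:ℝ) t, b s (extendPath hT.le γ s)) = 0 := by
    intro t
    have hFm : Measurable fun γ : PathSpace T d => γ t - γ ⟨0, left_mem_Icc.2 hT.le⟩ -
        projT d (∫ s in Ioc (0:ℝ) t, b s (extendPath hT.le γ s)) := by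
      have h1 : Measurable fun γ : PathSpace T d => ∫ s in Ioc (0:ℝ) t, b s (extendPath hT.le γ s) :=
        (StronglyMeasurable.integral_prod_right
          (f := fun (γ : PathSpace T d) s => b s (extendPath hT.le γ s)) (by exact hbm.stronglyMeasurable)).measurable
      have h2 : Measurable fun γ : PathSpace T d => γ t - γ ⟨0, left_mem_Icc.2 hT.le⟩ :=
        ((continuous_eval_const t).sub (continuous_eval_const _)).measurable
      exact h2.sub (measurable_projT.comp h1)
    set S := spT T d univ with hS
    have hSf : S ≠ ∞ := measure_ne_top _ _
    set A : ℝ≥0∞ := 2 * S + 3 * S ^ (1 / (2:ℝ)) with hA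
    have hAf : A ≠ ∞ := by
      have := ENNReal.rpow_lt_top_of_nonneg (x := S) (y := 1 / (2:ℝ)) (by norm_num) hSf
      rw [hA]
      exact ENNReal.add_ne_top.2 ⟨ENNReal.mul_ne_top (by simp) hSf, ENNReal.mul_ne_top (by simp) this.ne⟩
    have hbd : ∀ δ : ℝ, 0 < δ → ∫⁻ γ, ‖γ t - γ ⟨0, left_mem_Icc.2 hT.le⟩ -
        projT d (∫ s in Ioc (0:ℝ) t, b s (extendPath hT.le γ s))‖ₑ ∂(η : Measure (PathSpace T d)) ≤
        ENNReal.ofReal δ * A := by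
      intro δ hδ
      obtain ⟨c, hc, hcb⟩ := nice_dense hb hdiv hL hδ
      have hcc := hc.1.continuous
      obtain ⟨M, hM⟩ := hc.2.1
      have hl := limit_curve hT hδ hb hc hcb hεp hε0 hG hU hη t
      have hbcm : Measurable fun z : ℝ × Torus d => b z.1 z.2 - c z.1 z.2 :=
        Measurable.sub (f := fun z : ℝ × Torus d => b z.1 z.2) hb hcc.measurable
      have hsw := mass_swap hT.le hm (g := fun z => ‖b z.1 z.2 - c z.1 z.2‖ₑ) hbcm.enorm
      have hL1 := L1_of_L2 hbcm.aestronglyMeasurable hcb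
      have hpt : ∀ᵐ γ ∂(η : Measure (PathSpace T d)), ‖γ t - γ ⟨0, left_mem_Icc.2 hT.le⟩ -
          projT d (∫ s in Ioc (0:ℝ) t, b s (extendPath hT.le γ s))‖ₑ ≤
          ‖γ t - γ ⟨0, left_mem_Icc.2 hT.le⟩ -
            projT d (∫ s in Ioc (0:ℝ) t, c s (extendPath hT.le γ s))‖ₑ +
          ∫⁻ s in Ioc 0 T, ‖b s (extendPath hT.le γ s) - c s (extendPath hT.le γ s)‖ₑ := by
        filter_upwards [hIntg] with γ hγ
        have hcγ : Measurable fun s => c s (extendPath hT.le γ s) :=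
          hcc.measurable.comp (measurable_id.prodMk ((measurable_extend hT.le).comp
            (measurable_id.prodMk measurable_const)))
        have e1 : γ t - γ ⟨0, left_mem_Icc.2 hT.le⟩ -
            projT d (∫ s in Ioc (0:ℝ) t, b s (extendPath hT.le γ s)) =
            (γ t - γ ⟨0, left_mem_Icc.2 hT.le⟩ - projT d (∫ s in Ioc (0:ℝ) t, c s (extendPath hT.le γ s))) -
            projT d (∫ s in Ioc (0:ℝ) t, (b s (extendPath hT.le γ s) - c s (extendPath hT.le γ s))) := by
          rw [integral_sub, projT_sub]
          · abel
          · exact hγ.mono_set (Ioc_subset_Ioc_right t.2.2)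
          · exact Integrable.of_bound (C := M) hcγ.aestronglyMeasurable (ae_of_all _ fun s => hM s _)
        rw [e1]
        refine enorm_sub_le.trans (add_le_add le_rfl ?_)
        have e2 : ‖projT d (∫ s in Ioc (0:ℝ) t, (b s (extendPath hT.le γ s) - c s (extendPath hT.le γ s)))‖ₑ ≤
            ‖∫ s in Ioc (0:ℝ) t, (b s (extendPath hT.le γ s) - c s (extendPath hT.le γ s))‖ₑ := by
          rw [← ofReal_norm, ← ofReal_norm]
          exact ENNReal.ofReal_le_ofReal (norm_projT_le _)
        exact e2.trans ((enorm_integral_le_lintegral_enorm _).trans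
          (lintegral_mono_set (Ioc_subset_Ioc_right t.2.2)))
      refine (lintegral_mono_ae hpt).trans ?_
      have hmI : Measurable fun γ : PathSpace T d => ∫⁻ s in Ioc 0 T,
          ‖b s (extendPath hT.le γ s) - c s (extendPath hT.le γ s)‖ₑ :=
        Measurable.lintegral_prod_right'
          (f := fun p : PathSpace T d × ℝ => ‖b p.2 (extendPath hT.le p.1 p.2) - c p.2 (extendPath hT.le p.1 p.2)‖ₑ)
          (hbcm.comp (measurable_snd.prodMk ((measurable_extend hT.le).comp measurable_swap))).enorm
      rw [lintegral_add_right _ hmI, hsw]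
      refine (add_le_add hl hL1).trans (le_of_eq ?_)
      rw [ENNReal.ofReal_add hδ.le hδ.le, hA]
      ring
    have hz : ∫⁻ γ, ‖γ t - γ ⟨0, left_mem_Icc.2 hT.le⟩ -
        projT d (∫ s in Ioc (0:ℝ) t, b s (extendPath hT.le γ s))‖ₑ ∂(η : Measure (PathSpace T d)) = 0 := by
      refine le_antisymm ?_ zero_le
      have hlim : Tendsto (fun n => ENNReal.ofReal (ε n) * A) atTop (𝓝 0) := by
        have h1 : Tendsto (fun n => ENNReal.ofReal (ε n)) atTop (𝓝 0) := by
          simpa using ENNReal.tendsto_ofReal hε0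
        simpa using ENNReal.Tendsto.mul_const h1 (Or.inr hAf)
      exact ge_of_tendsto' hlim fun n => hbd _ (hεp n)
    rw [lintegral_eq_zero_iff hFm.enorm] at hz
    filter_upwards [hz] with γ hγ
    exact enorm_eq_zero.1 hγ
  -- all times at once
  obtain ⟨D, hDc, hDd⟩ := TopologicalSpace.exists_countable_dense (Icc (0:ℝ) T)
  have hall := (ae_ball_iff hDc).2 fun t (_ : t ∈ D) => hfix t
  filter_upwards [hIntg, hall] with γ hγ1 hγ2
  refine ⟨hγ1, ?_⟩
  have hcI : Continuous fun t : Icc (0:ℝ) T => ∫ s in Ioc (0:ℝ) t, b s (extendPath hT.le γ s) := by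
    have h1 : ContinuousOn (fun t : ℝ => ∫ s in Ioc (0:ℝ) t, b s (extendPath hT.le γ s)) (Icc 0 T) :=
      intervalIntegral.continuousOn_primitive
        ((integrableOn_Icc_iff_integrableOn_Ioc).2 hγ1)
    exact continuousOn_iff_continuous_domRestrict.1 h1
  have hcont : Continuous fun t : Icc (0:ℝ) T => γ ⟨0, left_mem_Icc.2 hT.le⟩ +
      projT d (∫ s in Ioc (0:ℝ) t, b s (extendPath hT.le γ s)) :=
    continuous_const.add (continuous_projT.comp hcI)
  have heq := Continuous.ext_on hDd γ.continuous hcont (fun t ht => by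
    have := hγ2 t ht
    rw [sub_sub, sub_eq_zero] at this
    exact this)
  intro t
  exact congrFun heq t

/-- existence and uniqueness of the incompressible probability measure
concentrated on integral curves of a divergence-free field
`b ∈ L¹_loc((0,T]; BV) ∩ L^q L^p` with `d/p + 2/q < 1`. -/
theorem stmt_15 (T : ℝ) (hT : 0 < T) (d : ℕ) (b : ℝ → Torus d → Vec d)
    (hb : Measurable (Function.uncurry b))
    (hdiv : DivergenceFree T d b)
    (p q : ℝ≥0∞) (hp : 1 < p) (hq : 1 < q)
    (hpq : (d : ℝ≥0∞) / p + 2 / q < 1)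
    (hLqLp : MemLqLp T d p q b)
    (hBV : MemL1locBVIoc T d b) :
    ∃! η : Measure (PathSpace T d),
      IsProbabilityMeasure η ∧
      ConcentratedOnCurves hT.le b η ∧
      ∀ t : Set.Icc (0 : ℝ) T,
        Measure.map (fun γ : PathSpace T d => γ t) η = (volume : Measure (Torus d)) := by
  have hdiv' := divFree_ae hb hdiv
  have hbI := ps_L1 hb hp hpq hLqLp
  have h2 := ps_L2 hb hdiv hp hpq hLqLp
  have hL : MemLp (Function.uncurry b) 2 (spT T d) := by
    refine ⟨hb.aestronglyMeasurable, ?_⟩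
    rw [eLpNorm_lt_top_iff_lintegral_rpow_enorm_lt_top (by simp) (by simp)]
    have h3 : ∫⁻ z, ‖b z.1 z.2‖ₑ ^ 2 ∂(spT T d) < ∞ := by
      unfold spT
      rw [lintegral_prod (fun z : ℝ × Torus d => ‖b z.1 z.2‖ₑ ^ 2)
        (by exact (hb.enorm.pow_const 2).aemeasurable)]
      exact h2
    refine lt_of_le_of_lt (le_of_eq ?_) h3
    refine lintegral_congr fun z => ?_
    simp [Function.uncurry]
  obtain ⟨η, hη1, hη2, hη3⟩ := exists_core hT hb hdiv' hL hbI
  obtain ⟨V, hV, hVf⟩ := bv_ae hb hdiv hbI hBV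
  refine ⟨η, ⟨hη1, hη2, hη3⟩, ?_⟩
  rintro η' ⟨h1', h2', h3'⟩
  exact unique_core hT hb h2' hη2 (fun r => h3' _) (fun r => hη3 _) hbI hV hVf
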